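/- Let F be a finite field, let a, b ≥ 3 be integers, set n = a + b and I = {1,…,n−1} \ {a}. Then the standard maximal parabolic subgroup P_I(F[t,t⁻¹]) ≤ SL_n(F[t,t⁻¹]), whose Levi factor has diagonal blocks of sizes a and b, is finitely presented. -/

import Mathlib

/-- A group is finitely presented if it is isomorphic to the quotient of a
finitely generated free group by the normal closure of a finite set. -/
def IsFinitelyPresented (G : Type*) [Group G] : Prop :=
  ∃ (m : ℕ) (S : Finset (FreeGroup (Fin m))),
    Nonempty ((FreeGroup (Fin m) ⧸ Subgroup.normalClosure (S : Set (FreeGroup (Fin m)))) ≃* G)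

/-- The elementary matrix `1 + r·E i j` as an element of `SL_n(R)`. -/
def elemMat {n : ℕ} {R : Type*} [CommRing R] (i j : Fin n) (hij : i ≠ j) (r : R) :
    Matrix.SpecialLinearGroup (Fin n) R :=
  ⟨Matrix.transvection i j r, Matrix.det_transvection_of_ne i j hij r⟩

/-- The set of diagonal matrices in `SL_n(R)`. -/
def diagMats (n : ℕ) (R : Type*) [CommRing R] :
    Set (Matrix.SpecialLinearGroup (Fin n) R) :=
  {g | (g : Matrix (Fin n) (Fin n) R).IsDiag}

/-- For (0-based) indices `i < j` in `Fin n`, the (1-based) pair `(i+1, j+1)` is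
`I`-connected if every simple-root index `k` with `i+1 ≤ k ≤ j` lies in `I`. -/
def IConn {n : ℕ} (I : Set ℕ) (i j : Fin n) : Prop :=
  ∀ k : ℕ, i.val + 1 ≤ k → k ≤ j.val → k ∈ I

/-- Upper elementary matrices `e_{ij}(r)` with `i < j` a `J`-connected pair. -/
def upperElems (n : ℕ) (R : Type*) [CommRing R] (J : Set ℕ) :
    Set (Matrix.SpecialLinearGroup (Fin n) R) :=
  {g | ∃ (i j : Fin n) (h : i < j) (r : R), IConn J i j ∧ g = elemMat i j (ne_of_lt h) r}

/-- All upper elementary matrices `e_{ij}(r)`, `i < j`. -/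
def allUpperElems (n : ℕ) (R : Type*) [CommRing R] :
    Set (Matrix.SpecialLinearGroup (Fin n) R) :=
  {g | ∃ (i j : Fin n) (h : i < j) (r : R), g = elemMat i j (ne_of_lt h) r}

/-- Lower elementary matrices `e_{ji}(r)` with `i < j` an `I`-connected pair. -/
def lowerElems (n : ℕ) (R : Type*) [CommRing R] (I : Set ℕ) :
    Set (Matrix.SpecialLinearGroup (Fin n) R) :=
  {g | ∃ (i j : Fin n) (h : i < j) (r : R), IConn I i j ∧ g = elemMat j i (ne_of_gt h) r}

/-- The standard parabolic subgroup `P_I(R) ≤ SL_n(R)`. -/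
def parabolic (n : ℕ) (R : Type*) [CommRing R] (I : Set ℕ) :
    Subgroup (Matrix.SpecialLinearGroup (Fin n) R) :=
  Subgroup.closure (diagMats n R ∪ allUpperElems n R ∪ lowerElems n R I)

/-- The Levi factor `L_I(R) ≤ SL_n(R)`. -/
def levi (n : ℕ) (R : Type*) [CommRing R] (I : Set ℕ) :
    Subgroup (Matrix.SpecialLinearGroup (Fin n) R) :=
  Subgroup.closure (diagMats n R ∪ upperElems n R I ∪ lowerElems n R I)

/-- `Adj(I)`: simple-root indices not in `I` adjacent to an element of `I`. -/
def adjSet (n : ℕ) (I : Set ℕ) : Set ℕ :=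
  {k | k ∈ Set.Icc 1 (n - 1) ∧ k ∉ I ∧ (k - 1 ∈ I ∨ k + 1 ∈ I)}

/-- `nonAdj(I)`: simple-root indices neither in `I` nor adjacent to `I`. -/
def nonAdjSet (n : ℕ) (I : Set ℕ) : Set ℕ :=
  Set.Icc 1 (n - 1) \ (I ∪ adjSet n I)

/-- The extended Levi factor `LE_I(R)` (for `I ≠ ∅`): generated by the Levi factor
together with all `e_{ij}(r)`, `i < j` a `nonAdj(I)`-connected pair. -/
def extLevi (n : ℕ) (R : Type*) [CommRing R] (I : Set ℕ) :
    Subgroup (Matrix.SpecialLinearGroup (Fin n) R) :=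
  Subgroup.closure (diagMats n R ∪ upperElems n R I ∪ lowerElems n R I ∪
    upperElems n R (nonAdjSet n I))

section
open LaurentPolynomial
open scoped Matrix MatrixGroups

theorem isFinitelyPresented_of_forall_injective {G : Type*} [Group G] (X : Set G)
    (hX : X.Finite) (hgen : Subgroup.closure X = ⊤) (K : ℕ)
    (H : ∀ (Γ : Type) [Group Γ] (lam : G → Γ) (π : Γ →* G), (∀ x ∈ X, π (lam x) = x) →
      Subgroup.closure (lam '' X) = ⊤ →
      (∀ l l' : List G, (∀ x ∈ l, x ∈ X) → (∀ x ∈ l', x ∈ X) → l.length ≤ K → l'.length ≤ K →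
        l.prod = l'.prod → (l.map lam).prod = (l'.map lam).prod) → Function.Injective π) :
    IsFinitelyPresented G := by
  classical
  have : Finite X := hX
  obtain ⟨m, ⟨e⟩⟩ := Finite.exists_equiv_fin X
  let w : G → FreeGroup (Fin m) := fun g => if h : g ∈ X then FreeGroup.of (e ⟨g, h⟩) else 1
  let LS : Set (List G) := {l | (∀ x ∈ l, x ∈ X) ∧ l.length ≤ K}
  have hLS : LS.Finite := by
    refine ((List.finite_length_le X K).image (List.map Subtype.val)).subset ?_
    rintro l ⟨h1, h2⟩
    refine ⟨l.attach.map fun x => ⟨x.1, h1 x.1 x.2⟩, ?_, ?_⟩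
    · simpa using h2
    · simp [List.map_map, Function.comp_def]
  let RS : Set (FreeGroup (Fin m)) :=
    (fun p : List G × List G => (p.1.map w).prod * ((p.2.map w).prod)⁻¹) ''
      {p | (p.1 ∈ LS ∧ p.2 ∈ LS) ∧ p.1.prod = p.2.prod}
  have hRS : RS.Finite :=
    Set.Finite.image _ ((hLS.prod hLS).subset fun p hp => ⟨hp.1.1, hp.1.2⟩)
  obtain ⟨Sf, hSf⟩ := hRS.exists_finset_coe
  let φ : FreeGroup (Fin m) →* G := FreeGroup.lift fun i => ((e.symm i : X) : G)
  have hφw : ∀ x ∈ X, φ (w x) = x := by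
    intro x hx
    simp [φ, w, hx]
  have hφl : ∀ l : List G, (∀ x ∈ l, x ∈ X) → φ ((l.map w).prod) = l.prod := by
    intro l hl
    rw [map_list_prod, List.map_map]
    congr 1
    conv_rhs => rw [← List.map_id l]
    exact List.map_congr_left fun x hx => hφw x (hl x hx)
  let N := Subgroup.normalClosure (Sf : Set (FreeGroup (Fin m)))
  have hN : N ≤ φ.ker := by
    refine Subgroup.normalClosure_le_normal ?_
    rw [hSf]
    rintro _ ⟨p, ⟨⟨h1, h2⟩, h3⟩, rfl⟩
    change φ _ = 1
    rw [map_mul, map_inv, hφl _ h1.1, hφl _ h2.1, h3, mul_inv_cancel]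
  let π : FreeGroup (Fin m) ⧸ N →* G := QuotientGroup.lift N φ hN
  let lam : G → FreeGroup (Fin m) ⧸ N := fun g => QuotientGroup.mk' N (w g)
  have hπ : ∀ x ∈ X, π (lam x) = x := fun x hx => hφw x hx
  have hsurj : Function.Surjective π := by
    rw [← MonoidHom.range_eq_top, eq_top_iff, ← hgen, Subgroup.closure_le]
    exact fun x hx => ⟨lam x, hπ x hx⟩
  have hgen' : Subgroup.closure (lam '' X) = ⊤ := by
    have : Subgroup.closure (w '' X) = ⊤ := by
      rw [eq_top_iff, ← FreeGroup.closure_range_of, Subgroup.closure_le]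
      rintro _ ⟨i, rfl⟩
      refine Subgroup.subset_closure ⟨(e.symm i : X), (e.symm i).2, ?_⟩
      simp [w]
    have h2 := congrArg (Subgroup.map (QuotientGroup.mk' N)) this
    rw [MonoidHom.map_closure, ← Set.image_comp] at h2
    rw [show lam = (QuotientGroup.mk' N) ∘ w from rfl, h2]
    exact Subgroup.map_top_of_surjective _ (QuotientGroup.mk'_surjective N)
  have hinj := H _ lam π hπ hgen' (by
    intro l l' h1 h2 h3 h4 h5
    have hm : ∀ l : List G, (l.map lam).prod = QuotientGroup.mk' N ((l.map w).prod) := by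
      intro l
      rw [map_list_prod, List.map_map]; rfl
    rw [hm, hm, ← mul_inv_eq_one, ← map_inv, ← map_mul]
    refine (QuotientGroup.eq_one_iff _).2 (Subgroup.subset_normalClosure ?_)
    rw [hSf]
    exact ⟨(l, l'), ⟨⟨⟨h1, h3⟩, ⟨h2, h4⟩⟩, h5⟩, rfl⟩)
  exact ⟨m, Sf, ⟨MulEquiv.ofBijective π ⟨hinj, hsurj⟩⟩⟩

theorem laurent_add_induction {F : Type*} [Field F] {P : F[T;T⁻¹] → Prop}
    (h0 : P 0) (hadd : ∀ f g, P f → P g → P (f + g))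
    (hmon : ∀ (c : F) (p : ℤ), P (C c * T p)) (f : F[T;T⁻¹]) : P f :=
  LaurentPolynomial.induction_on' f hadd fun n a => hmon a n

theorem vec_induction {F : Type*} [Field F] {κ : Type*} [Fintype κ] [DecidableEq κ]
    {P : (κ → F[T;T⁻¹]) → Prop} (s : κ → Prop)
    (h0 : P 0) (hadd : ∀ f g, P f → P g → P (f + g))
    (hmon : ∀ k, s k → ∀ (p : ℤ) (c : F), P (Pi.single k (C c * T p)))
    (f : κ → F[T;T⁻¹]) (hf : ∀ k, ¬ s k → f k = 0) : P f := by
  have h1 : ∀ k, s k → ∀ r : F[T;T⁻¹], P (Pi.single k r) := by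
    intro k hk r
    refine laurent_add_induction (P := fun r => P (Pi.single k r)) ?_ ?_ ?_ r
    · simpa using h0
    · intro f g hf hg
      rw [Pi.single_add]; exact hadd _ _ hf hg
    · exact fun c p => hmon k hk p c
  have h2 : ∀ t : Finset κ, P (∑ k ∈ t, Pi.single k (f k)) := by
    intro t
    induction t using Finset.induction_on with
    | empty => simpa using h0
    | insert k t hk ih =>
      rw [Finset.sum_insert hk]
      refine hadd _ _ ?_ ih
      by_cases hs : s k
      · exact h1 k hs _
      · rw [hf k hs]; simpa using h0
  have := h2 Finset.univ
  rwa [Finset.univ_sum_single] at this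

theorem exists_hom_of_commGroup {F : Type*} [Field F] {A : Type*} [CommGroup A] {κ : Type*}
    [Fintype κ] [DecidableEq κ] (y : κ → ℤ → F → A)
    (hadd : ∀ k p c c', y k p (c + c') = y k p c * y k p c') :
    ∃ θ : (κ → F[T;T⁻¹]) → A, (∀ f g, θ (f + g) = θ f * θ g) ∧
      (∀ k p c, θ (Pi.single k (C c * T p)) = y k p c) := by
  let y1 : κ → ℤ → (F →+ Additive A) := fun k p =>
    AddMonoidHom.mk' (fun c => Additive.ofMul (y k p c)) (fun c c' => by
      apply Additive.toMul.injective
      exact hadd k p c c')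
  let y2 : κ → (F[T;T⁻¹] →+ Additive A) := fun k =>
    (Finsupp.liftAddHom (y1 k)).comp
      (AddMonoidAlgebra.coeffAddEquiv (R := F) (M := ℤ)).toAddMonoidHom
  refine ⟨fun f => (∑ k, y2 k (f k)).toMul, fun f g => ?_, fun k p c => ?_⟩
  · simp only [Pi.add_apply, map_add, Finset.sum_add_distrib, toMul_add]
  · dsimp only
    rw [Finset.sum_eq_single k]
    · rw [Pi.single_eq_same, ← LaurentPolynomial.single_eq_C_mul_T]
      simp only [y2, AddMonoidHom.comp_apply]
      change Additive.toMul ((Finsupp.liftAddHom (y1 k)) (Finsupp.single p c)) = _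
      rw [Finsupp.liftAddHom_apply_single]; rfl
    · intro j _ hj
      rw [Pi.single_eq_of_ne hj, map_zero]
    · simp

theorem exists_hom_of_commuting {F : Type*} [Field F] {Γ : Type*} [Group Γ] {κ : Type*}
    [Fintype κ] [DecidableEq κ] (y : κ → ℤ → F → Γ)
    (hadd : ∀ k p c c', y k p (c + c') = y k p c * y k p c')
    (hcomm : ∀ k p c k' p' c', y k p c * y k' p' c' = y k' p' c' * y k p c) :
    ∃ θ : (κ → F[T;T⁻¹]) → Γ, (∀ f g, θ (f + g) = θ f * θ g) ∧
      (∀ k p c, θ (Pi.single k (C c * T p)) = y k p c) ∧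
      (∀ f, θ f ∈ Subgroup.closure {g | ∃ k p c, g = y k p c}) := by
  let H := Subgroup.closure {g | ∃ k p c, g = y k p c}
  have : IsMulCommutative H := Subgroup.isMulCommutative_closure (by
    rintro _ ⟨k, p, c, rfl⟩ _ ⟨k', p', c', rfl⟩
    exact hcomm _ _ _ _ _ _)
  let _ : CommGroup H := { (inferInstance : Group H) with mul_comm := this.is_comm.comm }
  obtain ⟨θ, h1, h2⟩ := exists_hom_of_commGroup (A := H)
    (fun k p c => ⟨y k p c, Subgroup.subset_closure ⟨k, p, c, rfl⟩⟩)
    (fun k p c c' => Subtype.ext (hadd k p c c'))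
  refine ⟨fun f => (θ f : Γ), fun f g => ?_, fun k p c => ?_, fun f => (θ f).2⟩
  · dsimp only
    rw [h1]; rfl
  · dsimp only
    rw [h2]

theorem closure_conj_mem {Γ : Type*} [Group Γ] {S Y : Set Γ}
    (hS : ∀ s ∈ S, s⁻¹ ∈ S)
    (h : ∀ s ∈ S, ∀ y ∈ Y, s * y * s⁻¹ ∈ Subgroup.closure Y) {s y : Γ}
    (hs : s ∈ Subgroup.closure S) (hy : y ∈ Subgroup.closure Y) :
    s * y * s⁻¹ ∈ Subgroup.closure Y := by
  have key : ∀ s ∈ S, ∀ y ∈ Subgroup.closure Y, s * y * s⁻¹ ∈ Subgroup.closure Y := by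
    intro s hs y hy
    induction hy using Subgroup.closure_induction with
    | mem y hy => exact h s hs y hy
    | one => simp
    | mul a b _ _ ha hb =>
      have := mul_mem ha hb
      simpa [mul_assoc] using this
    | inv a _ ha =>
      have := inv_mem ha
      simpa [mul_assoc] using this
  induction hs using Subgroup.closure_induction_left generalizing y with
  | one => simpa using hy
  | mul_left a ha b _ hb =>
    have := key a ha _ (hb hy)
    simpa [mul_assoc] using this
  | inv_mul_cancel a ha b _ hb =>
    have := key _ (hS a ha) _ (hb hy)
    simpa [mul_assoc] using this

/-- The subgroup of products `n * h` when `H` normalizes `N`. -/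
def normProd {Γ : Type*} [Group Γ] (N H : Subgroup Γ)
    (h : ∀ x ∈ H, ∀ y ∈ N, x * y * x⁻¹ ∈ N) : Subgroup Γ where
  carrier := {g | ∃ n ∈ N, ∃ x ∈ H, g = n * x}
  mul_mem' := by
    rintro _ _ ⟨n, hn, x, hx, rfl⟩ ⟨n', hn', x', hx', rfl⟩
    exact ⟨n * (x * n' * x⁻¹), mul_mem hn (h x hx _ hn'), x * x', mul_mem hx hx', by group⟩
  one_mem' := ⟨1, one_mem _, 1, one_mem _, by simp⟩
  inv_mem' := by
    rintro _ ⟨n, hn, x, hx, rfl⟩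
    exact ⟨x⁻¹ * n⁻¹ * x⁻¹⁻¹, h _ (inv_mem hx) _ (inv_mem hn), x⁻¹, inv_mem hx, by group⟩

section RowMat

variable {ι : Type*} [Fintype ι] [DecidableEq ι] {S : Type*} [CommRing S]

/-- The identity matrix with row `m` replaced by `r` off the diagonal. -/
def rowMat (m : ι) (r : ι → S) : Matrix ι ι S :=
  1 + Matrix.vecMulVec (Pi.single m 1) (Function.update r m 0)

theorem rowMat_mul (m : ι) (r r' : ι → S) : rowMat m r * rowMat m r' = rowMat m (r + r') := by
  have : Matrix.vecMulVec (Pi.single m (1 : S)) (Function.update r m 0) *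
      Matrix.vecMulVec (Pi.single m 1) (Function.update r' m 0) = 0 := by
    rw [Matrix.vecMulVec_mul_vecMulVec]
    simp
  have h2 : Function.update (r + r') m 0 = Function.update r m 0 + Function.update r' m 0 := by
    ext j
    by_cases h : j = m
    · subst h; simp
    · simp [h]
  rw [rowMat, rowMat, rowMat, h2, Matrix.vecMulVec_add, mul_add, add_mul, add_mul, this]
  simp [add_assoc]

theorem rowMat_zero (m : ι) : rowMat m (0 : ι → S) = 1 := by
  simp [rowMat]

/-- `rowMat m r` as an invertible matrix. -/
def rowUnit (m : ι) (r : ι → S) : GL ι S where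
  val := rowMat m r
  inv := rowMat m (-r)
  val_inv := by rw [rowMat_mul]; simp [rowMat_zero]
  inv_val := by rw [rowMat_mul]; simp [rowMat_zero]

theorem rowUnit_val (m : ι) (r : ι → S) : (rowUnit m r : Matrix ι ι S) = rowMat m r := rfl

theorem rowUnit_mul (m : ι) (r r' : ι → S) : rowUnit m r * rowUnit m r' = rowUnit m (r + r') :=
  Units.ext (rowMat_mul m r r')

theorem rowUnit_zero (m : ι) : rowUnit m (0 : ι → S) = 1 :=
  Units.ext (rowMat_zero m)

theorem rowMat_of_eq_zero {m : ι} {r : ι → S} (h : r m = 0) :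
    rowMat m r = 1 + Matrix.vecMulVec (Pi.single m 1) r := by
  rw [rowMat, ← h, Function.update_eq_self]

theorem rowMat_mulVec {m : ι} {r : ι → S} (h : r m = 0) (v : ι → S) :
    rowMat m r *ᵥ v = v + Pi.single m (r ⬝ᵥ v) := by
  rw [rowMat_of_eq_zero h, Matrix.add_mulVec, Matrix.one_mulVec, Matrix.vecMulVec_mulVec]
  congr 1
  ext i
  by_cases hi : i = m
  · subst hi; simp
  · simp [hi]

theorem rowMat_apply (m : ι) (r : ι → S) (i j : ι) :
    rowMat m r i j = if i = j then 1 else if i = m then r j else 0 := by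
  rw [rowMat]
  by_cases hij : i = j
  · subst hij
    by_cases him : i = m
    · subst him; simp [Matrix.vecMulVec_apply]
    · simp [Matrix.vecMulVec_apply, him]
  · by_cases him : i = m
    · subst him; simp [Matrix.vecMulVec_apply, hij, Function.update_of_ne (Ne.symm hij)]
    · simp [Matrix.vecMulVec_apply, him, hij]

/-- A diagonal matrix with unit entries as an invertible matrix. -/
def diagUnit (d : ι → Sˣ) : GL ι S where
  val := Matrix.diagonal fun i => (d i : S)
  inv := Matrix.diagonal fun i => ((d i)⁻¹ : Sˣ)
  val_inv := by simp [Matrix.diagonal_mul_diagonal]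
  inv_val := by simp [Matrix.diagonal_mul_diagonal]

theorem diagUnit_mul (d d' : ι → Sˣ) : diagUnit d * diagUnit d' = diagUnit (d * d') :=
  Units.ext (by simp [diagUnit, Matrix.diagonal_mul_diagonal])

theorem rowMat_single {i j : ι} (hij : i ≠ j) (c : S) :
    rowMat i (Pi.single j c) = Matrix.transvection i j c := by
  ext k l
  rw [rowMat_apply, Matrix.transvection, Matrix.add_apply, Matrix.one_apply, Matrix.single_apply]
  by_cases hkl : k = l
  · subst hkl
    have : ¬ (i = k ∧ j = k) := fun h => hij (h.1.trans h.2.symm)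
    simp [this]
  · by_cases hki : k = i
    · subst hki
      by_cases hlj : l = j
      · subst hlj; simp [hkl]
      · simp [hkl, hlj, Ne.symm hlj]
    · simp [hkl, hki, Ne.symm hki]

end RowMat

theorem GL_induction {F : Type*} [Field F] {ι : Type*} [Fintype ι] [DecidableEq ι]
    {P : GL ι F → Prop} (hmul : ∀ g h, P g → P h → P (g * h))
    (hdiag : ∀ d : ι → Fˣ, P (diagUnit d))
    (helem : ∀ i j, i ≠ j → ∀ c : F, P (rowUnit i (Pi.single j c))) (g : GL ι F) : P g := by
  have key := Matrix.diagonal_transvection_induction_of_det_ne_zero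
    (fun M : Matrix ι ι F => ∃ g : GL ι F, (g : Matrix ι ι F) = M ∧ P g) (g : Matrix ι ι F)
    (by have := (Matrix.isUnit_iff_isUnit_det (g : Matrix ι ι F)).1 g.isUnit
        exact this.ne_zero) ?_ ?_ ?_
  · obtain ⟨g', h1, h2⟩ := key
    rwa [← Units.ext h1]
  · intro D hD
    rw [Matrix.det_diagonal] at hD
    have h3 : ∀ i, D i ≠ 0 := fun i => (Finset.prod_ne_zero_iff.1 hD) i (Finset.mem_univ i)
    exact ⟨diagUnit fun i => Units.mk0 (D i) (h3 i), by simp [diagUnit], hdiag _⟩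
  · intro t
    exact ⟨rowUnit t.i (Pi.single t.j t.c), rowMat_single t.hij t.c, helem _ _ t.hij _⟩
  · rintro A B _ _ ⟨g, rfl, hg⟩ ⟨h, rfl, hh⟩
    exact ⟨g * h, rfl, hmul g h hg hh⟩

end

section
open Polynomial
open scoped Matrix MatrixGroups

variable {F : Type*} [Field F] {ι : Type*} [Fintype ι] [DecidableEq ι]

/-- The action of a constant invertible matrix on polynomial vectors. -/
noncomputable def constAct (h : GL ι F) (v : ι → F[X]) : ι → F[X] := (h : Matrix ι ι F).map C *ᵥ v

theorem constAct_mul (g h : GL ι F) (v : ι → F[X]) :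
    constAct (g * h) v = constAct g (constAct h v) := by
  simp [constAct, Matrix.mulVec_mulVec, Matrix.map_mul]

theorem constAct_one (v : ι → F[X]) : constAct (1 : GL ι F) v = v := by
  simp [constAct]

theorem constAct_add (h : GL ι F) (v w : ι → F[X]) :
    constAct h (v + w) = constAct h v + constAct h w :=
  Matrix.mulVec_add _ _ _

theorem constAct_inv_self (h : GL ι F) (v : ι → F[X]) : constAct h⁻¹ (constAct h v) = v := by
  rw [← constAct_mul, inv_mul_cancel, constAct_one]

theorem constAct_apply (h : GL ι F) (v : ι → F[X]) (i : ι) :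
    constAct h v i = ∑ j, C (h i j) * v j := by
  simp [constAct, Matrix.mulVec, dotProduct]

theorem coeff_constAct (h : GL ι F) (v : ι → F[X]) (n : ℕ) (i : ι) :
    (constAct h v i).coeff n = ((h : Matrix ι ι F) *ᵥ fun j => (v j).coeff n) i := by
  rw [constAct_apply, finset_sum_coeff]
  simp [Matrix.mulVec, dotProduct]

theorem constAct_C (h : GL ι F) (t : ι → F) :
    constAct h (fun i => C (t i)) = fun i => C (((h : Matrix ι ι F) *ᵥ t) i) := by
  ext1 i
  rw [constAct_apply]
  simp [Matrix.mulVec, dotProduct, map_sum]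

/-- The action of `rowMat m f` on vectors, for `f m = 0`. -/
noncomputable def shear (m : ι) (f v : ι → F[X]) : ι → F[X] := v + Pi.single m (f ⬝ᵥ v)

theorem shear_apply_ne {m i : ι} (h : i ≠ m) (f v : ι → F[X]) : shear m f v i = v i := by
  simp [shear, h]

theorem shear_apply_self (m : ι) (f v : ι → F[X]) : shear m f v m = v m + f ⬝ᵥ v := by
  simp [shear]

theorem dotProduct_shear {m : ι} (g f v : ι → F[X]) :
    g ⬝ᵥ shear m f v = g ⬝ᵥ v + g m * (f ⬝ᵥ v) := by
  simp [shear, dotProduct_add]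

theorem shear_shear {m : ι} {f g : ι → F[X]} (hg : g m = 0) (v : ι → F[X]) :
    shear m g (shear m f v) = shear m (f + g) v := by
  rw [shear, dotProduct_shear, hg, zero_mul, add_zero, shear, shear, add_dotProduct,
    Pi.single_add, add_assoc]

theorem shear_zero (m : ι) (v : ι → F[X]) : shear m 0 v = v := by
  simp [shear]

/-- The vector `f` vanishes outside `J`. -/
def SuppIn {S : Type*} [Zero S] (J : Finset ι) (f : ι → S) : Prop := ∀ i, i ∉ J → f i = 0

/-- Invertible matrices equal to the identity outside the block `J × J`. -/
def blockGL (F : Type*) [Field F] {ι : Type*} [Fintype ι] [DecidableEq ι] (J : Finset ι) :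
    Subgroup (GL ι F) where
  carrier := {h | ∀ i j, (i ∉ J ∨ j ∉ J) → h i j = (1 : Matrix ι ι F) i j}
  one_mem' := fun i j _ => rfl
  mul_mem' := by
    intro g h hg hh i j hij
    change ((g : Matrix ι ι F) * (h : Matrix ι ι F)) i j = _
    rw [Matrix.mul_apply]
    rcases hij with hi | hj
    · rw [Finset.sum_congr rfl fun k _ => by rw [hg i k (Or.inl hi)]]
      rw [← Matrix.mul_apply, one_mul, hh i j (Or.inl hi)]
    · rw [Finset.sum_congr rfl fun k _ => by rw [hh k j (Or.inr hj)]]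
      rw [← Matrix.mul_apply, mul_one, hg i j (Or.inr hj)]
  inv_mem' := by
    intro g hg i j hij
    rcases hij with hi | hj
    · have : ((g : Matrix ι ι F) * (g⁻¹ : GL ι F)) i j = (1 : Matrix ι ι F) i j := by
        rw [← Units.val_mul, mul_inv_cancel]; rfl
      rw [Matrix.mul_apply, Finset.sum_congr rfl fun k _ => by rw [hg i k (Or.inl hi)],
        ← Matrix.mul_apply, one_mul] at this
      exact this
    · have : (((g⁻¹ : GL ι F) : Matrix ι ι F) * g) i j = (1 : Matrix ι ι F) i j := by
        rw [← Units.val_mul, inv_mul_cancel]; rfl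
      rw [Matrix.mul_apply, Finset.sum_congr rfl fun k _ => by rw [hg k j (Or.inr hj)],
        ← Matrix.mul_apply, mul_one] at this
      exact this

/-- The identity matrix with column `k` replaced by `t`. -/
noncomputable def colUnit (k : ι) (t : ι → F) (ht : t k ≠ 0) : GL ι F :=
  Matrix.GeneralLinearGroup.mkOfDetNeZero (Matrix.updateCol 1 k t) (by
    rwa [← Matrix.cramer_apply, Matrix.cramer_one])

theorem colUnit_apply (k : ι) (t : ι → F) (ht : t k ≠ 0) (i j : ι) :
    colUnit k t ht i j = if j = k then t i else (1 : Matrix ι ι F) i j := by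
  change Matrix.updateCol 1 k t i j = _
  rw [Matrix.updateCol_apply]

theorem colUnit_mem {J : Finset ι} {k : ι} (hk : k ∈ J) {t : ι → F} (ht : t k ≠ 0)
    (hJ : SuppIn J t) : colUnit k t ht ∈ blockGL F J := by
  intro i j hij
  rw [colUnit_apply]
  split_ifs with h
  · subst h
    have hi : i ∉ J := hij.resolve_right (fun h => h hk)
    rw [hJ i hi, Matrix.one_apply_ne]
    rintro rfl; exact hi hk
  · rfl

theorem colUnit_mulVec (k : ι) (t : ι → F) (ht : t k ≠ 0) :
    (colUnit k t ht : Matrix ι ι F) *ᵥ Pi.single k 1 = t := by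
  ext i
  rw [Matrix.mulVec_single_one]
  simp [Matrix.col_apply, colUnit_apply]

/-- The permutation matrix of the transposition of `i` and `j`. -/
def swapGL (F : Type*) [Field F] {ι : Type*} [Fintype ι] [DecidableEq ι] (i j : ι) : GL ι F :=
  Matrix.GeneralLinearGroup.swap F i j

theorem swapGL_apply (i j k l : ι) :
    swapGL F i j k l = if Equiv.swap i j k = l then 1 else 0 := by
  change Matrix.swap F i j k l = _
  simp [Matrix.swap, Equiv.Perm.permMatrix, PEquiv.toMatrix_apply, eq_comm]

theorem swapGL_mem {J : Finset ι} {i j : ι} (hi : i ∈ J) (hj : j ∈ J) :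
    swapGL F i j ∈ blockGL F J := by
  intro k l hkl
  rw [swapGL_apply, Matrix.one_apply]
  congr 1
  rcases hkl with h | h
  · rw [Equiv.swap_apply_of_ne_of_ne]
    · rintro rfl; exact h hi
    · rintro rfl; exact h hj
  · rw [Equiv.swap_apply_eq_iff, Equiv.swap_apply_of_ne_of_ne]
    · rintro rfl; exact h hi
    · rintro rfl; exact h hj

theorem swapGL_mul_self (i j : ι) : swapGL F i j * swapGL F i j = 1 := by
  apply Units.ext
  exact Matrix.swap_mul_self i j

theorem swapGL_inv (i j : ι) : (swapGL F i j)⁻¹ = swapGL F i j := by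
  rw [inv_eq_iff_mul_eq_one, swapGL_mul_self]

/-- All entries have degree at most `d`. -/
def DegLE (d : ℕ) (v : ι → F[X]) : Prop := ∀ i n, d < n → (v i).coeff n = 0

theorem DegLE.mono {d e : ℕ} (h : d ≤ e) {v : ι → F[X]} (hv : DegLE d v) : DegLE e v :=
  fun i n hn => hv i n (h.trans_lt hn)

theorem DegLE.constAct {d : ℕ} {v : ι → F[X]} (hv : DegLE d v) (h : GL ι F) :
    DegLE d (constAct h v) := by
  intro i n hn
  rw [coeff_constAct, show (fun j => (v j).coeff n) = 0 from funext fun j => hv j n hn]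
  simp

theorem DegLE.of_constAct {d : ℕ} {v : ι → F[X]} {h : GL ι F} (hv : DegLE d (_root_.constAct h v)) :
    DegLE d v := by
  rw [← constAct_inv_self h v]
  exact hv.constAct _

theorem degLE_of_succ {d : ℕ} {v : ι → F[X]} (hv : DegLE (d + 1) v)
    (h : ∀ i, (v i).coeff (d + 1) = 0) : DegLE d v := by
  intro i n hn
  rcases Nat.lt_or_ge (d + 1) n with h1 | h1
  · exact hv i n h1
  · rw [show n = d + 1 by omega]; exact h i

theorem exists_degLE (v : ι → F[X]) : ∃ d, DegLE d v := by
  refine ⟨Finset.univ.sup fun i => (v i).natDegree, fun i n hn => ?_⟩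
  refine coeff_eq_zero_of_natDegree_lt (lt_of_le_of_lt ?_ hn)
  exact Finset.le_sup (f := fun i => (v i).natDegree) (Finset.mem_univ i)

/-- Unimodular vectors supported in `J`. -/
def Good (J : Finset ι) (v : ι → F[X]) : Prop := SuppIn J v ∧ ∃ w : ι → F[X], w ⬝ᵥ v = 1

theorem Good.constAct {J : Finset ι} {v : ι → F[X]} (hv : Good J v) {h : GL ι F}
    (hh : h ∈ blockGL F J) : Good J (constAct h v) := by
  refine ⟨fun i hi => ?_, ?_⟩
  · rw [constAct_apply, Finset.sum_eq_zero]
    intro j _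
    by_cases hj : j ∈ J
    · rw [hh i j (Or.inl hi), Matrix.one_apply_ne (by rintro rfl; exact hi hj)]; simp
    · rw [hv.1 j hj, mul_zero]
  · obtain ⟨w, hw⟩ := hv.2
    refine ⟨w ᵥ* ((h⁻¹ : GL ι F) : Matrix ι ι F).map C, ?_⟩
    rw [← Matrix.dotProduct_mulVec]
    change w ⬝ᵥ _root_.constAct h⁻¹ (_root_.constAct h v) = 1
    rw [constAct_inv_self, hw]

theorem Good.shear {J : Finset ι} {v : ι → F[X]} (hv : Good J v) {m : ι} (hm : m ∈ J)
    {f : ι → F[X]} (hf : f m = 0) : Good J (shear m f v) := by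
  refine ⟨fun i hi => ?_, ?_⟩
  · rw [shear_apply_ne (by rintro rfl; exact hi hm), hv.1 i hi]
  · obtain ⟨w, hw⟩ := hv.2
    refine ⟨w - w m • f, ?_⟩
    rw [dotProduct_shear, sub_dotProduct, hw, smul_dotProduct]
    simp [hf]

theorem good_single {J : Finset ι} {m : ι} (hm : m ∈ J) :
    Good J (Pi.single m 1 : ι → F[X]) := by
  refine ⟨fun i hi => ?_, Pi.single m 1, by simp⟩
  rw [Pi.single_eq_of_ne]
  rintro rfl; exact hi hm

theorem coeff_add_div_mul {p q : F[X]} (hq : q ≠ 0) {d : ℕ} (hd : ∀ n, d < n → q.coeff n = 0)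
    {n : ℕ} (hn : d < n) : (p + -(p / q) * q).coeff n = 0 := by
  have h1 : p + -(p / q) * q = p % q := by
    have := EuclideanDomain.div_add_mod p q
    linear_combination -this
  rw [h1]
  refine coeff_eq_zero_of_degree_lt ?_
  refine (EuclideanDomain.mod_lt p hq).trans_le ?_
  refine (degree_le_iff_coeff_zero q d).2 (fun k hk => hd k (by exact_mod_cast hk)) |>.trans ?_
  exact_mod_cast hn.le

theorem exists_shear_degLE {J : Finset ι} {v : ι → F[X]} (hv : Good J v) {m : ι}
    {d : ℕ} (h : ∀ i, i ≠ m → ∀ n, d < n → (v i).coeff n = 0) :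
    ∃ f : ι → F[X], SuppIn (J.erase m) f ∧ DegLE d (shear m f v) := by
  by_cases hi : ∃ i, i ≠ m ∧ v i ≠ 0
  · obtain ⟨i, him, hi⟩ := hi
    refine ⟨Pi.single i (-(v m / v i)), ?_, ?_⟩
    · intro j hj
      rw [Pi.single_eq_of_ne]
      rintro rfl
      exact hj (Finset.mem_erase.2 ⟨him, by_contra fun h => hi (hv.1 _ h)⟩)
    · intro j n hn
      by_cases hj : j = m
      · subst hj
        rw [shear_apply_self, single_dotProduct]
        exact coeff_add_div_mul hi (h i him) hn
      · rw [shear_apply_ne hj]; exact h j hj n hn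
  · push Not at hi
    refine ⟨0, fun _ _ => rfl, ?_⟩
    rw [shear_zero]
    intro j n hn
    by_cases hj : j = m
    · subst hj
      obtain ⟨w, hw⟩ := hv.2
      rw [dotProduct, Finset.sum_eq_single j (fun i _ h => by rw [hi i h, mul_zero])
        (by simp)] at hw
      have hu : IsUnit (v j) := IsUnit.of_mul_eq_one _ (by rw [mul_comm]; exact hw)
      refine coeff_eq_zero_of_natDegree_lt ?_
      rw [natDegree_eq_zero_of_isUnit hu]; omega
    · rw [hi j hj]; simp

end

section
open Polynomial
open scoped Matrix MatrixGroups

/-- A group with homomorphic copies of `GL` over a field and of the row subgroups over the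
polynomial ring, subject to the relations between them, and a linear representation. -/
structure PolySys (F ι Γ K : Type*) [Field F] [Fintype ι] [DecidableEq ι] [Group Γ]
    [CommRing K] where
  α : GL ι F →* Γ
  ρ : ι → (ι → F[X]) → Γ
  π : Γ →* Matrix ι ι K
  φ : F[X] →+* K
  φ_inj : Function.Injective φ
  π_α : ∀ h : GL ι F, π (α h) = (h : Matrix ι ι F).map fun c => φ (C c)
  π_ρ : ∀ m f, f m = 0 → π (ρ m f) = (rowMat m f).map φ
  ρ_add : ∀ m f g, f m = 0 → g m = 0 → ρ m (f + g) = ρ m f * ρ m g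
  ρ_const : ∀ m (r : ι → F), r m = 0 → ρ m (fun i => C (r i)) = α (rowUnit m r)
  conj : ∀ (h : GL ι F) m k c (f f' : ι → F[X]), (∀ i, h i k = if i = m then c else 0) →
    f k = 0 → (∀ j, ∑ i, f' i * C (h i j) = C c * f j) → α h * ρ k f = ρ m f' * α h
  comm : ∀ m k (f e : ι → F[X]), m ≠ k → f m = 0 → e k = 0 → e m = 0 →
    ρ m f * ρ k e = ρ k e * ρ m (f + f k • e)

namespace PolySys

variable {F ι Γ K : Type*} [Field F] [Fintype ι] [DecidableEq ι] [Group Γ]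
    [CommRing K] (A : PolySys F ι Γ K)

theorem ρ_zero (m : ι) : A.ρ m 0 = 1 := by
  have := A.ρ_add m 0 0 rfl rfl
  rw [add_zero] at this
  exact left_eq_mul.1 this

theorem ρ_neg {m : ι} {f : ι → F[X]} (hf : f m = 0) : A.ρ m (-f) = (A.ρ m f)⁻¹ := by
  rw [eq_inv_iff_mul_eq_one, ← A.ρ_add m _ _ (by simp [hf]) hf, neg_add_cancel, A.ρ_zero]

/-- The row vector `c f h⁻¹`. -/
noncomputable def transport (h : GL ι F) (c : F) (f : ι → F[X]) : ι → F[X] :=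
  (C c • f) ᵥ* ((h⁻¹ : GL ι F) : Matrix ι ι F).map C

theorem transport_spec (h : GL ι F) (c : F) (f : ι → F[X]) (j : ι) :
    ∑ i, transport h c f i * C (h i j) = C c * f j := by
  have : transport h c f ᵥ* (h : Matrix ι ι F).map C = C c • f := by
    rw [transport, Matrix.vecMul_vecMul, ← Matrix.map_mul, ← Units.val_mul, inv_mul_cancel]
    simp
  have := congrFun this j
  simpa [Matrix.vecMul, dotProduct] using this

theorem transport_dotProduct (h : GL ι F) (c : F) (f v : ι → F[X]) :
    transport h c f ⬝ᵥ constAct h v = C c * (f ⬝ᵥ v) := by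
  rw [transport, ← Matrix.dotProduct_mulVec]
  change (C c • f) ⬝ᵥ constAct h⁻¹ (constAct h v) = _
  rw [constAct_inv_self, smul_dotProduct, smul_eq_mul]

theorem transport_supp {h : GL ι F} {J : Finset ι} (hh : h ∈ blockGL F J) (c : F)
    {f : ι → F[X]} (hf : SuppIn J f) : SuppIn J (transport h c f) := by
  intro i hi
  simp only [transport, Matrix.vecMul, dotProduct]
  refine Finset.sum_eq_zero fun j _ => ?_
  by_cases hj : j ∈ J
  · rw [Matrix.map_apply, inv_mem hh j i (Or.inr hi),
      Matrix.one_apply_ne (by rintro rfl; exact hi hj)]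
    simp
  · simp [hf j hj]

theorem transport_apply_eq_zero {h : GL ι F} {m k : ι} {c : F}
    (hh : ∀ i, h i k = if i = m then c else 0) {f : ι → F[X]} (hf : f k = 0) :
    transport h c f m = 0 := by
  have h1 := transport_spec h c f k
  have hc : c ≠ 0 := by
    rintro rfl
    have h2 : ((h⁻¹ : GL ι F) : Matrix ι ι F) * (h : Matrix ι ι F) = 1 := by
      rw [← Units.val_mul, inv_mul_cancel]; rfl
    have h3 := congrFun (congrFun h2 k) k
    rw [Matrix.mul_apply, Finset.sum_eq_zero] at h3
    · simp at h3
    · intro i _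
      rw [hh i]; simp
  rw [hf, mul_zero, Finset.sum_eq_single m] at h1
  · rw [hh m, if_pos rfl] at h1
    exact (mul_eq_zero.1 h1).resolve_right (by simpa using hc)
  · intro i _ hi
    rw [hh i, if_neg hi]; simp
  · simp

theorem conj_transport {h : GL ι F} {m k : ι} {c : F} (hh : ∀ i, h i k = if i = m then c else 0)
    {f : ι → F[X]} (hf : f k = 0) : A.α h * A.ρ k f = A.ρ m (transport h c f) * A.α h :=
  A.conj h m k c f _ hh hf (transport_spec h c f)

theorem constAct_shear {h : GL ι F} {m k : ι} {c : F} (hh : ∀ i, h i k = if i = m then c else 0)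
    (f v : ι → F[X]) :
    constAct h (shear k f v) = shear m (transport h c f) (constAct h v) := by
  rw [shear, shear, constAct_add, transport_dotProduct]
  congr 1
  ext1 i
  rw [constAct_apply, Finset.sum_eq_single k]
  · rw [hh i]
    by_cases him : i = m
    · subst him; simp
    · simp [him]
  · intro j _ hj; simp [hj]
  · simp

/-- The constant matrices and the row subgroups of the block `J`. -/
def gens (J : Finset ι) : Set Γ :=
  {g | (∃ h ∈ blockGL F J, g = A.α h) ∨ ∃ k ∈ J, ∃ f, SuppIn (J.erase k) f ∧ g = A.ρ k f}

/-- The subgroup generated by the constant matrices and row subgroups of the block `J`. -/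
def level (J : Finset ι) : Subgroup Γ := Subgroup.closure (A.gens J)

theorem α_mem_level {J : Finset ι} {h : GL ι F} (hh : h ∈ blockGL F J) : A.α h ∈ A.level J :=
  Subgroup.subset_closure (Or.inl ⟨h, hh, rfl⟩)

theorem ρ_mem_level {J : Finset ι} {k : ι} (hk : k ∈ J) {f : ι → F[X]}
    (hf : SuppIn (J.erase k) f) : A.ρ k f ∈ A.level J :=
  Subgroup.subset_closure (Or.inr ⟨k, hk, f, hf, rfl⟩)

theorem inv_mem_gen {J : Finset ι} {g : Γ} (hg : g ∈ A.gens J) : g⁻¹ ∈ A.gens J := by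
  rcases hg with ⟨h, hh, rfl⟩ | ⟨k, hk, f, hf, rfl⟩
  · exact Or.inl ⟨h⁻¹, inv_mem hh, by rw [map_inv]⟩
  · refine Or.inr ⟨k, hk, -f, fun i hi => by simp [hf i hi], ?_⟩
    rw [A.ρ_neg (hf k (by simp))]

theorem π_level {J : Finset ι} {g : Γ} (hg : g ∈ A.level J) (i j : ι) (hi : i ∉ J) :
    A.π g i j = (1 : Matrix ι ι K) i j := by
  have key : ∀ g ∈ A.gens J, ∀ j, A.π g i j = (1 : Matrix ι ι K) i j := by
    rintro g (⟨h, hh, rfl⟩ | ⟨k, hk, f, hf, rfl⟩) j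
    · rw [A.π_α, Matrix.map_apply, hh i j (Or.inl hi), Matrix.one_apply, Matrix.one_apply]
      split_ifs <;> simp
    · rw [A.π_ρ k f (hf k (by simp)), Matrix.map_apply, rowMat_apply, Matrix.one_apply,
        if_neg (show i ≠ k by rintro rfl; exact hi hk)]
      split_ifs <;> simp
  have step : ∀ (g h : Γ), (∀ j, A.π g i j = (1 : Matrix ι ι K) i j) →
      (∀ j, A.π h i j = (1 : Matrix ι ι K) i j) →
      ∀ j, A.π (g * h) i j = (1 : Matrix ι ι K) i j := by
    intro g h hg hh j
    rw [map_mul, Matrix.mul_apply, Finset.sum_congr rfl fun k _ => by rw [hg k],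
      ← Matrix.mul_apply, one_mul, hh]
  revert j
  induction hg using Subgroup.closure_induction_left with
  | one => intro j; rw [map_one]
  | mul_left x hx y _ hy => exact step x y (key x hx) hy
  | inv_mul_cancel x hx y _ hy => exact step _ y (key _ (A.inv_mem_gen hx)) hy

variable (m : ι) (L : Finset ι)

/-- The row subgroup at `m` with support in `L`. -/
def rowSub (hm : m ∉ L) : Subgroup Γ where
  carrier := {g | ∃ f, SuppIn L f ∧ g = A.ρ m f}
  one_mem' := ⟨0, fun _ _ => rfl, (A.ρ_zero m).symm⟩
  mul_mem' := by
    rintro _ _ ⟨f, hf, rfl⟩ ⟨g, hg, rfl⟩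
    exact ⟨f + g, fun i hi => by simp [hf i hi, hg i hi],
      (A.ρ_add m f g (hf m hm) (hg m hm)).symm⟩
  inv_mem' := by
    rintro _ ⟨f, hf, rfl⟩
    exact ⟨-f, fun i hi => by simp [hf i hi], (A.ρ_neg (hf m hm)).symm⟩

variable {m L}

theorem blockGL_col {J : Finset ι} {h : GL ι F} (hh : h ∈ blockGL F J) (hm : m ∉ J) (i : ι) :
    h i m = if i = m then 1 else 0 := by
  rw [hh i m (Or.inr hm), Matrix.one_apply]

theorem level_normalizes (hm : m ∉ L) : ∀ x ∈ A.level L, ∀ y ∈ A.rowSub m L hm,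
    x * y * x⁻¹ ∈ A.rowSub m L hm := by
  intro x hx y hy
  have h1 : ∀ s ∈ A.gens L, ∀ y ∈ (A.rowSub m L hm : Set Γ),
      s * y * s⁻¹ ∈ Subgroup.closure (A.rowSub m L hm : Set Γ) := by
    rintro s (⟨h, hh, rfl⟩ | ⟨k, hk, e, he, rfl⟩) _ ⟨f, hf, rfl⟩
    · rw [Subgroup.closure_eq]
      refine ⟨transport h 1 f, transport_supp hh 1 hf, ?_⟩
      rw [A.conj_transport (blockGL_col hh hm) (hf m hm), mul_inv_cancel_right]
    · rw [Subgroup.closure_eq]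
      have hmk : m ≠ k := by rintro rfl; exact hm hk
      have hek : e k = 0 := he k (by simp)
      have hem : e m = 0 := he m fun h => hm (Finset.mem_of_mem_erase h)
      refine ⟨f - f k • e, fun i hi => ?_, ?_⟩
      · simp [hf i hi, he i fun h => hi (Finset.mem_of_mem_erase h)]
      · rw [mul_inv_eq_iff_eq_mul, A.comm m k _ e hmk (by simp [hf m hm, hem]) hek hem]
        congr 2
        simp [hek]
  have := closure_conj_mem (S := A.gens L) (fun s hs => A.inv_mem_gen hs) h1 hx
    (y := y) (Subgroup.subset_closure hy)
  rwa [Subgroup.closure_eq] at this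

/-- The candidate stabilizer of the basis vector at `m`. -/
def stab (hm : m ∉ L) : Subgroup Γ := normProd (A.rowSub m L hm) (A.level L)
  (A.level_normalizes hm)

theorem ρ_mem_stab (hm : m ∉ L) {f : ι → F[X]} (hf : SuppIn L f) : A.ρ m f ∈ A.stab hm :=
  ⟨_, ⟨f, hf, rfl⟩, 1, one_mem _, by simp⟩

theorem level_le_stab (hm : m ∉ L) : A.level L ≤ A.stab hm :=
  fun x hx => ⟨1, one_mem _, x, hx, by simp⟩

theorem α_mem_stab (hm : m ∉ L) {h : GL ι F} (hh : h ∈ blockGL F (insert m L))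
    (hcol : ∀ i, h i m = if i = m then 1 else 0) : A.α h ∈ A.stab hm := by
  let r : ι → F := fun j => if j = m then 0 else h m j
  have hr : r m = 0 := by simp [r]
  have hrs : SuppIn L r := by
    intro j hj
    by_cases hjm : j = m
    · simp [r, hjm]
    · simp only [r, if_neg hjm]
      rw [hh m j (Or.inr (by simp [hj, hjm])), Matrix.one_apply_ne (Ne.symm hjm)]
  have hA : h * rowUnit m (-r) ∈ blockGL F L := by
    have hval : ∀ i j, (h * rowUnit m (-r)) i j = h i j - (if i = m then r j else 0) := by
      intro i j
      change ((h : Matrix ι ι F) * rowMat m (-r)) i j = _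
      rw [rowMat_of_eq_zero (by simp [hr]), mul_add, Matrix.mul_vecMulVec, mul_one,
        Matrix.add_apply, Matrix.vecMulVec_apply, Matrix.mulVec_single_one, Matrix.col_apply, hcol]
      split_ifs <;> simp [sub_eq_add_neg]
    intro i j hij
    rw [hval]
    by_cases hi : i = m
    · subst hi
      by_cases hj : j = i
      · subst hj; simp [hcol, hr]
      · simp [r, hj, Matrix.one_apply_ne (Ne.symm hj)]
    · rw [if_neg hi, sub_zero]
      by_cases hj : j = m
      · subst hj; rw [hcol, Matrix.one_apply]
      · exact hh i j (by simpa [hi, hj] using hij)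
  have h2 : A.α h = A.α (h * rowUnit m (-r)) * A.ρ m (fun i => C (r i)) := by
    rw [A.ρ_const m r hr, ← map_mul, mul_assoc, rowUnit_mul, neg_add_cancel, rowUnit_zero, mul_one]
  rw [h2]
  exact mul_mem (A.level_le_stab hm (A.α_mem_level hA))
    (A.ρ_mem_stab hm fun i hi => by simp [hrs i hi])

/-- A partial action of the generators on unimodular vectors of degree at most `d`, with values
in the cosets of the candidate stabilizer. -/
structure CosetMap (hm : m ∉ L) (d : ℕ) (c : (ι → F[X]) → Γ ⧸ A.stab hm) : Prop where
  base : c (Pi.single m 1) = ((1 : Γ) : Γ ⧸ A.stab hm)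
  act : ∀ v, Good (insert m L) v → DegLE d v → ∀ h ∈ blockGL F (insert m L),
    c (constAct h v) = A.α h • c v
  shear : ∀ v f, Good (insert m L) v → DegLE d v → SuppIn L f → DegLE d (shear m f v) →
    c (shear m f v) = A.ρ m f • c v

end PolySys
end

section
open Polynomial
open scoped Matrix MatrixGroups

namespace PolySys

variable {F ι Γ K : Type*} [Field F] [Fintype ι] [DecidableEq ι] [Group Γ]
    [CommRing K] (A : PolySys F ι Γ K)

theorem transport_supp_erase {h : GL ι F} {m k : ι} {L : Finset ι}
    (hh : h ∈ blockGL F (insert m L)) {c : F} (hcol : ∀ i, h i k = if i = m then c else 0)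
    {f : ι → F[X]} (hf : SuppIn ((insert m L).erase k) f) : SuppIn L (transport h c f) := by
  intro i hi
  by_cases him : i = m
  · subst him; exact transport_apply_eq_zero hcol (hf k (by simp))
  · refine transport_supp hh c (fun j hj => hf j fun h => hj (Finset.mem_of_mem_erase h)) i ?_
    simp [him, hi]

theorem swapGL_col (m k : ι) (i : ι) : swapGL F m k i k = if i = m then 1 else 0 := by
  rw [swapGL_apply]
  congr 1
  rw [Equiv.swap_apply_eq_iff, Equiv.swap_apply_right]

theorem rowUnit_mem {J : Finset ι} {m : ι} (hm : m ∈ J) {r : ι → F} (hr : SuppIn J r) :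
    rowUnit m r ∈ blockGL F J := by
  intro i j hij
  rw [rowUnit_val, rowMat_apply, Matrix.one_apply]
  split_ifs with h1 h2
  · rfl
  · subst h2
    exact hr j (hij.resolve_left fun h => h hm)
  · rfl

theorem constAct_rowUnit {m : ι} {r : ι → F} (hr : r m = 0) (w : ι → F[X]) :
    constAct (rowUnit m r) w = shear m (fun i => C (r i)) w := by
  have h1 : (rowMat m r).map C = rowMat m fun i => C (r i) := by
    ext1 i j
    rw [Matrix.map_apply, rowMat_apply, rowMat_apply]
    split_ifs <;> simp
  rw [constAct, rowUnit_val, h1, rowMat_mulVec (by simp [hr]), shear]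

theorem colUnit_inv_mulVec (k : ι) (t : ι → F) (ht : t k ≠ 0) :
    ((colUnit k t ht)⁻¹ : GL ι F).val *ᵥ t = Pi.single k 1 := by
  have h1 := congrArg (fun w => ((colUnit k t ht)⁻¹ : GL ι F).val *ᵥ w) (colUnit_mulVec k t ht)
  rw [← h1]
  rw [Matrix.mulVec_mulVec, ← Units.val_mul, inv_mul_cancel, Units.val_one, Matrix.one_mulVec]

theorem exists_blockGL_mulVec {J : Finset ι} {m : ι} (hm : m ∈ J) {t : ι → F} (ht : SuppIn J t)
    (h0 : ∃ i, t i ≠ 0) : ∃ g ∈ blockGL F J, (g : Matrix ι ι F) *ᵥ t = Pi.single m 1 := by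
  obtain ⟨k, hk⟩ := h0
  have hkJ : k ∈ J := by_contra fun h => hk (ht k h)
  refine ⟨swapGL F m k * (colUnit k t hk)⁻¹,
    mul_mem (swapGL_mem hm hkJ) (inv_mem (colUnit_mem hkJ hk ht)), ?_⟩
  rw [Units.val_mul, ← Matrix.mulVec_mulVec, colUnit_inv_mulVec, Matrix.mulVec_single_one]
  ext i
  rw [Matrix.col_apply, swapGL_col, Pi.single_apply]

theorem inv_col {h : GL ι F} {m : ι} (hh : ∀ i, h i m = if i = m then 1 else 0) (i : ι) :
    (h⁻¹ : GL ι F) i m = if i = m then 1 else 0 := by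
  have h1 : (h : Matrix ι ι F) *ᵥ Pi.single m 1 = Pi.single m 1 := by
    rw [Matrix.mulVec_single_one]
    ext i
    rw [Matrix.col_apply, hh, Pi.single_apply]
  have h2 : ((h⁻¹ : GL ι F) : Matrix ι ι F) *ᵥ Pi.single m 1 = Pi.single m 1 := by
    conv_lhs => rw [← h1]
    rw [Matrix.mulVec_mulVec, ← Units.val_mul, inv_mul_cancel, Units.val_one, Matrix.one_mulVec]
  have := congrFun h2 i
  rwa [Matrix.mulVec_single_one, Matrix.col_apply, Pi.single_apply] at this

variable {A} {m : ι} {L : Finset ι} {hm : m ∉ L} {d : ℕ} {c : (ι → F[X]) → Γ ⧸ A.stab hm}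

theorem CosetMap.shear_row (E : A.CosetMap hm d c) {k : ι} (hk : k ∈ insert m L)
    {v f : ι → F[X]} (hv : Good (insert m L) v) (hd : DegLE d v)
    (hf : SuppIn ((insert m L).erase k) f) (hd' : DegLE d (_root_.shear k f v)) :
    c (_root_.shear k f v) = A.ρ k f • c v := by
  have hw : swapGL F m k ∈ blockGL F (insert m L) := swapGL_mem (Finset.mem_insert_self _ _) hk
  have hfk : f k = 0 := hf k (by simp)
  have h1 := E.act _ (hv.shear hk hfk) hd' _ hw
  have h2 := constAct_shear (swapGL_col (F := F) m k) f v
  rw [h2, E.shear _ _ (hv.constAct hw) (hd.constAct _)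
    (transport_supp_erase hw (swapGL_col m k) hf) (by rw [← h2]; exact hd'.constAct _),
    E.act _ hv hd _ hw, smul_smul, ← A.conj_transport (swapGL_col m k) hfk, mul_smul] at h1
  exact (smul_left_cancel _ h1).symm

variable (m L) in
/-- The matrix `g` followed by a shear at `m` lowers the degree of `v` to at most `d`. -/
def IsRed (d : ℕ) (v : ι → F[X]) (g : GL ι F) (f : ι → F[X]) : Prop :=
  g ∈ blockGL F (insert m L) ∧ SuppIn L f ∧ DegLE d (shear m f (constAct g v))

theorem exists_isRed {v : ι → F[X]} (hv : Good (insert m L) v) (hd : DegLE (d + 1) v)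
    (hm : m ∉ L) : ∃ g f, IsRed m L d v g f := by
  by_cases ht : ∃ i, (v i).coeff (d + 1) ≠ 0
  · obtain ⟨g, hg, hgt⟩ := exists_blockGL_mulVec (t := fun i => (v i).coeff (d + 1))
      (Finset.mem_insert_self m L) (fun i hi => by simp [hv.1 i hi]) ht
    have hgd := hd.constAct g
    obtain ⟨f, hf, hfd⟩ := exists_shear_degLE (hv.constAct hg) (m := m) (d := d) (by
      intro i hi n hn
      rcases Nat.lt_or_ge (d + 1) n with h1 | h1
      · exact hgd i n h1
      · rw [show n = d + 1 by omega, coeff_constAct, hgt, Pi.single_eq_of_ne hi])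
    rw [Finset.erase_insert hm] at hf
    exact ⟨g, f, hg, hf, hfd⟩
  · push Not at ht
    refine ⟨1, 0, one_mem _, fun _ _ => rfl, ?_⟩
    rw [shear_zero, constAct_one]
    exact degLE_of_succ hd ht

theorem CosetMap.red_unique (E : A.CosetMap hm d c) {v : ι → F[X]} (hv : Good (insert m L) v)
    (hd : DegLE (d + 1) v) {g g' : GL ι F} {f f' : ι → F[X]} (h1 : IsRed m L d v g f)
    (h2 : IsRed m L d v g' f') :
    ((A.α g)⁻¹ * (A.ρ m f)⁻¹) • c (_root_.shear m f (constAct g v)) =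
      ((A.α g')⁻¹ * (A.ρ m f')⁻¹) • c (_root_.shear m f' (constAct g' v)) := by
  have hmJ := Finset.mem_insert_self m L
  by_cases hvd : DegLE d v
  · have key : ∀ g f, IsRed m L d v g f →
        ((A.α g)⁻¹ * (A.ρ m f)⁻¹) • c (_root_.shear m f (constAct g v)) = c v := by
      intro g f h
      rw [E.shear _ _ (hv.constAct h.1) (hvd.constAct g) h.2.1 h.2.2, E.act _ hv hvd _ h.1,
        smul_smul, smul_smul]
      convert one_smul Γ (c v) using 2
      group
    rw [key g f h1, key g' f' h2]
  · set u := constAct g v with hu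
    set u' := constAct g' v with hu'
    set h := g' * g⁻¹ with hh
    have hhJ : h ∈ blockGL F (insert m L) := mul_mem h2.1 (inv_mem h1.1)
    have huu : constAct h u = u' := by
      rw [hu, ← constAct_mul, hh, inv_mul_cancel_right]
    have hoff : ∀ i, i ≠ m → (u i).coeff (d + 1) = 0 := fun i hi => by
      rw [← shear_apply_ne hi f u]; exact h1.2.2 i _ (Nat.lt_succ_self d)
    have hoff' : ∀ i, i ≠ m → (u' i).coeff (d + 1) = 0 := fun i hi => by
      rw [← shear_apply_ne hi f' u']; exact h2.2.2 i _ (Nat.lt_succ_self d)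
    have hum : (u m).coeff (d + 1) ≠ 0 := by
      intro h0
      refine hvd (DegLE.of_constAct (h := g) (degLE_of_succ (hd.constAct g) fun i => ?_))
      by_cases hi : i = m
      · subst hi; exact h0
      · exact hoff i hi
    have hcol : ∀ i, h i m = if i = m then h m m else 0 := by
      intro i
      by_cases hi : i = m
      · subst hi; simp
      · rw [if_neg hi]
        have h3 := hoff' i hi
        rw [← huu, coeff_constAct, Matrix.mulVec, dotProduct, Finset.sum_eq_single m] at h3
        · exact (mul_eq_zero.1 h3).resolve_right hum
        · intro j _ hj; rw [hoff j hj, mul_zero]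
        · simp
    have hfm : f m = 0 := h1.2.1 m hm
    set f1 := transport h (h m m) f with hf1
    have hf1s : SuppIn L f1 := transport_supp_erase hhJ hcol (by
      rw [Finset.erase_insert hm]; exact h1.2.1)
    have hsub : SuppIn L (f' - f1) := fun i hi => by simp [h2.2.1 i hi, hf1s i hi]
    have hy : _root_.shear m f' u' =
        _root_.shear m (f' - f1) (constAct h (_root_.shear m f u)) := by
      rw [constAct_shear hcol, huu, ← hf1, shear_shear (hsub m hm), add_sub_cancel]
    have hgu := (hv.constAct h1.1).shear hmJ hfm
    rw [hy, E.shear _ _ (hgu.constAct hhJ) (h1.2.2.constAct h) hsub (hy ▸ h2.2.2),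
      E.act _ hgu h1.2.2 _ hhJ, smul_smul, smul_smul]
    congr 1
    have e1 : A.ρ m (f' - f1) = A.ρ m f' * (A.ρ m f1)⁻¹ := by
      rw [sub_eq_add_neg, A.ρ_add m _ _ (h2.2.1 m hm) (by simp [hf1s m hm]),
        A.ρ_neg (hf1s m hm)]
    have e2 : A.ρ m f1 = A.α h * A.ρ m f * (A.α h)⁻¹ := by
      rw [A.conj_transport hcol hfm, mul_inv_cancel_right]
    have e3 : A.α h = A.α g' * (A.α g)⁻¹ := by rw [hh, map_mul, map_inv]
    rw [e1, e2, e3]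
    group

open Classical in
variable (A hm d c) in
/-- Extension of a coset map to vectors of degree one higher. -/
noncomputable def extendCoset (v : ι → F[X]) : Γ ⧸ A.stab hm :=
  if h : ∃ p : GL ι F × (ι → F[X]), IsRed m L d v p.1 p.2 then
    ((A.α h.choose.1)⁻¹ * (A.ρ m h.choose.2)⁻¹) • c (shear m h.choose.2 (constAct h.choose.1 v))
  else c v

theorem CosetMap.extend_eq (E : A.CosetMap hm d c) {v : ι → F[X]} (hv : Good (insert m L) v)
    (hd : DegLE (d + 1) v) {g : GL ι F} {f : ι → F[X]} (h1 : IsRed m L d v g f) :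
    extendCoset A hm d c v =
      ((A.α g)⁻¹ * (A.ρ m f)⁻¹) • c (_root_.shear m f (constAct g v)) := by
  have h : ∃ p : GL ι F × (ι → F[X]), IsRed m L d v p.1 p.2 := ⟨(g, f), h1⟩
  rw [extendCoset, dif_pos h]
  exact E.red_unique hv hd h.choose_spec h1

theorem CosetMap.extend_eq_row (E : A.CosetMap hm d c) {v : ι → F[X]}
    (hv : Good (insert m L) v) (hd : DegLE (d + 1) v) {k : ι} (hk : k ∈ insert m L)
    {e : ι → F[X]} (he : SuppIn ((insert m L).erase k) e) (hde : DegLE d (_root_.shear k e v)) :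
    extendCoset A hm d c v = (A.ρ k e)⁻¹ • c (_root_.shear k e v) := by
  have hw : swapGL F m k ∈ blockGL F (insert m L) := swapGL_mem (Finset.mem_insert_self _ _) hk
  have hek : e k = 0 := he k (by simp)
  have h2 := constAct_shear (swapGL_col (F := F) m k) e v
  rw [E.extend_eq hv hd (g := swapGL F m k) (f := transport (swapGL F m k) 1 e)
    ⟨hw, transport_supp_erase hw (swapGL_col m k) he, by rw [← h2]; exact hde.constAct _⟩,
    ← h2, E.act _ (hv.shear hk hek) hde _ hw, smul_smul]
  congr 1
  rw [← mul_inv_eq_of_eq_mul (A.conj_transport (swapGL_col (F := F) m k) hek)]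
  group

theorem CosetMap.extend_act (E : A.CosetMap hm d c) {v : ι → F[X]}
    (hv : Good (insert m L) v) (hd : DegLE (d + 1) v) {h : GL ι F}
    (hh : h ∈ blockGL F (insert m L)) :
    extendCoset A hm d c (constAct h v) = A.α h • extendCoset A hm d c v := by
  obtain ⟨g, f, hgf⟩ := exists_isRed hv hd hm
  have h1 : constAct (g * h⁻¹) (constAct h v) = constAct g v := by
    rw [← constAct_mul, inv_mul_cancel_right]
  rw [E.extend_eq hv hd hgf, E.extend_eq (hv.constAct hh) (hd.constAct h) (g := g * h⁻¹) (f := f)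
    ⟨mul_mem hgf.1 (inv_mem hh), hgf.2.1, by rw [h1]; exact hgf.2.2⟩, h1, smul_smul]
  congr 1
  rw [map_mul, map_inv]
  group

theorem shear_of_reduced {c' : (ι → F[X]) → Γ ⧸ A.stab hm} {D : ℕ}
    (hact : ∀ v, Good (insert m L) v → DegLE D v → ∀ h ∈ blockGL F (insert m L),
      c' (constAct h v) = A.α h • c' v)
    (hred : ∀ u f k, k ∈ L → Good (insert m L) u → DegLE D u → SuppIn L f →
      DegLE D (shear m f u) → (∀ i, (u i).coeff D = if i = k then 1 else 0) →
      (∀ i, (shear m f u i).coeff D = if i = k then 1 else 0) →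
      c' (shear m f u) = A.ρ m f • c' u)
    {v f : ι → F[X]} (hv : Good (insert m L) v) (hd : DegLE D v) (hf : SuppIn L f)
    (hd' : DegLE D (shear m f v)) {k : ι} (hk : k ∈ L) (hvk : (v k).coeff D ≠ 0) :
    c' (shear m f v) = A.ρ m f • c' v := by
  have hmJ := Finset.mem_insert_self m L
  have hkm : k ≠ m := by rintro rfl; exact hm hk
  set t : ι → F := fun i => (v i).coeff D with ht
  have hM := colUnit_mem (F := F) (Finset.mem_insert_of_mem hk) (t := t) hvk
    (show SuppIn (insert m L) t from fun i hi => by simp [t, hv.1 i hi])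
  have hMcol : ∀ i, colUnit k t hvk i m = if i = m then 1 else 0 := fun i => by
    rw [colUnit_apply, if_neg hkm.symm, Matrix.one_apply]
  set h := (colUnit k t hvk)⁻¹ with hh
  have hhJ : h ∈ blockGL F (insert m L) := inv_mem hM
  have hcol : ∀ i, h i m = if i = m then 1 else 0 := inv_col hMcol
  have htop : (h : Matrix ι ι F) *ᵥ t = Pi.single k 1 := by
    rw [hh, colUnit_inv_mulVec]
  set u := constAct h v with hu
  have hfm := hf m hm
  set f1 := transport h 1 f with hf1
  have hf1s : SuppIn L f1 := transport_supp_erase hhJ hcol (by rwa [Finset.erase_insert hm])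
  have hs1 : constAct h (shear m f v) = shear m f1 u := constAct_shear hcol f v
  have hucoeff : ∀ i, (u i).coeff D = if i = k then 1 else 0 := fun i => by
    rw [hu, coeff_constAct, htop, Pi.single_apply]
  set δ := (shear m f1 u m).coeff D with hδ
  let r : ι → F := Pi.single k (-δ)
  have hrm : r m = 0 := Pi.single_eq_of_ne hkm.symm _
  have hrs : SuppIn L r := fun i hi => Pi.single_eq_of_ne (by rintro rfl; exact hi hk) _
  have hrJ : rowUnit m r ∈ blockGL F (insert m L) :=
    rowUnit_mem hmJ fun i hi => hrs i fun h => hi (Finset.mem_insert_of_mem h)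
  set f2 := f1 + fun i => C (r i) with hf2
  have hf2s : SuppIn L f2 := fun i hi => by simp [f2, hf1s i hi, hrs i hi]
  have hs2 : shear m f2 u = constAct (rowUnit m r) (constAct h (shear m f v)) := by
    rw [constAct_rowUnit hrm, hs1, shear_shear (by simp [hrm])]
  have hgv' := hv.shear hmJ hfm
  have hdf2 : DegLE D (shear m f2 u) := by rw [hs2]; exact (hd'.constAct _).constAct _
  have hcoeff2 : ∀ i, (shear m f2 u i).coeff D = if i = k then 1 else 0 := by
    intro i
    by_cases him : i = m
    · subst him
      rw [if_neg hkm.symm, hs2, constAct_rowUnit hrm, hs1, shear_apply_self, coeff_add, ← hδ]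
      have : (fun j => C (r j)) = (Pi.single k (C (-δ)) : ι → F[X]) := by
        ext1 j
        simp only [r, Pi.single_apply]
        split_ifs <;> simp
      rw [this, single_dotProduct, coeff_C_mul, shear_apply_ne hkm, hucoeff k]
      simp
    · rw [shear_apply_ne him, hucoeff]
  have h3 := hred u f2 k hk (hv.constAct hhJ) (hd.constAct h) hf2s hdf2 hucoeff hcoeff2
  rw [hs2, hact _ (hgv'.constAct hhJ) (hd'.constAct h) _ hrJ, hact _ hgv' hd' _ hhJ, hf2,
    add_comm, A.ρ_add m _ _ (by simp [hrm]) (hf1s m hm), A.ρ_const m r hrm, hu,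
    hact _ hv hd _ hhJ, mul_smul] at h3
  have h4 := smul_left_cancel _ h3
  rw [smul_smul, hf1, ← A.conj_transport hcol hfm, mul_smul] at h4
  exact smul_left_cancel _ h4

end PolySys
end

section
open Polynomial
open scoped Matrix MatrixGroups

namespace PolySys

variable {F ι Γ K : Type*} [Field F] [Fintype ι] [DecidableEq ι] [Group Γ]
    [CommRing K] {A : PolySys F ι Γ K}
  {m : ι} {L : Finset ι} {hm : m ∉ L} {d : ℕ} {c : (ι → F[X]) → Γ ⧸ A.stab hm}

theorem CosetMap.extend (E : A.CosetMap hm d c) :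
    A.CosetMap hm (d + 1) (extendCoset A hm d c) := by
  have hmJ := Finset.mem_insert_self m L
  have hact := fun v (hv : Good (insert m L) v) (hd : DegLE (d + 1) v) h
    (hh : h ∈ blockGL F (insert m L)) => E.extend_act hv hd hh
  refine ⟨?_, hact, ?_⟩
  · have hd0 : DegLE d (Pi.single m 1 : ι → F[X]) := by
      intro i n hn
      rw [Pi.single_apply]
      split_ifs
      · rw [coeff_one, if_neg (by omega)]
      · simp
    rw [E.extend_eq (good_single hmJ) (hd0.mono (Nat.le_succ d)) (g := 1) (f := 0)
      ⟨one_mem _, fun _ _ => rfl, by rwa [shear_zero, constAct_one]⟩, shear_zero, constAct_one,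
      E.base, map_one, A.ρ_zero]
    simp
  · intro v f hv hd hf hd'
    have hfm := hf m hm
    by_cases hk : ∃ k ∈ L, (v k).coeff (d + 1) ≠ 0
    · obtain ⟨k, hk, hvk⟩ := hk
      refine shear_of_reduced hact ?_ hv hd hf hd' hk hvk
      clear hvk hk k hd' hf hd hv hfm f v
      intro u f k hk hu hd hf hd' hut hut'
      have hkm : k ≠ m := by rintro rfl; exact hm hk
      have hfm := hf m hm
      have hkJ : k ∈ insert m L := Finset.mem_insert_of_mem hk
      by_cases hi : ∃ i ∈ L, i ≠ k ∧ u i ≠ 0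
      · obtain ⟨i, hiL, hik, hui⟩ := hi
        have him : i ≠ m := by rintro rfl; exact hm hiL
        set e : ι → F[X] := Pi.single i (-(u k / u i)) with he
        have hek : e k = 0 := Pi.single_eq_of_ne hik.symm _
        have hem : e m = 0 := Pi.single_eq_of_ne him.symm _
        have hes : SuppIn ((insert m L).erase k) e := fun j hj => by
          refine Pi.single_eq_of_ne ?_ _
          rintro rfl
          exact hj (Finset.mem_erase.2 ⟨hik, Finset.mem_insert_of_mem hiL⟩)
        have hdi : ∀ n, d < n → (u i).coeff n = 0 := by
          intro n hn
          rcases Nat.lt_or_ge (d + 1) n with h1 | h1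
          · exact hd i n h1
          · rw [show n = d + 1 by omega, hut, if_neg hik]
        have hdeg : ∀ w : ι → F[X], DegLE (d + 1) w →
            (∀ i, (w i).coeff (d + 1) = if i = k then 1 else 0) → w k = u k → w i = u i →
            DegLE d (_root_.shear k e w) := by
          intro w hwd hwt hwk hwi j n hn
          by_cases hj : j = k
          · subst hj
            rw [shear_apply_self, he, single_dotProduct, hwk, hwi]
            exact coeff_add_div_mul hui hdi hn
          · rw [shear_apply_ne hj]
            rcases Nat.lt_or_ge (d + 1) n with h1 | h1
            · exact hwd j n h1
            · rw [show n = d + 1 by omega, hwt, if_neg hj]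
        have hy := hdeg u hd hut rfl rfl
        have hy' := hdeg _ hd' hut' (shear_apply_ne hkm _ _) (shear_apply_ne him _ _)
        have hus := hu.shear hmJ hfm
        rw [E.extend_eq_row hu hd hkJ hes hy, E.extend_eq_row hus hd' hkJ hes hy']
        set f2 := f - f k • e with hf2
        have hf2s : SuppIn L f2 := fun j hj => by
          have hej : e j = 0 := Pi.single_eq_of_ne (by rintro rfl; exact hj hiL) _
          simp [f2, hf j hj, hej]
        have hyy : _root_.shear k e (_root_.shear m f u) =
            _root_.shear m f2 (_root_.shear k e u) := by
          ext1 j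
          by_cases hjm : j = m
          · subst hjm
            rw [shear_apply_ne hkm.symm, shear_apply_self, shear_apply_self,
              shear_apply_ne hkm.symm, dotProduct_shear, hf2, sub_dotProduct, smul_dotProduct]
            simp only [Pi.sub_apply, Pi.smul_apply, hek, smul_eq_mul]
            ring
          · rw [shear_apply_ne hjm]
            by_cases hjk : j = k
            · subst hjk
              rw [shear_apply_self, shear_apply_self, shear_apply_ne hjm, dotProduct_shear, hem]
              ring
            · rw [shear_apply_ne hjk, shear_apply_ne hjk, shear_apply_ne hjm]
        rw [hyy, E.shear _ _ (hu.shear hkJ hek) hy hf2s (hyy ▸ hy'), smul_smul, smul_smul]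
        congr 1
        have h5 := A.comm m k f2 e hkm.symm (hf2s m hm) hek hem
        have h6 : f2 + f2 k • e = f := by simp [f2, hek]
        rw [h6] at h5
        rw [inv_mul_eq_iff_eq_mul, ← mul_assoc, ← h5, mul_inv_cancel_right]
      · push Not at hi
        have hoff : ∀ j, j ≠ k → j ≠ m → u j = 0 := by
          intro j hjk hjm
          by_cases hj : j ∈ L
          · exact hi j hj hjk
          · exact hu.1 j (by simp [hjm, hj])
        have hdot : f ⬝ᵥ u = f k * u k := by
          rw [dotProduct, Finset.sum_eq_single k]
          · intro j _ hjk
            by_cases hjm : j = m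
            · subst hjm; rw [hfm, zero_mul]
            · rw [hoff j hjk hjm, mul_zero]
          · simp
        have hfk : f k = 0 := by
          by_contra hne
          have h1 : f k * u k = _root_.shear m f u m - u m := by rw [shear_apply_self, hdot]; ring
          have hmon : (u k).natDegree = d + 1 := by
            refine le_antisymm (natDegree_le_iff_coeff_eq_zero.2 fun n hn => hd k n hn) ?_
            refine le_natDegree_of_ne_zero ?_
            rw [hut]; simp
          have hu0 : u k ≠ 0 := by rintro h; rw [h] at hmon; simp at hmon
          have h2 : (f k * u k).natDegree = (f k).natDegree + (d + 1) := by
            rw [natDegree_mul hne hu0, hmon]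
          have h3 : (f k * u k).coeff ((f k).natDegree + (d + 1)) ≠ 0 := by
            rw [← h2]
            exact leadingCoeff_ne_zero.2 (mul_ne_zero hne hu0)
          apply h3
          rw [h1, coeff_sub]
          rcases Nat.eq_zero_or_pos (f k).natDegree with h4 | h4
          · rw [h4, zero_add, hut, hut', sub_self]
          · rw [hd m _ (by omega), hd' m _ (by omega), sub_self]
        have hfu : f ⬝ᵥ u = 0 := by rw [hdot, hfk, zero_mul]
        have hus : _root_.shear m f u = u := by rw [_root_.shear, hfu]; simp
        rw [hus]
        obtain ⟨e, he, hy⟩ := exists_shear_degLE hu (m := k) (d := d) (by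
          intro i hik n hn
          rcases Nat.lt_or_ge (d + 1) n with h1 | h1
          · exact hd i n h1
          · rw [show n = d + 1 by omega, hut, if_neg hik])
        have hek : e k = 0 := he k (by simp)
        set e2 := e + e m • f with he2
        have he2s : SuppIn ((insert m L).erase k) e2 := by
          intro j hj
          have : f j = 0 := by
            by_cases hjk : j = k
            · rw [hjk, hfk]
            · refine hf j fun h => hj (Finset.mem_erase.2 ⟨hjk, Finset.mem_insert_of_mem h⟩)
          simp [e2, he j hj, this]
        have hs2 : _root_.shear k e2 u = _root_.shear k e u := by
          rw [_root_.shear, _root_.shear, he2, add_dotProduct, smul_dotProduct, hfu]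
          simp
        have hfy : _root_.shear m f (_root_.shear k e u) = _root_.shear k e u := by
          conv_lhs => rw [_root_.shear]
          rw [dotProduct_shear, hfu, hfk]
          simp
        have h5 := A.comm k m e f hkm hek hfm hfk
        have h6 := E.shear _ f (hu.shear hkJ hek) hy hf (by rw [hfy]; exact hy)
        rw [hfy] at h6
        rw [← inv_smul_eq_iff]
        conv_rhs => rw [E.extend_eq_row hu hd hkJ he2s (by rw [hs2]; exact hy), hs2]
        rw [E.extend_eq_row hu hd hkJ he hy, smul_smul, ← mul_inv_rev, h5, mul_inv_rev, mul_smul,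
          inv_smul_eq_iff.2 h6]
    · push Not at hk
      have hvoff : ∀ i, i ≠ m → ∀ n, d < n → (v i).coeff n = 0 := by
        intro i hi n hn
        rcases Nat.lt_or_ge (d + 1) n with h1 | h1
        · exact hd i n h1
        · rw [show n = d + 1 by omega]
          by_cases hiL : i ∈ L
          · exact hk i hiL
          · rw [hv.1 i (by simp [hi, hiL]), coeff_zero]
      obtain ⟨f0, hf0, hd0⟩ := exists_shear_degLE hv hvoff
      rw [Finset.erase_insert hm] at hf0
      have hs : _root_.shear m (f0 - f) (_root_.shear m f v) = _root_.shear m f0 v := by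
        rw [shear_shear (by simp [hfm, hf0 m hm]), add_sub_cancel]
      rw [E.extend_eq hv hd (g := 1) (f := f0) ⟨one_mem _, hf0, by rwa [constAct_one]⟩,
        E.extend_eq (hv.shear hmJ hfm) hd' (g := 1) (f := f0 - f)
          ⟨one_mem _, fun i hi => by simp [hf i hi, hf0 i hi], by rwa [constAct_one, hs]⟩,
        constAct_one, constAct_one, hs, sub_eq_add_neg,
        A.ρ_add m _ _ (hf0 m hm) (by simp [hfm]), A.ρ_neg hfm, smul_smul]
      congr 1
      rw [map_one]
      group

open Classical in
variable (A hm) in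
/-- The coset map on constant vectors. -/
noncomputable def baseCoset (v : ι → F[X]) : Γ ⧸ A.stab hm :=
  if h : ∃ g ∈ blockGL F (insert m L), v = constAct g (Pi.single m 1) then
    (A.α h.choose : Γ ⧸ A.stab hm)
  else ((1 : Γ) : Γ ⧸ A.stab hm)

theorem constAct_single (g : GL ι F) (m i : ι) :
    constAct g (Pi.single m 1) i = C (g i m) := by
  rw [constAct_apply, Finset.sum_eq_single m]
  · simp
  · intro j _ hj; simp [hj]
  · simp

theorem baseCoset_eq {g : GL ι F} (hg : g ∈ blockGL F (insert m L)) :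
    baseCoset A hm (constAct g (Pi.single m 1)) = (A.α g : Γ ⧸ A.stab hm) := by
  have h : ∃ g' ∈ blockGL F (insert m L),
      constAct g (Pi.single m (1 : F[X])) = constAct g' (Pi.single m 1) := ⟨g, hg, rfl⟩
  rw [baseCoset, dif_pos h]
  obtain ⟨h1, h2⟩ := h.choose_spec
  generalize h.choose = g' at h1 h2 ⊢
  refine QuotientGroup.eq.2 ?_
  rw [← map_inv, ← map_mul]
  refine A.α_mem_stab hm (mul_mem (inv_mem h1) hg) fun i => ?_
  apply C_injective
  rw [← constAct_single, constAct_mul, h2, constAct_inv_self, Pi.single_apply]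
  split_ifs <;> simp

theorem exists_const {J : Finset ι} (hmJ : m ∈ J) {v : ι → F[X]} (hv : Good J v)
    (hd : DegLE 0 v) : ∃ g ∈ blockGL F J, v = constAct g (Pi.single m 1) := by
  have hvc : v = fun i => C ((v i).coeff 0) := by
    ext1 i
    refine eq_C_of_natDegree_eq_zero ?_
    exact Nat.le_zero.1 (natDegree_le_iff_coeff_eq_zero.2 fun n hn => hd i n hn)
  have h0 : ∃ i, (v i).coeff 0 ≠ 0 := by
    by_contra h
    push Not at h
    obtain ⟨w, hw⟩ := hv.2
    have : v = 0 := by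
      rw [hvc]; ext1 i; rw [h i]; simp
    rw [this] at hw
    simp at hw
  obtain ⟨g, hg, hgt⟩ := exists_blockGL_mulVec (t := fun i => (v i).coeff 0) hmJ
    (fun i hi => by simp [hv.1 i hi]) h0
  refine ⟨g⁻¹, inv_mem hg, ?_⟩
  have h2 : constAct g v = Pi.single m 1 := by
    rw [hvc, constAct_C, hgt]
    ext1 i
    rw [Pi.single_apply, Pi.single_apply]
    split_ifs <;> simp
  rw [← h2, constAct_inv_self]

theorem cosetMap_zero : A.CosetMap hm 0 (baseCoset A hm) := by
  have hmJ := Finset.mem_insert_self m L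
  have hact : ∀ v, Good (insert m L) v → DegLE 0 v → ∀ h ∈ blockGL F (insert m L),
      baseCoset A hm (constAct h v) = A.α h • baseCoset A hm v := by
    intro v hv hd h hh
    obtain ⟨g, hg, rfl⟩ := exists_const hmJ hv hd
    rw [baseCoset_eq hg, ← constAct_mul, baseCoset_eq (mul_mem hh hg), map_mul]
    rfl
  refine ⟨?_, hact, ?_⟩
  · have := baseCoset_eq (A := A) (hm := hm) (one_mem (blockGL F (insert m L)))
    rwa [constAct_one, map_one] at this
  · intro v f hv hd hf hd'
    have hfm := hf m hm
    by_cases hk : ∃ k ∈ L, (v k).coeff 0 ≠ 0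
    · obtain ⟨k, hk, hvk⟩ := hk
      refine shear_of_reduced hact ?_ hv hd hf hd' hk hvk
      clear hvk hk k hd' hf hd hv hfm f v
      intro u f k hk hu hd hf hd' hut hut'
      have hkm : k ≠ m := by rintro rfl; exact hm hk
      have hfm := hf m hm
      have hw := swapGL_mem (F := F) hmJ (Finset.mem_insert_of_mem hk)
      have hcst : ∀ w : ι → F[X], DegLE 0 w → (∀ i, (w i).coeff 0 = if i = k then 1 else 0) →
          w = Pi.single k 1 := by
        intro w hwd hwt
        ext1 i
        rw [eq_C_of_natDegree_eq_zero
          (Nat.le_zero.1 (natDegree_le_iff_coeff_eq_zero.2 fun n hn => hwd i n hn)), hwt,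
          Pi.single_apply]
        split_ifs <;> simp
      have h1 := hcst u hd hut
      have h2 := hcst _ hd' hut'
      have hfk : f k = 0 := by
        have h3 := congrFun h2 m
        rw [shear_apply_self, h1, Pi.single_eq_of_ne hkm.symm, dotProduct_single] at h3
        simpa using h3
      have h3 : u = constAct (swapGL F m k) (Pi.single m 1) := by
        rw [h1]
        ext1 i
        have h4 : swapGL F m k i m = if i = k then 1 else 0 := by
          rw [swapGL_apply]
          congr 1
          rw [Equiv.swap_apply_eq_iff, Equiv.swap_apply_left]
        rw [constAct_single, h4, Pi.single_apply]
        split_ifs <;> simp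
      rw [h2, ← h1, h3, baseCoset_eq hw]
      have h4 := A.conj_transport (swapGL_col (F := F) m k) (f := f) hfk
      have h5 : transport (swapGL F m k) 1 f = f := by
        have h7 : ∀ j, transport (swapGL F m k) 1 f (Equiv.swap m k j) = f j := by
          intro j
          have h6 := transport_spec (swapGL F m k) 1 f j
          simp only [swapGL_apply, map_one, one_mul, Equiv.swap_apply_eq_iff] at h6
          simpa [apply_ite C] using h6
        ext1 j
        rw [← Equiv.swap_apply_self m k j, h7, Equiv.swap_apply_self]
        by_cases hjm : j = m
        · subst hjm; rw [Equiv.swap_apply_left, hfm, hfk]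
        · by_cases hjk : j = k
          · subst hjk; rw [Equiv.swap_apply_right, hfm, hfk]
          · rw [Equiv.swap_apply_of_ne_of_ne hjm hjk]
      rw [h5] at h4
      refine QuotientGroup.eq.2 ?_
      change (A.α _)⁻¹ * (A.ρ m f * A.α _) ∈ A.stab hm
      rw [← h4, inv_mul_cancel_left]
      refine A.level_le_stab hm (A.ρ_mem_level hk fun j hj => ?_)
      by_cases hjk : j = k
      · rw [hjk, hfk]
      · exact hf j fun h => hj (Finset.mem_erase.2 ⟨hjk, h⟩)
    · push Not at hk
      have hoff : ∀ j, j ≠ m → v j = 0 := by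
        intro j hjm
        by_cases hj : j ∈ L
        · rw [eq_C_of_natDegree_eq_zero
            (Nat.le_zero.1 (natDegree_le_iff_coeff_eq_zero.2 fun n hn => hd j n hn)), hk j hj,
            C_0]
        · exact hv.1 j (by simp [hjm, hj])
      have hfv : f ⬝ᵥ v = 0 := by
        rw [dotProduct]
        refine Finset.sum_eq_zero fun j _ => ?_
        by_cases hjm : j = m
        · rw [hjm, hfm, zero_mul]
        · rw [hoff j hjm, mul_zero]
      have hs : shear m f v = v := by rw [_root_.shear, hfv]; simp
      rw [hs]
      obtain ⟨g, hg, hgv⟩ := exists_const hmJ hv hd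
      have hcol : ∀ i, g i m = if i = m then g m m else 0 := by
        intro i
        by_cases him : i = m
        · rw [him, if_pos rfl]
        · rw [if_neg him]
          apply C_injective
          rw [← constAct_single, ← hgv, hoff i him, C_0]
      have hcol' : ∀ i, (g⁻¹ : GL ι F) i m = if i = m then (g m m)⁻¹ else 0 := by
        have h1 : (g : Matrix ι ι F) *ᵥ Pi.single m 1 = g m m • Pi.single m 1 := by
          rw [Matrix.mulVec_single_one]
          ext i
          rw [Matrix.col_apply, hcol, Pi.smul_apply, Pi.single_apply]
          simp
        have h2 : Pi.single m 1 = g m m • (((g⁻¹ : GL ι F) : Matrix ι ι F) *ᵥ Pi.single m 1) := by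
          rw [← Matrix.mulVec_smul, ← h1, Matrix.mulVec_mulVec, ← Units.val_mul, inv_mul_cancel,
            Units.val_one, Matrix.one_mulVec]
        intro i
        have h3 := congrFun h2 i
        rw [Matrix.mulVec_single_one, Pi.smul_apply, Matrix.col_apply, Pi.single_apply,
          smul_eq_mul] at h3
        have h4 : g m m ≠ 0 := by
          intro h0
          have := congrFun h2 m
          rw [h0] at this
          simp at this
        rw [show (g⁻¹ : GL ι F).val i m = (g m m)⁻¹ * (g m m * (g⁻¹ : GL ι F).val i m) by
          rw [inv_mul_cancel_left₀ h4], ← h3]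
        simp
      rw [hgv, baseCoset_eq hg]
      have h4 := A.conj_transport (h := g⁻¹) hcol' (f := f) hfm
      refine QuotientGroup.eq.2 ?_
      change (A.α _)⁻¹ * (A.ρ m f * A.α _) ∈ A.stab hm
      rw [← map_inv, ← mul_assoc, h4, mul_assoc, ← map_mul, inv_mul_cancel, map_one,
        mul_one]
      exact A.ρ_mem_stab hm (transport_supp_erase (inv_mem hg) hcol'
        (by rwa [Finset.erase_insert hm]))

theorem exists_cosetMap (hm : m ∉ L) (d : ℕ) : ∃ c, A.CosetMap hm d c := by
  induction d with
  | zero => exact ⟨_, cosetMap_zero⟩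
  | succ d ih =>
    obtain ⟨c, hc⟩ := ih
    exact ⟨_, hc.extend⟩

end PolySys
end

section
open Polynomial
open scoped Matrix MatrixGroups

namespace PolySys

variable {F ι Γ K : Type*} [Field F] [Fintype ι] [DecidableEq ι] [Group Γ]
    [CommRing K] {A : PolySys F ι Γ K}
  {m : ι} {L : Finset ι}

theorem exists_act_gen (hm : m ∉ L) {s : Γ} (hs : s ∈ A.gens (insert m L)) {v : ι → F[X]}
    (hv : Good (insert m L) v) : ∃ v', Good (insert m L) v' ∧
      A.π s *ᵥ (fun i => A.φ (v i)) = (fun i => A.φ (v' i)) ∧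
      ∃ d₀, ∀ d c, d₀ ≤ d → A.CosetMap hm d c → c v' = s • c v := by
  obtain ⟨d, hd⟩ := exists_degLE v
  rcases hs with ⟨h, hh, rfl⟩ | ⟨k, hk, f, hf, rfl⟩
  · refine ⟨constAct h v, hv.constAct hh, ?_, d, fun d' c hd' E =>
      E.act v hv (hd.mono hd') h hh⟩
    ext1 i
    rw [A.π_α, constAct_apply, map_sum]
    simp [Matrix.mulVec, dotProduct]
  · have hfk : f k = 0 := hf k (by simp)
    obtain ⟨e, he⟩ := exists_degLE (shear k f v)
    refine ⟨shear k f v, hv.shear hk hfk, ?_, max d e, fun d' c hd' E =>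
      E.shear_row hk hv (hd.mono (le_of_max_le_left hd')) hf (he.mono (le_of_max_le_right hd'))⟩
    ext1 i
    rw [A.π_ρ k f hfk, shear, ← rowMat_mulVec hfk]
    exact (RingHom.map_mulVec A.φ _ _ i).symm

theorem exists_act (hm : m ∉ L) {γ : Γ} (hγ : γ ∈ A.level (insert m L)) : ∃ v',
      A.π γ *ᵥ (fun i => A.φ ((Pi.single m 1 : ι → F[X]) i)) = (fun i => A.φ (v' i)) ∧
      Good (insert m L) v' ∧
      ∃ d₀, ∀ d c, d₀ ≤ d → A.CosetMap hm d c → c v' = (γ : Γ ⧸ A.stab hm) := by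
  have step : ∀ s ∈ A.gens (insert m L), ∀ y : Γ, (∃ v',
      A.π y *ᵥ (fun i => A.φ ((Pi.single m 1 : ι → F[X]) i)) = (fun i => A.φ (v' i)) ∧
      Good (insert m L) v' ∧
      ∃ d₀, ∀ d c, d₀ ≤ d → A.CosetMap hm d c → c v' = (y : Γ ⧸ A.stab hm)) → ∃ v',
      A.π (s * y) *ᵥ (fun i => A.φ ((Pi.single m 1 : ι → F[X]) i)) = (fun i => A.φ (v' i)) ∧
      Good (insert m L) v' ∧
      ∃ d₀, ∀ d c, d₀ ≤ d → A.CosetMap hm d c → c v' = ((s * y : Γ) : Γ ⧸ A.stab hm) := by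
    rintro s hs y ⟨v, hv, hg, d, hd⟩
    obtain ⟨v', hg', hv', d', hd'⟩ := exists_act_gen hm hs hg
    refine ⟨v', ?_, hg', max d d', fun D c hD E => ?_⟩
    · rw [map_mul, ← Matrix.mulVec_mulVec, hv, hv']
    · rw [hd' D c (le_of_max_le_right hD) E, hd D c (le_of_max_le_left hD) E]
      rfl
  induction hγ using Subgroup.closure_induction_left with
  | one =>
    refine ⟨Pi.single m 1, by simp, good_single (Finset.mem_insert_self m L), 0,
      fun d c _ E => E.base⟩
  | mul_left x hx y _ hy => exact step x hx y hy
  | inv_mul_cancel x hx y _ hy => exact step _ (A.inv_mem_gen hx) y hy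

theorem eq_one_of_mem_level (J : Finset ι) : ∀ γ ∈ A.level J, A.π γ = 1 → γ = 1 := by
  induction J using Finset.induction_on with
  | empty =>
    intro γ hγ _
    have : A.level ∅ ≤ ⊥ := by
      refine (Subgroup.closure_le _).2 ?_
      rintro g (⟨h, hh, rfl⟩ | ⟨k, hk, _⟩)
      · have : h = 1 := by
          ext i j
          rw [hh i j (by simp)]; rfl
        rw [this, map_one]; exact one_mem _
      · simp at hk
    exact Subgroup.mem_bot.1 (this hγ)
  | insert m L hm ih =>
    intro γ hγ hπ
    obtain ⟨v, hv, hg, d, hd⟩ := exists_act hm hγ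
    obtain ⟨c, hc⟩ := A.exists_cosetMap hm d
    have h1 := hd d c le_rfl hc
    have h2 : v = Pi.single m 1 := by
      ext1 i
      apply A.φ_inj
      rw [hπ, Matrix.one_mulVec] at hv
      exact (congrFun hv i).symm
    rw [h2, hc.base] at h1
    obtain ⟨_, ⟨f, hf, rfl⟩, x, hx, rfl⟩ : γ ∈ A.stab hm := by
      have := QuotientGroup.eq.1 h1
      simpa using this
    have hfm := hf m hm
    have h3 : f = 0 := by
      have h4 : A.π (A.ρ m f) = A.π x⁻¹ := by
        rw [← mul_one (A.π (A.ρ m f)), ← map_one A.π, ← mul_inv_cancel x, map_mul A.π x,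
          ← mul_assoc, ← map_mul, hπ, one_mul]
      ext1 i
      apply A.φ_inj
      have h5 := congrFun (congrFun h4 m) i
      rw [A.π_level (inv_mem hx) m i hm, A.π_ρ m f hfm, Matrix.map_apply, rowMat_apply,
        Matrix.one_apply] at h5
      by_cases him : m = i
      · subst him; simp [hfm]
      · simpa [him, Ne.symm him] using h5
    rw [h3, A.ρ_zero, one_mul] at hπ ⊢
    exact ih x hx hπ

end PolySys
end

section

/-- Root subgroups over `F`, for a closed set of roots of type `A`, satisfying Steinberg relations,
together with a torus whose elements centralize the root subgroups on which they act trivially. -/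
structure RootSys (F ι Γ : Type*) [Ring F] [Group Γ] where
  Φ : ι → ι → Prop
  x : ι → ι → F → Γ
  τ : (ι → ℤ) → Γ
  D : AddSubgroup (ι → ℤ)
  irrefl : ∀ i, ¬ Φ i i
  trans : ∀ i j k, Φ i j → Φ j k → i ≠ k → Φ i k
  τ_add : ∀ d e, τ (d + e) = τ d * τ e
  commute_τ : ∀ i j, Φ i j → ∀ d ∈ D, d i = d j → ∀ c, Commute (τ d) (x i j c)
  x_add : ∀ i j, Φ i j → ∀ c c', x i j (c + c') = x i j c * x i j c'
  commute_x : ∀ i j k l, Φ i j → Φ k l → j ≠ k → i ≠ l → ∀ c c', Commute (x i j c) (x k l c')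
  x_mul : ∀ i j k, Φ i j → Φ j k → i ≠ k → ∀ c c',
    x i j c * x j k c' = x j k c' * x i j c * x i k (c * c')
  rich : ∀ i j k l, Φ i j → Φ k l → (i = k → j ≠ l) → (i = l → j ≠ k) → ∀ p q,
    ∃ d ∈ D, d i - d j = p ∧ d k - d l = q
  exists_mid : ∀ i j, Φ i j → ∃ k, Φ i k ∧ Φ k j

namespace RootSys

variable {F ι Γ : Type*} [Ring F] [Group Γ] (A : RootSys F ι Γ)

theorem ne {i j : ι} (h : A.Φ i j) : i ≠ j := by
  rintro rfl; exact A.irrefl i h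

theorem τ_zero : A.τ 0 = 1 := by
  have := A.τ_add 0 0
  rw [add_zero] at this
  exact left_eq_mul.1 this

theorem τ_neg (d : ι → ℤ) : A.τ (-d) = (A.τ d)⁻¹ := by
  rw [eq_inv_iff_mul_eq_one, ← A.τ_add, neg_add_cancel, A.τ_zero]

theorem exists_degree {i j : ι} (h : A.Φ i j) (p : ℤ) : ∃ d ∈ A.D, d i - d j = p := by
  obtain ⟨k, h1, h2⟩ := A.exists_mid i j h
  obtain ⟨d, hd, h3, _⟩ := A.rich i j i k h h1 (fun _ => (A.ne h2).symm)
    (fun h => absurd h (A.ne h1)) p 0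
  exact ⟨d, hd, h3⟩

open Classical in
/-- The torus conjugate of a root element with degree `p`. -/
noncomputable def y (i j : ι) (p : ℤ) (c : F) : Γ :=
  if h : ∃ d ∈ A.D, d i - d j = p then A.τ h.choose * A.x i j c * (A.τ h.choose)⁻¹ else 1

theorem y_eq {i j : ι} (h : A.Φ i j) {d : ι → ℤ} (hd : d ∈ A.D) (c : F) :
    A.y i j (d i - d j) c = A.τ d * A.x i j c * (A.τ d)⁻¹ := by
  have h1 : ∃ d' ∈ A.D, d' i - d' j = d i - d j := ⟨d, hd, rfl⟩
  rw [y, dif_pos h1]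
  obtain ⟨h2, h3⟩ := h1.choose_spec
  generalize h1.choose = e at h2 h3 ⊢
  have h4 := A.commute_τ i j h (-d + e) (add_mem (neg_mem hd) h2)
    (by simp only [Pi.add_apply, Pi.neg_apply]; lia) c
  rw [A.τ_add, A.τ_neg] at h4
  have h5 := h4.eq
  rw [mul_inv_eq_iff_eq_mul]
  have h6 : A.τ e * A.x i j c = A.τ d * ((A.τ d)⁻¹ * A.τ e * A.x i j c) := by group
  rw [h6, h5]
  group

theorem y_add {i j : ι} (h : A.Φ i j) (p : ℤ) (c c' : F) :
    A.y i j p (c + c') = A.y i j p c * A.y i j p c' := by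
  obtain ⟨d, hd, rfl⟩ := A.exists_degree h p
  rw [A.y_eq h hd, A.y_eq h hd, A.y_eq h hd, A.x_add i j h]
  group

theorem y_zero {i j : ι} (h : A.Φ i j) (c : F) : A.y i j 0 c = A.x i j c := by
  have := A.y_eq h (zero_mem A.D) c
  simpa [A.τ_zero] using this

theorem τ_mul_y {i j : ι} (h : A.Φ i j) {d : ι → ℤ} (hd : d ∈ A.D) (p : ℤ) (c : F) :
    A.τ d * A.y i j p c * (A.τ d)⁻¹ = A.y i j (p + (d i - d j)) c := by
  obtain ⟨e, he, rfl⟩ := A.exists_degree h p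
  have := A.y_eq h (add_mem hd he) c
  rw [show (d + e) i - (d + e) j = e i - e j + (d i - d j) by
    simp only [Pi.add_apply]; ring] at this
  rw [this, A.y_eq h he, A.τ_add]
  group

theorem y_mul {i j k : ι} (hij : A.Φ i j) (hjk : A.Φ j k) (hik : i ≠ k) (p q : ℤ) (c c' : F) :
    A.y i j p c * A.y j k q c' = A.y j k q c' * A.y i j p c * A.y i k (p + q) (c * c') := by
  obtain ⟨d, hd, rfl, rfl⟩ := A.rich i j j k hij hjk (fun h => absurd h (A.ne hij))
    (fun h => absurd h hik) p q
  have h1 := A.y_eq (A.trans i j k hij hjk hik) hd (c * c')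
  rw [← sub_add_sub_cancel _ (d j)] at h1
  rw [h1, A.y_eq hij hd, A.y_eq hjk hd]
  have := A.x_mul i j k hij hjk hik c c'
  calc _ = A.τ d * (A.x i j c * A.x j k c') * (A.τ d)⁻¹ := by group
    _ = _ := by rw [this]; group

theorem commute_y {i j k l : ι} (hij : A.Φ i j) (hkl : A.Φ k l) (hjk : j ≠ k) (hil : i ≠ l)
    (p q : ℤ) (c c' : F) : Commute (A.y i j p c) (A.y k l q c') := by
  have key : ∀ {i j k l : ι}, A.Φ i j → A.Φ k l → j ≠ k → i ≠ l → (i = k → j ≠ l) →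
      ∀ p q c c', Commute (A.y i j p c) (A.y k l q c') := by
    intro i j k l hij hkl hjk hil hne p q c c'
    obtain ⟨d, hd, rfl, rfl⟩ := A.rich i j k l hij hkl hne (fun h => absurd h hil) p q
    rw [A.y_eq hij hd, A.y_eq hkl hd]
    exact (A.commute_x i j k l hij hkl hjk hil c c').conj _
  by_cases hne : i = k → j ≠ l
  · exact key hij hkl hjk hil hne p q c c'
  · push Not at hne
    obtain ⟨rfl, rfl⟩ := hne
    obtain ⟨m, him, hmj⟩ := A.exists_mid i j hij
    have h1 := A.y_mul him hmj (A.ne hij) q 0 c' 1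
    rw [add_zero, mul_one, ← inv_mul_eq_iff_eq_mul] at h1
    rw [← h1]
    have h2 := key hij him (A.ne hij).symm (A.ne him) (fun _ => (A.ne hmj).symm) p q c c'
    have h3 := key hij hmj (A.ne hmj).symm (A.ne hij) (fun h => absurd h (A.ne him)) p 0 c 1
    exact ((h3.mul_right h2).inv_right).mul_right (h2.mul_right h3)

end RootSys
end

section
open LaurentPolynomial
open scoped Matrix MatrixGroups

section
variable {S ι : Type*} [CommRing S] [Fintype ι] [DecidableEq ι]

theorem rowMat_mul_rowMat {m k : ι} {f e : ι → S} (hmk : m ≠ k) (hf : f m = 0) (hk : e k = 0)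
    (hm : e m = 0) : rowMat m f * rowMat k e = rowMat k e * rowMat m (f + f k • e) := by
  rw [rowMat_of_eq_zero hf, rowMat_of_eq_zero hk, rowMat_of_eq_zero (m := m) (by simp [hf, hm])]
  simp only [mul_add, add_mul, Matrix.vecMulVec_mul_vecMulVec, dotProduct_single, hm, mul_one,
    one_mul, zero_smul, Matrix.vecMulVec_zero, add_zero, Matrix.vecMulVec_add]
  abel

theorem rowUnit_mul_rowUnit {m k : ι} {f e : ι → S} (hmk : m ≠ k) (hf : f m = 0) (hk : e k = 0)
    (hm : e m = 0) : rowUnit m f * rowUnit k e = rowUnit k e * rowUnit m (f + f k • e) :=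
  Units.ext (rowMat_mul_rowMat hmk hf hk hm)

theorem rowUnit_commute (m : ι) (f e : ι → S) : Commute (rowUnit m f) (rowUnit m e) := by
  rw [commute_iff_eq, rowUnit_mul, rowUnit_mul, add_comm]

theorem rowUnit_single_commute {i j k l : ι} (hij : i ≠ j) (hkl : k ≠ l) (hjk : j ≠ k)
    (hil : i ≠ l) (c c' : S) :
    Commute (rowUnit i (Pi.single j c)) (rowUnit k (Pi.single l c')) := by
  by_cases hik : i = k
  · subst hik; exact rowUnit_commute _ _ _
  · rw [commute_iff_eq, rowUnit_mul_rowUnit hik (by simp [hij]) (by simp [hkl]) (by simp [hil])]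
    simp [hjk.symm]

theorem rowUnit_single_mul {i j k : ι} (hij : i ≠ j) (hjk : j ≠ k) (hik : i ≠ k) (c c' : S) :
    rowUnit i (Pi.single j c) * rowUnit j (Pi.single k c') =
      rowUnit j (Pi.single k c') * rowUnit i (Pi.single j c) *
        rowUnit i (Pi.single k (c * c')) := by
  rw [rowUnit_mul_rowUnit hij (by simp [hij]) (by simp [hjk]) (by simp [hik]), mul_assoc,
    rowUnit_mul, Pi.single_eq_same, ← Pi.single_smul, smul_eq_mul]

theorem rowMat_self (m : ι) (c : S) : rowMat m (Pi.single m c) = 1 := by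
  rw [rowMat, show Function.update (Pi.single m c : ι → S) m 0 = 0 by
    ext i; by_cases h : i = m <;> simp [h]]
  simp

theorem rowUnit_self (m : ι) (c : S) : rowUnit m (Pi.single m c) = 1 :=
  Units.ext (rowMat_self m c)

theorem diagonal_mul_rowMat {a : ι → S} {m : ι} {r r' : ι → S}
    (h : ∀ k, k ≠ m → a m * r k = r' k * a k) :
    Matrix.diagonal a * rowMat m r = rowMat m r' * Matrix.diagonal a := by
  ext i j
  rw [Matrix.diagonal_mul, Matrix.mul_diagonal, rowMat_apply, rowMat_apply]
  split_ifs with h1 h2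
  · subst h1; ring
  · subst h2; exact h j (Ne.symm h1)
  · simp

end

theorem exists_degrees {ι : Type*} [DecidableEq ι] {i j k l : ι} (hij : i ≠ j) (hkl : k ≠ l)
    (h1 : i = k → j ≠ l) (h2 : i = l → j ≠ k) (p q : ℤ) :
    ∃ d : ι → ℤ, d i - d j = p ∧ d k - d l = q := by
  by_cases hik : i = k
  · subst hik
    refine ⟨Pi.single j (-p) + Pi.single l (-q), ?_, ?_⟩ <;>
      simp [hij, hkl, h1 rfl, (h1 rfl).symm]
  by_cases hil : i = l
  · subst hil
    refine ⟨Pi.single j (-p) + Pi.single k q, ?_, ?_⟩ <;>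
      simp [hij, hik, hkl, h2 rfl, (h2 rfl).symm]
  by_cases hjk : j = k
  · subst hjk
    refine ⟨Pi.single i p + Pi.single l (-q), ?_, ?_⟩ <;>
      simp [hij, hik, hkl, hil, Ne.symm hij, Ne.symm hil]
  · refine ⟨Pi.single i p + Pi.single k q, ?_, ?_⟩ <;>
      simp [hik, hil, hjk, Ne.symm hij, Ne.symm hik, Ne.symm hil, Ne.symm hkl]

/-- A group with a homomorphic copy of `GL` over a field and commuting elements `τ (single k 1)`
which behave like the diagonal matrices with a single entry `T`, and a linear representation. -/
structure TorusSys (F ι Γ : Type*) [Field F] [Fintype ι] [DecidableEq ι] [Group Γ] where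
  α : GL ι F →* Γ
  τ : (ι → ℤ) → Γ
  π : Γ →* Matrix ι ι F[T;T⁻¹]
  τ_add : ∀ d e, τ (d + e) = τ d * τ e
  π_α : ∀ h : GL ι F, π (α h) = (h : Matrix ι ι F).map C
  π_τ : ∀ d, π (τ d) = Matrix.diagonal fun i => T (d i)
  mono : ∀ (h : GL ι F) m k c, (∀ i, h i k = if i = m then c else 0) →
    (∀ j, h m j = if j = k then c else 0) →
    α h * τ (Pi.single k 1) = τ (Pi.single m 1) * α h
  pair : ∀ i j, i ≠ j → ∀ c,
    Commute (τ (Pi.single i 1 + Pi.single j 1)) (α (rowUnit i (Pi.single j c)))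
  exists_mid : ∀ i j : ι, ∃ k, k ≠ i ∧ k ≠ j

/-- The degrees at which a torus homomorphism commutes with `g`. -/
def commDeg {Γ ι : Type*} [Group Γ] (τ : (ι → ℤ) → Γ) (hτ : ∀ d e, τ (d + e) = τ d * τ e) (g : Γ) :
    AddSubgroup (ι → ℤ) where
  carrier := {d | Commute (τ d) g}
  zero_mem' := by
    have h1 := hτ 0 0
    rw [add_zero] at h1
    simp [left_eq_mul.1 h1]
  add_mem' := by
    intro d e hd he
    simp only [Set.mem_ofPred_eq] at hd he ⊢
    rw [hτ]; exact hd.mul_left he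
  neg_mem' := by
    intro d hd
    have h1 := hτ 0 0
    rw [add_zero] at h1
    have h2 := hτ (-d) d
    rw [neg_add_cancel, left_eq_mul.1 h1, eq_comm, ← eq_inv_iff_mul_eq_one] at h2
    simp only [Set.mem_ofPred_eq] at hd ⊢
    rw [h2]; exact hd.inv_left

namespace TorusSys

variable {F ι Γ : Type*} [Field F] [Fintype ι] [DecidableEq ι] [Group Γ] (A : TorusSys F ι Γ)

theorem mono_zpow {h : GL ι F} {m k : ι} {c : F} (hc : ∀ i, h i k = if i = m then c else 0)
    (hr : ∀ j, h m j = if j = k then c else 0) (p : ℤ) :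
    A.α h * A.τ (Pi.single k p) = A.τ (Pi.single m p) * A.α h := by
  let S : AddSubgroup ℤ :=
    { carrier := {p | A.α h * A.τ (Pi.single k p) = A.τ (Pi.single m p) * A.α h}
      zero_mem' := by
        have h1 := A.τ_add 0 0
        rw [add_zero] at h1
        simp [left_eq_mul.1 h1]
      add_mem' := by
        intro p q hp hq
        simp only [Set.mem_ofPred_eq] at hp hq ⊢
        rw [Pi.single_add, Pi.single_add, A.τ_add, A.τ_add, ← mul_assoc, hp, mul_assoc, hq,
          mul_assoc]
      neg_mem' := by
        intro p hp
        have h1 := A.τ_add 0 0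
        rw [add_zero] at h1
        have h2 : ∀ d, A.τ (-d) = (A.τ d)⁻¹ := by
          intro d
          rw [eq_inv_iff_mul_eq_one, ← A.τ_add, neg_add_cancel, left_eq_mul.1 h1]
        simp only [Set.mem_ofPred_eq] at hp ⊢
        rw [Pi.single_neg, Pi.single_neg, h2, h2, mul_inv_eq_iff_eq_mul, mul_assoc, hp,
          inv_mul_cancel_left] }
  have h1 : (1 : ℤ) ∈ S := A.mono h m k c hc hr
  have h2 := zsmul_mem h1 p
  rwa [zsmul_one, Int.cast_id] at h2

theorem commute_τ_rowUnit {i j : ι} (hij : i ≠ j) {d : ι → ℤ} (hd : d i = d j) (c : F) :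
    Commute (A.τ d) (A.α (rowUnit i (Pi.single j c))) := by
  set H := commDeg A.τ A.τ_add (A.α (rowUnit i (Pi.single j c))) with hH
  have h1 : ∀ k, k ≠ i → k ≠ j → (Pi.single k 1 : ι → ℤ) ∈ H := by
    intro k hki hkj
    refine (A.mono _ k k 1 (fun l => ?_) (fun l => ?_)).symm
    · rw [rowUnit_val, rowMat_apply]
      split_ifs <;> simp [hkj]
    · rw [rowUnit_val, rowMat_apply, if_neg hki]
      simp [eq_comm]
  have h2 : ∀ e : ι → ℤ, e i = 0 → e j = 0 → e ∈ H := by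
    intro e hi hj
    rw [← Finset.univ_sum_single e]
    refine sum_mem fun k _ => ?_
    by_cases hki : k = i
    · subst hki; rw [hi, Pi.single_zero]; exact zero_mem _
    by_cases hkj : k = j
    · subst hkj; rw [hj, Pi.single_zero]; exact zero_mem _
    have := zsmul_mem (h1 k hki hkj) (e k)
    rwa [← Pi.single_smul, smul_eq_mul, mul_one] at this
  have h3 : (Pi.single i 1 + Pi.single j 1 : ι → ℤ) ∈ H := A.pair i j hij c
  have h4 := h2 (d - d i • (Pi.single i 1 + Pi.single j 1)) (by simp [hij.symm, hij])
    (by simp [hij.symm, hij, hd])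
  have h5 := add_mem h4 (zsmul_mem h3 (d i))
  rwa [sub_add_cancel] at h5

/-- The root system of all pairs of distinct indices. -/
def roots : RootSys F ι Γ where
  Φ i j := i ≠ j
  x i j c := A.α (rowUnit i (Pi.single j c))
  τ := A.τ
  D := ⊤
  irrefl _ h := h rfl
  trans _ _ _ _ _ h := h
  τ_add := A.τ_add
  commute_τ _ _ h _ _ hd c := A.commute_τ_rowUnit h hd c
  x_add _ _ _ c c' := by rw [← map_mul, rowUnit_mul, Pi.single_add]
  commute_x _ _ _ _ hij hkl hjk hil c c' := (rowUnit_single_commute hij hkl hjk hil c c').map A.α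
  x_mul _ _ _ hij hjk hik c c' := by
    rw [← map_mul, rowUnit_single_mul hij hjk hik, map_mul, map_mul]
  rich _ _ _ _ hij hkl h1 h2 p q := by
    obtain ⟨d, h3⟩ := exists_degrees hij hkl h1 h2 p q
    exact ⟨d, AddSubgroup.mem_top d, h3⟩
  exists_mid i j _ := by
    obtain ⟨k, h1, h2⟩ := A.exists_mid i j
    exact ⟨k, h1.symm, h2⟩

theorem exists_ρ (m : ι) : ∃ θ : (ι → F[T;T⁻¹]) → Γ, (∀ f g, θ (f + g) = θ f * θ g) ∧
    (∀ k p c, θ (Pi.single k (C c * T p)) = if k = m then 1 else A.roots.y m k p c) := by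
  obtain ⟨θ, h1, h2, _⟩ := exists_hom_of_commuting (F := F)
    (fun k p c => if k = m then 1 else A.roots.y m k p c) (by
      intro k p c c'
      split_ifs with h
      · simp
      · exact A.roots.y_add (Ne.symm h) p c c') (by
      intro k p c k' p' c'
      split_ifs with h h'
      · simp
      · simp
      · simp
      · rename_i h''
        exact A.roots.commute_y (Ne.symm h) (Ne.symm h'') h (Ne.symm h'') p p' c c')
  exact ⟨θ, h1, h2⟩

/-- The row subgroups over the Laurent polynomial ring. -/
noncomputable def ρ (m : ι) : (ι → F[T;T⁻¹]) → Γ := (A.exists_ρ m).choose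

theorem ρ_add (m : ι) (f g : ι → F[T;T⁻¹]) : A.ρ m (f + g) = A.ρ m f * A.ρ m g :=
  (A.exists_ρ m).choose_spec.1 f g

theorem ρ_self (m : ι) (p : ℤ) (c : F) : A.ρ m (Pi.single m (C c * T p)) = 1 := by
  rw [ρ, (A.exists_ρ m).choose_spec.2, if_pos rfl]

theorem ρ_single {m k : ι} (h : m ≠ k) (p : ℤ) (c : F) :
    A.ρ m (Pi.single k (C c * T p)) = A.roots.y m k p c := by
  rw [ρ, (A.exists_ρ m).choose_spec.2, if_neg h.symm]

theorem ρ_zero (m : ι) : A.ρ m 0 = 1 := by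
  have := A.ρ_add m 0 0
  rw [add_zero] at this
  exact left_eq_mul.1 this

theorem ρ_commute (m : ι) (f g : ι → F[T;T⁻¹]) : Commute (A.ρ m f) (A.ρ m g) := by
  rw [commute_iff_eq, ← A.ρ_add, ← A.ρ_add, add_comm]

theorem τ_mul_ρ (d : ι → ℤ) (m : ι) (f : ι → F[T;T⁻¹]) :
    A.τ d * A.ρ m f * (A.τ d)⁻¹ = A.ρ m (fun k => T (d m - d k) * f k) := by
  refine vec_induction (P := fun f => A.τ d * A.ρ m f * (A.τ d)⁻¹ =
    A.ρ m (fun k => T (d m - d k) * f k)) (fun _ => True) ?_ ?_ ?_ f (by simp)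
  · have : (fun k => T (d m - d k) * (0 : ι → F[T;T⁻¹]) k) = 0 := by ext1 k; simp
    rw [this, A.ρ_zero]; simp
  · intro f g hf hg
    have : (fun k => T (d m - d k) * (f + g) k) =
        (fun k => T (d m - d k) * f k) + (fun k => T (d m - d k) * g k) := by
      ext1 k; simp [mul_add]
    rw [this, A.ρ_add, A.ρ_add, ← hf, ← hg]
    group
  · intro k _ p c
    have : (fun j => T (d m - d j) * (Pi.single k (C c * T p) : ι → F[T;T⁻¹]) j) =
        Pi.single k (C c * T (p + (d m - d k))) := by
      ext1 j
      by_cases hj : j = k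
      · subst hj
        rw [Pi.single_eq_same, Pi.single_eq_same, T_add]; ring
      · simp [hj]
    rw [this]
    by_cases hk : m = k
    · subst hk; rw [A.ρ_self, A.ρ_self]; simp
    · rw [A.ρ_single hk, A.ρ_single hk]
      exact A.roots.τ_mul_y hk (AddSubgroup.mem_top d) p c

theorem ρ_const (m : ι) (r : ι → F) : A.ρ m (fun i => C (r i)) = A.α (rowUnit m r) := by
  have key : ∀ t : Finset ι, A.ρ m (fun i => C ((∑ k ∈ t, Pi.single k (r k) : ι → F) i)) =
      A.α (rowUnit m (∑ k ∈ t, Pi.single k (r k))) := by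
    intro t
    induction t using Finset.induction_on with
    | empty =>
      rw [Finset.sum_empty, rowUnit_zero, map_one]
      convert A.ρ_zero m using 2
      ext1 i; simp
    | insert k t hk ih =>
      rw [Finset.sum_insert hk, ← rowUnit_mul, map_mul, ← ih]
      have : (fun i => C ((Pi.single k (r k) + ∑ x ∈ t, Pi.single x (r x) : ι → F) i)) =
          Pi.single k (C (r k) * T 0) +
            fun i => C ((∑ x ∈ t, Pi.single x (r x) : ι → F) i) := by
        ext1 i
        by_cases hi : i = k
        · subst hi; simp
        · simp [hi]
      rw [this, A.ρ_add]
      congr 1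
      by_cases hkm : m = k
      · subst hkm; rw [A.ρ_self, rowUnit_self, map_one]
      · rw [A.ρ_single hkm, A.roots.y_zero hkm]; rfl
  have := key Finset.univ
  rwa [Finset.univ_sum_single] at this

theorem ρ_commute_of_ne {m k : ι} (hmk : m ≠ k) {f e : ι → F[T;T⁻¹]} (hfk : f k = 0)
    (hem : e m = 0) : Commute (A.ρ m f) (A.ρ k e) := by
  refine vec_induction (P := fun f => Commute (A.ρ m f) (A.ρ k e)) (fun j => j ≠ k) ?_ ?_ ?_ f
    (by simp [hfk])
  · rw [A.ρ_zero]; exact Commute.one_left _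
  · intro f g hf hg
    rw [A.ρ_add]; exact hf.mul_left hg
  intro j hj p c
  refine vec_induction (P := fun e => Commute (A.ρ m (Pi.single j (C c * T p))) (A.ρ k e))
    (fun j => j ≠ m) ?_ ?_ ?_ e (by simp [hem])
  · rw [A.ρ_zero]; exact Commute.one_right _
  · intro f g hf hg
    rw [A.ρ_add]; exact hf.mul_right hg
  intro l hl q c'
  by_cases hmj : m = j
  · subst hmj; rw [A.ρ_self]; exact Commute.one_left _
  by_cases hkl : k = l
  · subst hkl; rw [A.ρ_self]; exact Commute.one_right _
  rw [A.ρ_single hmj, A.ρ_single hkl]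
  exact A.roots.commute_y hmj hkl hj hl.symm p q c c'

theorem ρ_comm {m k : ι} (hmk : m ≠ k) {f e : ι → F[T;T⁻¹]} (hek : e k = 0)
    (hem : e m = 0) : A.ρ m f * A.ρ k e = A.ρ k e * A.ρ m (f + f k • e) := by
  refine vec_induction (P := fun f => A.ρ m f * A.ρ k e = A.ρ k e * A.ρ m (f + f k • e))
    (fun _ => True) ?_ ?_ ?_ f (by simp)
  · simp [A.ρ_zero]
  · intro f g hf hg
    rw [A.ρ_add, mul_assoc, hg, ← mul_assoc, hf, mul_assoc, ← A.ρ_add]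
    congr 2
    rw [Pi.add_apply, add_smul]; abel
  intro j _ p c
  by_cases hj : j = k
  · subst hj
    rw [Pi.single_eq_same]
    refine (vec_induction (P := fun e => (e j = 0 ∧ e m = 0) ∧
      A.ρ m (Pi.single j (C c * T p)) * A.ρ j e =
      A.ρ j e * A.ρ m (Pi.single j (C c * T p) + (C c * T p) • e)) (fun i => i ≠ j ∧ i ≠ m)
      ?_ ?_ ?_ e ?_).2
    · simp [A.ρ_zero]
    · rintro e g ⟨⟨hej, hem⟩, he⟩ ⟨⟨hgj, hgm⟩, hg⟩
      refine ⟨by simp [hej, hem, hgj, hgm], ?_⟩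
      have h1 := A.ρ_commute_of_ne hmk (f := (C c * T p : F[T;T⁻¹]) • e) (by simp [hej]) hgm
      rw [smul_add, A.ρ_add j, ← mul_assoc, he, A.ρ_add m, mul_assoc, mul_assoc, h1.eq,
        ← mul_assoc (A.ρ m _) (A.ρ j g), hg, add_left_comm, A.ρ_add m _ (_ + _),
        (A.ρ_commute m _ _).eq]
      simp only [mul_assoc]
    · rintro l ⟨hlj, hlm⟩ q c'
      refine ⟨by simp [hlj.symm, hlm.symm], ?_⟩
      have h1 : (C c * T p : F[T;T⁻¹]) • (Pi.single l (C c' * T q) : ι → F[T;T⁻¹]) =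
          Pi.single l (C (c * c') * T (p + q)) := by
        rw [← Pi.single_smul, smul_eq_mul, T_add, map_mul]
        congr 1
        ring
      rw [h1, A.ρ_add, A.ρ_single hmk, A.ρ_single hlj.symm, A.ρ_single hlm.symm, ← mul_assoc]
      exact A.roots.y_mul hmk hlj.symm hlm.symm p q c c'
    · intro i hi
      by_cases h : i = j
      · rw [h, hek]
      · rw [show i = m by tauto, hem]
  · rw [Pi.single_eq_of_ne (Ne.symm hj), zero_smul, add_zero]
    exact (A.ρ_commute_of_ne hmk (by simp [Ne.symm hj]) hem).eq

end TorusSys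
end

section
open LaurentPolynomial
open scoped Matrix MatrixGroups

section
variable {S ι : Type*} [CommRing S] [Fintype ι] [DecidableEq ι]

theorem mul_rowMat {h : Matrix ι ι S} {m k : ι} {c : S} (hc : ∀ i, h i k = if i = m then c else 0)
    {r r' : ι → S} (hr : r k = 0) (hr' : r' m = 0) (hrr : r' ᵥ* h = c • r) :
    h * rowMat k r = rowMat m r' * h := by
  have h1 : h *ᵥ Pi.single k 1 = c • Pi.single m 1 := by
    ext i
    rw [Matrix.mulVec_single_one, Matrix.col_apply, hc, Pi.smul_apply, Pi.single_apply]
    simp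
  rw [rowMat_of_eq_zero hr, rowMat_of_eq_zero hr', mul_add, add_mul, Matrix.mul_vecMulVec,
    Matrix.vecMulVec_mul, hrr, h1, Matrix.smul_vecMulVec, Matrix.vecMulVec_smul, mul_one, one_mul]

end

section
variable {F ι : Type*} [Field F] [Fintype ι] [DecidableEq ι]

theorem col_ne_zero {h : GL ι F} {m k : ι} {c : F} (hc : ∀ i, h i k = if i = m then c else 0) :
    c ≠ 0 := by
  rintro rfl
  have h2 : ((h⁻¹ : GL ι F) : Matrix ι ι F) * (h : Matrix ι ι F) = 1 := by
    rw [← Units.val_mul, inv_mul_cancel]; rfl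
  have h3 := congrFun (congrFun h2 k) k
  rw [Matrix.mul_apply, Finset.sum_eq_zero] at h3
  · simp at h3
  · intro i _
    rw [hc i]; simp

theorem inv_apply_of_col {h : GL ι F} {m k : ι} {c : F}
    (hc : ∀ i, h i k = if i = m then c else 0) (j : ι) :
    (h⁻¹ : GL ι F) j m = if j = k then c⁻¹ else 0 := by
  have h2 : ((h⁻¹ : GL ι F) : Matrix ι ι F) * (h : Matrix ι ι F) = 1 := by
    rw [← Units.val_mul, inv_mul_cancel]; rfl
  have h3 := congrFun (congrFun h2 j) k
  rw [Matrix.mul_apply, Finset.sum_eq_single m, hc m, if_pos rfl, Matrix.one_apply,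
    ← eq_div_iff (col_ne_zero hc)] at h3
  · change ((h⁻¹ : GL ι F) : Matrix ι ι F) j m = _
    rw [h3]
    split_ifs <;> simp
  · intro i _ hi
    rw [hc i, if_neg hi, mul_zero]
  · simp

theorem vecMul_inv_eq_zero {h : GL ι F} {m k : ι} {c : F}
    (hc : ∀ i, h i k = if i = m then c else 0) {r : ι → F} (hr : r k = 0) :
    (r ᵥ* ((h⁻¹ : GL ι F) : Matrix ι ι F)) m = 0 := by
  simp only [Matrix.vecMul, dotProduct]
  refine Finset.sum_eq_zero fun j _ => ?_
  rw [inv_apply_of_col hc]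
  split_ifs with hj
  · rw [hj, hr, zero_mul]
  · rw [mul_zero]

/-- An invertible matrix with column `k` supported at `m` is a product of a row operation and a
matrix whose row `m` is supported at `k`. -/
theorem exists_levi_factor {h : GL ι F} {m k : ι} {c : F}
    (hc : ∀ i, h i k = if i = m then c else 0) : ∃ (r : ι → F) (h' : GL ι F),
    r m = 0 ∧ h = rowUnit m r * h' ∧ (∀ i, h' i k = if i = m then c else 0) ∧
      ∀ j, h' m j = if j = k then c else 0 := by
  set r : ι → F := Pi.single m 1 - c • (Pi.single k 1 ᵥ* ((h⁻¹ : GL ι F) : Matrix ι ι F)) with hr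
  have hrm : r m = 0 := by
    rw [hr, Pi.sub_apply, Pi.smul_apply, Matrix.single_one_vecMul, Matrix.row_apply,
      inv_apply_of_col hc]
    simp [col_ne_zero hc]
  have hval : ((rowUnit m (-r) * h : GL ι F) : Matrix ι ι F) =
      h - Matrix.vecMulVec (Pi.single m 1) (r ᵥ* (h : Matrix ι ι F)) := by
    rw [Units.val_mul, rowUnit_val, rowMat_of_eq_zero (by simp [hrm]), add_mul, one_mul,
      Matrix.vecMulVec_mul, Matrix.neg_vecMul, Matrix.vecMulVec_neg, sub_eq_add_neg]
  have hrh : r ᵥ* (h : Matrix ι ι F) = (h : Matrix ι ι F) m - c • Pi.single k 1 := by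
    rw [hr, Matrix.sub_vecMul, Matrix.smul_vecMul, Matrix.vecMul_vecMul, ← Units.val_mul,
      inv_mul_cancel, Units.val_one, Matrix.vecMul_one, Matrix.single_one_vecMul]
    rfl
  refine ⟨r, rowUnit m (-r) * h, hrm, ?_, fun i => ?_, fun j => ?_⟩
  · rw [← mul_assoc, rowUnit_mul, add_neg_cancel, rowUnit_zero, one_mul]
  · change ((rowUnit m (-r) * h : GL ι F) : Matrix ι ι F) i k = _
    rw [hval, hrh, Matrix.sub_apply, Matrix.vecMulVec_apply, hc, Pi.sub_apply, hc]
    simp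
  · change ((rowUnit m (-r) * h : GL ι F) : Matrix ι ι F) m j = _
    rw [hval, hrh, Matrix.sub_apply, Matrix.vecMulVec_apply]
    simp [Pi.single_apply]

end

namespace TorusSys

variable {F ι Γ : Type*} [Field F] [Fintype ι] [DecidableEq ι] [Group Γ] (A : TorusSys F ι Γ)

theorem ρ_scale (m : ι) (p : ℤ) {r : ι → F} (hr : r m = 0) :
    A.ρ m (fun i => C (r i) * T p) =
      A.τ (Pi.single m p) * A.α (rowUnit m r) * (A.τ (Pi.single m p))⁻¹ := by
  rw [← A.ρ_const, A.τ_mul_ρ]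
  congr 1
  ext1 i
  by_cases hi : i = m
  · subst hi; simp [hr]
  · rw [Pi.single_eq_same, Pi.single_eq_of_ne hi, sub_zero, mul_comm]

theorem conj_levi {h : GL ι F} {m k : ι} {c : F} (hc : ∀ i, h i k = if i = m then c else 0)
    (hrow : ∀ j, h m j = if j = k then c else 0) {f : ι → F[T;T⁻¹]} (hf : f k = 0) :
    A.α h * A.ρ k f =
      A.ρ m ((C c • f) ᵥ* ((h⁻¹ : GL ι F) : Matrix ι ι F).map C) * A.α h := by
  refine vec_induction (P := fun f => A.α h * A.ρ k f =
    A.ρ m ((C c • f) ᵥ* ((h⁻¹ : GL ι F) : Matrix ι ι F).map C) * A.α h) (fun j => j ≠ k)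
    ?_ ?_ ?_ f (by simp [hf])
  · rw [A.ρ_zero, smul_zero, Matrix.zero_vecMul, A.ρ_zero, mul_one, one_mul]
  · intro f g hf hg
    rw [smul_add, Matrix.add_vecMul, A.ρ_add, A.ρ_add, ← mul_assoc, hf, mul_assoc, hg, mul_assoc]
  · intro j hj p b
    set r : ι → F := Pi.single j b with hr
    have hrk : r k = 0 := by simp [hr, Ne.symm hj]
    set r' : ι → F := (c • r) ᵥ* ((h⁻¹ : GL ι F) : Matrix ι ι F) with hr'
    have hr'm : r' m = 0 := vecMul_inv_eq_zero hc (by simp [hrk])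
    have h1 : (Pi.single j (C b * T p) : ι → F[T;T⁻¹]) = fun i => C (r i) * T p := by
      ext1 i
      by_cases hi : i = j
      · subst hi; simp [hr]
      · simp [hr, hi]
    have h2 : (C c • (Pi.single j (C b * T p) : ι → F[T;T⁻¹])) ᵥ*
        ((h⁻¹ : GL ι F) : Matrix ι ι F).map C = fun i => C (r' i) * T p := by
      ext1 i
      rw [hr', hr, ← Pi.single_smul, ← Pi.single_smul, Matrix.single_vecMul,
        Matrix.single_vecMul]
      simp only [Pi.smul_apply, smul_eq_mul, Matrix.row_apply, Matrix.map_apply, map_mul]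
      ring
    have h3 : h * rowUnit k r = rowUnit m r' * h := by
      refine Units.ext (mul_rowMat hc hrk hr'm ?_)
      rw [hr', Matrix.vecMul_vecMul, ← Units.val_mul, inv_mul_cancel, Units.val_one,
        Matrix.vecMul_one]
    have h4 := A.mono_zpow hc hrow p
    rw [h2, h1, A.ρ_scale k p hrk, A.ρ_scale m p hr'm, ← mul_assoc, ← mul_assoc, h4,
      mul_assoc (A.τ _) (A.α h), ← map_mul, h3, map_mul, mul_inv_eq_iff_eq_mul, mul_assoc _ (A.α h),
      h4]
    group

theorem conj {h : GL ι F} {m k : ι} {c : F} (hc : ∀ i, h i k = if i = m then c else 0)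
    {f f' : ι → F[T;T⁻¹]} (hf : f k = 0) (hff : ∀ j, ∑ i, f' i * C (h i j) = C c * f j) :
    A.α h * A.ρ k f = A.ρ m f' * A.α h := by
  have hM : ∀ g : GL ι F, (g : Matrix ι ι F).map (C : F →+* F[T;T⁻¹]) *
      ((g⁻¹ : GL ι F) : Matrix ι ι F).map C = 1 := by
    intro g
    rw [← Matrix.map_mul, ← Units.val_mul, mul_inv_cancel]
    simp
  have h1 : f' ᵥ* (h : Matrix ι ι F).map C = C c • f := by
    ext1 j; exact hff j
  have hf'm : f' m = 0 := by
    have h2 := hff k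
    rw [hf, mul_zero, Finset.sum_eq_single m] at h2
    · rw [hc, if_pos rfl] at h2
      exact (mul_eq_zero.1 h2).resolve_right fun h0 => col_ne_zero hc ((map_eq_zero _).1 h0)
    · intro i _ hi
      rw [hc i, if_neg hi]; simp
    · simp
  obtain ⟨r, h', hrm, rfl, hc', hrow⟩ := exists_levi_factor hc
  have h3 : (C c • f) ᵥ* ((h'⁻¹ : GL ι F) : Matrix ι ι F).map C = f' := by
    rw [← h1, Units.val_mul, Matrix.map_mul, ← Matrix.vecMul_vecMul, Matrix.vecMul_vecMul, hM,
      Matrix.vecMul_one, rowUnit_val]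
    have : (rowMat m r).map (C : F →+* F[T;T⁻¹]) = rowMat m fun i => C (r i) := by
      ext1 i j
      rw [Matrix.map_apply, rowMat_apply, rowMat_apply]
      split_ifs <;> simp
    rw [this, rowMat_of_eq_zero (by simp [hrm]), Matrix.vecMul_add, Matrix.vecMul_vecMulVec]
    simp [hf'm]
  rw [map_mul, mul_assoc, A.conj_levi hc' hrow hf, h3, ← A.ρ_const, ← mul_assoc,
    (A.ρ_commute m _ _).eq, mul_assoc]

theorem π_y {m k : ι} (hmk : m ≠ k) (p : ℤ) (c : F) :
    A.π (A.roots.y m k p c) = rowMat m (Pi.single k (C c * T p)) := by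
  have h1 := A.roots.y_eq hmk (AddSubgroup.mem_top (Pi.single m p)) c
  rw [Pi.single_eq_same, Pi.single_eq_of_ne (Ne.symm hmk), sub_zero] at h1
  have hx : A.roots.x m k c = A.α (rowUnit m (Pi.single k c)) := rfl
  have hτ : A.roots.τ = A.τ := rfl
  have h2 : A.π (A.τ (Pi.single m p)) * A.π (A.α (rowUnit m (Pi.single k c))) =
      rowMat m (Pi.single k (C c * T p)) * A.π (A.τ (Pi.single m p)) := by
    have : (rowMat m (Pi.single k c)).map (C : F →+* F[T;T⁻¹]) = rowMat m (Pi.single k (C c)) := by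
      ext1 i j
      rw [Matrix.map_apply, rowMat_apply, rowMat_apply, Pi.single_apply, Pi.single_apply]
      split_ifs <;> first | exact map_one C | exact map_zero C | rfl
    rw [A.π_τ, A.π_α, rowUnit_val, this]
    refine diagonal_mul_rowMat fun j hj => ?_
    by_cases hjk : j = k
    · subst hjk
      rw [Pi.single_eq_same, Pi.single_eq_same, Pi.single_eq_same, Pi.single_eq_of_ne hj, T_zero,
        mul_one, mul_comm]
    · simp [hjk]
  rw [h1, map_mul, map_mul, hτ, hx, h2, mul_assoc, ← map_mul, mul_inv_cancel, map_one, mul_one]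

theorem π_ρ (m : ι) (f : ι → F[T;T⁻¹]) : A.π (A.ρ m f) = rowMat m f := by
  refine vec_induction (P := fun f => A.π (A.ρ m f) = rowMat m f) (fun _ => True) ?_ ?_ ?_ f
    (by simp)
  · rw [A.ρ_zero, map_one, rowMat_zero]
  · intro f g hf hg
    rw [A.ρ_add, map_mul, hf, hg, rowMat_mul]
  · intro k _ p c
    by_cases hk : m = k
    · subst hk; rw [A.ρ_self, map_one, rowMat_self]
    · rw [A.ρ_single hk, A.π_y hk]

open Polynomial (toLaurent toLaurent_injective toLaurent_C) in
/-- Restriction of the row subgroups to polynomials. -/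
noncomputable def poly : PolySys F ι Γ F[T;T⁻¹] where
  α := A.α
  ρ m f := A.ρ m fun i => toLaurent (f i)
  π := A.π
  φ := toLaurent
  φ_inj := toLaurent_injective
  π_α h := by
    rw [A.π_α]
    ext1 i j
    simp
  π_ρ m f _ := by
    rw [A.π_ρ]
    ext1 i j
    rw [Matrix.map_apply, rowMat_apply, rowMat_apply]
    split_ifs <;> simp
  ρ_add m f g _ _ := by
    rw [← A.ρ_add]
    congr 1
    ext1 i; simp
  ρ_const m r _ := by
    rw [← A.ρ_const]
    congr 1
    ext1 i; simp
  conj h m k c f f' hc hf hff := by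
    refine A.conj hc (by simp [hf]) fun j => ?_
    have := congrArg toLaurent (hff j)
    simpa using this
  comm m k f e hmk hf hek hem := by
    rw [A.ρ_comm hmk (by simp [hek]) (by simp [hem])]
    congr 2
    ext1 i; simp

end TorusSys
end

section
open LaurentPolynomial
open Polynomial (toLaurent)
open scoped Matrix MatrixGroups

section
variable {F ι : Type*} [Field F] [Fintype ι] [DecidableEq ι]

/-- The transpose of an invertible matrix. -/
def transposeGL (g : GL ι F) : GL ι F where
  val := (g : Matrix ι ι F)ᵀ
  inv := ((g⁻¹ : GL ι F) : Matrix ι ι F)ᵀ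
  val_inv := by
    rw [← Matrix.transpose_mul, ← Units.val_mul, inv_mul_cancel, Units.val_one,
      Matrix.transpose_one]
  inv_val := by
    rw [← Matrix.transpose_mul, ← Units.val_mul, mul_inv_cancel, Units.val_one,
      Matrix.transpose_one]

theorem transposeGL_apply (g : GL ι F) (i j : ι) : transposeGL g i j = g j i := rfl

theorem transposeGL_mul (g h : GL ι F) : transposeGL (g * h) = transposeGL h * transposeGL g :=
  Units.ext (Matrix.transpose_mul _ _)

theorem transposeGL_transposeGL (g : GL ι F) : transposeGL (transposeGL g) = g :=
  Units.ext (Matrix.transpose_transpose _)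

theorem transposeGL_one : transposeGL (1 : GL ι F) = 1 :=
  Units.ext Matrix.transpose_one

theorem transposeGL_rowUnit {m j : ι} (h : m ≠ j) (c : F) :
    transposeGL (rowUnit m (Pi.single j c)) = rowUnit j (Pi.single m c) := by
  refine Units.ext ?_
  change (rowMat m (Pi.single j c))ᵀ = rowMat j (Pi.single m c)
  rw [rowMat_single h, rowMat_single h.symm, Matrix.transvection, Matrix.transvection,
    Matrix.transpose_add, Matrix.transpose_one, Matrix.transpose_single]

end

namespace TorusSys

variable {F ι Γ : Type*} [Field F] [Fintype ι] [DecidableEq ι] [Group Γ] (A : TorusSys F ι Γ)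

theorem τ_zero : A.τ 0 = 1 := A.roots.τ_zero

theorem τ_neg (d : ι → ℤ) : A.τ (-d) = (A.τ d)⁻¹ := A.roots.τ_neg d

/-- The torus element with a single `T` at `i`. -/
def s (i : ι) : Γ := A.τ (Pi.single i 1)

/-- The subgroup generated by the constants and the polynomial row subgroups. -/
noncomputable def polyGroup : Subgroup Γ := A.poly.level Finset.univ

theorem α_mem (h : GL ι F) : A.α h ∈ A.polyGroup :=
  A.poly.α_mem_level fun i j hij => by simp at hij

theorem poly_ρ_mem {k : ι} {f : ι → Polynomial F} (hf : f k = 0) :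
    A.poly.ρ k f ∈ A.polyGroup :=
  A.poly.ρ_mem_level (Finset.mem_univ k) fun i hi => by
    have : i = k := by simpa using hi
    rw [this, hf]

/-- Elements of `polyGroup` whose conjugate by the inverse of `s m` remains in `polyGroup`. -/
noncomputable def conjGroup (m : ι) : Subgroup Γ :=
  A.polyGroup ⊓ A.polyGroup.comap (MulAut.conj (A.s m)⁻¹).toMonoidHom

variable {A}

theorem mem_conjGroup {m : ι} {b : Γ} :
    b ∈ A.conjGroup m ↔ b ∈ A.polyGroup ∧ (A.s m)⁻¹ * b * A.s m ∈ A.polyGroup := by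
  simp [conjGroup, Subgroup.mem_inf, Subgroup.mem_comap]

theorem poly_ρ_mem_conjGroup {m k : ι} (hk : k ≠ m) {f : ι → Polynomial F} (hf : f k = 0) :
    A.poly.ρ k f ∈ A.conjGroup m := by
  refine mem_conjGroup.2 ⟨A.poly_ρ_mem hf, ?_⟩
  have h1 := A.τ_mul_ρ (-Pi.single m 1) k (fun i => toLaurent (f i))
  rw [τ_neg, inv_inv] at h1
  have h2 : (A.s m)⁻¹ * A.poly.ρ k f * A.s m =
      A.poly.ρ k (fun i => if i = m then Polynomial.X * f i else f i) := by
    refine h1.trans ?_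
    change A.ρ k _ = A.ρ k _
    congr 1
    ext1 j
    by_cases hj : j = m
    · subst hj; simp [hk]
    · simp [hk, hj]
  rw [h2]
  refine A.poly_ρ_mem ?_
  simp [hf]

theorem poly_ρ_X_mem_conjGroup (m : ι) {f : ι → Polynomial F} (hf : f m = 0) :
    A.poly.ρ m ((Polynomial.X : Polynomial F) • f) ∈ A.conjGroup m := by
  refine mem_conjGroup.2 ⟨A.poly_ρ_mem (by simp [hf]), ?_⟩
  have h1 := A.τ_mul_ρ (-Pi.single m 1) m
    (fun i => toLaurent (((Polynomial.X : Polynomial F) • f) i))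
  rw [τ_neg, inv_inv] at h1
  have h2 : (A.s m)⁻¹ * A.poly.ρ m ((Polynomial.X : Polynomial F) • f) * A.s m =
      A.poly.ρ m f := by
    refine h1.trans ?_
    change A.ρ m _ = A.ρ m _
    congr 1
    ext1 j
    by_cases hj : j = m
    · subst hj; simp [hf]
    · simp only [Pi.neg_apply, Pi.single_eq_same, Pi.single_eq_of_ne hj, Pi.smul_apply,
        smul_eq_mul, map_mul, Polynomial.toLaurent_X]
      rw [← mul_assoc, ← T_add]
      simp
  rw [h2]
  exact A.poly_ρ_mem hf

theorem poly_ρ_single_mem (m : ι) {j : ι} (hj : j ≠ m) (c : F) :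
    A.α (rowUnit j (Pi.single m c)) ∈ A.conjGroup m := by
  have := A.poly.ρ_const j (Pi.single m c) (by simp [hj])
  change _ = A.α _ at this
  rw [← this]
  exact poly_ρ_mem_conjGroup hj (by simp [hj])

theorem transpose_rowUnit_mem (m : ι) {r : ι → F} (hr : r m = 0) :
    A.α (transposeGL (rowUnit m r)) ∈ A.conjGroup m := by
  have key : ∀ t : Finset ι, A.α (transposeGL (rowUnit m (∑ k ∈ t, Pi.single k (r k)))) ∈
      A.conjGroup m := by
    intro t
    induction t using Finset.induction_on with
    | empty => rw [Finset.sum_empty, rowUnit_zero, transposeGL_one, map_one]; exact one_mem _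
    | insert k t hk ih =>
      rw [Finset.sum_insert hk, ← rowUnit_mul, transposeGL_mul, map_mul]
      refine mul_mem ih ?_
      by_cases hkm : k = m
      · subst hkm; rw [rowUnit_self, transposeGL_one, map_one]; exact one_mem _
      · rw [transposeGL_rowUnit (Ne.symm hkm)]
        exact poly_ρ_single_mem m hkm _
  have := key Finset.univ
  rwa [Finset.univ_sum_single] at this

theorem α_mem_conjGroup {m : ι} {q : GL ι F} {c : F} (hq : ∀ j, q m j = if j = m then c else 0) :
    A.α q ∈ A.conjGroup m := by
  obtain ⟨r, h, hr, h1, h2, h3⟩ := exists_levi_factor (h := transposeGL q) (k := m) hq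
  have h4 : q = transposeGL h * transposeGL (rowUnit m r) := by
    rw [← transposeGL_mul, ← h1, transposeGL_transposeGL]
  rw [h4, map_mul]
  refine mul_mem (mem_conjGroup.2 ⟨A.α_mem _, ?_⟩) (transpose_rowUnit_mem m hr)
  have h5 := A.mono (transposeGL h) m m c h3 h2
  change _ = A.s m * _ at h5
  rw [mul_assoc]
  change (A.s m)⁻¹ * (_ * A.τ _) ∈ _
  rw [h5, inv_mul_cancel_left]
  exact A.α_mem _

theorem exists_conjGroup_col (m : ι) {u : ι → F} (hu : u ≠ 0) : ∃ (q : GL ι F) (i : ι),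
    A.α q ∈ A.conjGroup m ∧ (q : Matrix ι ι F) *ᵥ Pi.single i 1 = u := by
  by_cases hm : u m = 0
  · obtain ⟨l, hl⟩ := Function.ne_iff.1 hu
    have hlm : l ≠ m := by rintro rfl; exact hl hm
    refine ⟨colUnit l u hl, l, α_mem_conjGroup (c := 1) fun j => ?_, colUnit_mulVec l u hl⟩
    rw [colUnit_apply, Matrix.one_apply]
    by_cases hj : j = l
    · subst hj; simp [hm, hlm]
    · simp [hj, eq_comm]
  · refine ⟨colUnit m u hm, m, α_mem_conjGroup (c := u m) fun j => ?_, colUnit_mulVec m u hm⟩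
    rw [colUnit_apply, Matrix.one_apply]
    by_cases hj : j = m
    · subst hj; simp
    · simp [hj, Ne.symm hj]

theorem conj_ρ_X_mem (m : ι) (h : GL ι F) {k : ι} {f : ι → Polynomial F} (hf : f k = 0) :
    (A.α h)⁻¹ * A.poly.ρ k ((Polynomial.X : Polynomial F) • f) * A.α h ∈ A.conjGroup m := by
  have hu : ((h⁻¹ : GL ι F) : Matrix ι ι F) *ᵥ Pi.single k 1 ≠ 0 := by
    intro h0
    have h1 := congrArg (fun v => (h : Matrix ι ι F) *ᵥ v) h0
    rw [Matrix.mulVec_mulVec, ← Units.val_mul, mul_inv_cancel, Units.val_one, Matrix.one_mulVec,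
      Matrix.mulVec_zero] at h1
    have := congrFun h1 k
    simp at this
  obtain ⟨q, i, hq, hqi⟩ := exists_conjGroup_col (A := A) m hu
  have hcol : ∀ j, (q⁻¹ * h⁻¹ : GL ι F) j k = if j = i then 1 else 0 := by
    intro j
    have h1 : ((q⁻¹ * h⁻¹ : GL ι F) : Matrix ι ι F) *ᵥ Pi.single k 1 = Pi.single i 1 := by
      rw [Units.val_mul, ← Matrix.mulVec_mulVec, ← hqi, Matrix.mulVec_mulVec, ← Units.val_mul,
        inv_mul_cancel, Units.val_one, Matrix.one_mulVec]
    have h2 := congrFun h1 j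
    rwa [Matrix.mulVec_single_one, Matrix.col_apply, Pi.single_apply] at h2
  have h3 := A.poly.conj_transport hcol (f := (Polynomial.X : Polynomial F) • f) (by simp [hf])
  have h4 : PolySys.transport (q⁻¹ * h⁻¹) 1 ((Polynomial.X : Polynomial F) • f) =
      (Polynomial.X : Polynomial F) • PolySys.transport (q⁻¹ * h⁻¹) 1 f := by
    rw [PolySys.transport, PolySys.transport, smul_comm, Matrix.smul_vecMul]
  rw [h4] at h3
  change A.α _ * _ = _ * A.α _ at h3
  rw [← mul_inv_eq_iff_eq_mul] at h3
  have h5 : A.poly.ρ i ((Polynomial.X : Polynomial F) • PolySys.transport (q⁻¹ * h⁻¹) 1 f) ∈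
      A.conjGroup m := by
    have h6 : PolySys.transport (q⁻¹ * h⁻¹) 1 f i = 0 :=
      PolySys.transport_apply_eq_zero hcol hf
    by_cases him : i = m
    · subst him; exact poly_ρ_X_mem_conjGroup _ h6
    · exact poly_ρ_mem_conjGroup him (by simp [h6])
  rw [← h3] at h5
  have h7 := mul_mem (mul_mem hq h5) (inv_mem hq)
  convert h7 using 1
  rw [map_mul, map_inv, map_inv]
  group

/-- Elements all of whose conjugates by constants lie in `conjGroup`. -/
noncomputable def coreGroup (A : TorusSys F ι Γ) (m : ι) : Subgroup Γ where
  carrier := {γ | ∀ h, (A.α h)⁻¹ * γ * A.α h ∈ A.conjGroup m}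
  one_mem' := fun h => by simp
  mul_mem' := by
    intro a b ha hb h
    have := mul_mem (ha h) (hb h)
    convert this using 1
    group
  inv_mem' := by
    intro a ha h
    have := inv_mem (ha h)
    convert this using 1
    group

theorem exists_α_mul (m : ι) {b : Γ} (hb : b ∈ A.polyGroup) :
    ∃ h, ∃ κ ∈ A.conjGroup m, b = A.α h * κ := by
  have hconj : ∀ x ∈ A.α.range, ∀ y ∈ A.coreGroup m, x * y * x⁻¹ ∈ A.coreGroup m := by
    rintro _ ⟨g, rfl⟩ y hy h
    have := hy (g⁻¹ * h)
    convert this using 1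
    rw [map_mul, map_inv]
    group
  have h1 : A.polyGroup ≤ normProd (A.coreGroup m) A.α.range hconj := by
    refine (Subgroup.closure_le _).2 ?_
    rintro g (⟨h, hh, rfl⟩ | ⟨k, hk, f, hf, rfl⟩)
    · exact ⟨1, one_mem _, A.α h, ⟨h, rfl⟩, by rw [one_mul]; rfl⟩
    · have hfk : f k = 0 := hf k (by simp)
      refine ⟨A.poly.ρ k ((Polynomial.X : Polynomial F) • fun i => (f i).divX),
        fun h => conj_ρ_X_mem m h (by simp [hfk]), A.α (rowUnit k fun i => (f i).coeff 0),
        ⟨_, rfl⟩, ?_⟩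
      have h2 := A.poly.ρ_const k (fun i => (f i).coeff 0) (by simp [hfk])
      change _ = A.α _ at h2
      rw [← h2, ← A.poly.ρ_add k _ _ (by simp [hfk]) (by simp [hfk])]
      congr 1
      ext1 i
      exact (Polynomial.X_mul_divX_add (f i)).symm
  obtain ⟨n, hn, _, ⟨h, rfl⟩, rfl⟩ := h1 hb
  exact ⟨h, (A.α h)⁻¹ * n * A.α h, hn h, by group⟩

end TorusSys
end

section
open LaurentPolynomial
open Polynomial (toLaurent)
open scoped Matrix MatrixGroups

namespace TorusSys

variable {F ι Γ : Type*} [Field F] [Fintype ι] [DecidableEq ι] [Group Γ]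

/-- The products `b₀ * s m * b₁ * ⋯ * s m * bₖ` with all `bᵢ` in `polyGroup`. -/
def cell (A : TorusSys F ι Γ) (m : ι) : ℕ → Set Γ
  | 0 => A.polyGroup
  | k + 1 => {x | ∃ h, ∃ γ ∈ cell A m k, x = A.α h * A.s m * γ}

variable {A : TorusSys F ι Γ}

theorem mul_mem_cell {m : ι} {k : ℕ} {b γ : Γ} (hb : b ∈ A.polyGroup) (hγ : γ ∈ A.cell m k) :
    b * γ ∈ A.cell m k := by
  induction k generalizing b γ with
  | zero => exact mul_mem hb hγ
  | succ k ih =>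
    obtain ⟨h, δ, hδ, rfl⟩ := hγ
    obtain ⟨h', κ, hκ, h1⟩ := exists_α_mul m (mul_mem hb (A.α_mem h))
    refine ⟨h', _, ih (mem_conjGroup.1 hκ).2 hδ, ?_⟩
    calc b * (A.α h * A.s m * δ) = (b * A.α h) * A.s m * δ := by group
      _ = _ := by rw [h1]; group

theorem α_mul_mem_cell {m : ι} {k : ℕ} {h : GL ι F} {γ : Γ} (hγ : γ ∈ A.cell m k) :
    A.α h * γ ∈ A.cell m k :=
  mul_mem_cell (A.α_mem h) hγ

theorem conjGroup_mul_mem_cell {m : ι} {k : ℕ} {κ γ : Γ} (hκ : κ ∈ A.conjGroup m)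
    (hγ : γ ∈ A.cell m k) : (A.s m)⁻¹ * κ * A.s m * γ ∈ A.cell m k :=
  mul_mem_cell (mem_conjGroup.1 hκ).2 hγ

theorem s_eq (m l : ι) : A.s l = (A.α (swapGL F m l))⁻¹ * A.s m * A.α (swapGL F m l) := by
  have h1 := A.mono (swapGL F m l) m l 1 (fun i => ?_) fun j => ?_
  · rw [mul_assoc, eq_inv_mul_iff_mul_eq]
    exact h1
  · simp only [swapGL_apply, Equiv.swap_apply_eq_iff, Equiv.swap_apply_right]
  · rw [swapGL_apply, Equiv.swap_apply_left]
    simp [eq_comm]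

theorem s_mul_mem_cell {m : ι} (l : ι) {k : ℕ} {γ : Γ} (hγ : γ ∈ A.cell m k) :
    A.s l * γ ∈ A.cell m (k + 1) := by
  refine ⟨(swapGL F m l)⁻¹, _, α_mul_mem_cell (h := swapGL F m l) hγ, ?_⟩
  rw [s_eq m l, map_inv]
  group

theorem s_inv_mul_mem_cell {m l i : ι} {k : ℕ} {h : GL ι F} {c : F} {γ : Γ}
    (hr : ∀ j, h l j = if j = i then c else 0) (hγ : γ ∈ A.cell m k) :
    (A.s l)⁻¹ * A.α h * A.s i * γ ∈ A.cell m k := by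
  have h1 : A.α (swapGL F m l * h * swapGL F m i) ∈ A.conjGroup m := by
    refine α_mem_conjGroup (c := c) fun j => ?_
    have h2 : ∀ (p q : GL ι F) x y, (p * q) x y = ∑ z, p x z * q z y := fun p q x y =>
      Matrix.mul_apply
    have h3 : ∀ z, (swapGL F m l * h) m z = h l z := by
      intro z
      rw [h2]
      simp [swapGL_apply]
    rw [h2]
    simp only [h3, swapGL_apply, Equiv.swap_apply_eq_iff, mul_ite, mul_one, mul_zero,
      Finset.sum_ite_eq', Finset.mem_univ, if_true, hr, Equiv.swap_apply_right]
  have h2 := α_mul_mem_cell (h := swapGL F m l)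
    (conjGroup_mul_mem_cell h1 (α_mul_mem_cell (h := swapGL F m i) hγ))
  convert h2 using 1
  rw [s_eq m l, s_eq m i]
  have h3 := swapGL_inv (F := F) m l
  have h4 := swapGL_inv (F := F) m i
  rw [← map_inv, ← map_inv, h3, h4, map_mul, map_mul]
  have h5 : (A.α (swapGL F m l))⁻¹ = A.α (swapGL F m l) := by rw [← map_inv, h3]
  calc _ = (A.α (swapGL F m l))⁻¹ * (A.s m)⁻¹ * (A.α (swapGL F m l))⁻¹ * A.α h *
        (A.α (swapGL F m i) * A.s m * A.α (swapGL F m i)) * γ := by group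
    _ = _ := by rw [h5]; group

/-- The matrices with polynomial entries. -/
noncomputable def polyMatrices (F ι : Type*) [Field F] [Fintype ι] [DecidableEq ι] :
    Subring (Matrix ι ι F[T;T⁻¹]) :=
  ((toLaurent (R := F)).mapMatrix (m := ι)).range

theorem exists_toLaurent {M : Matrix ι ι F[T;T⁻¹]} (hM : M ∈ polyMatrices F ι) (i j : ι) :
    ∃ p, M i j = toLaurent p := by
  obtain ⟨N, rfl⟩ := hM
  exact ⟨N i j, rfl⟩

theorem π_mem_of_mem_polyGroup {γ : Γ} (hγ : γ ∈ A.polyGroup) : A.π γ ∈ polyMatrices F ι := by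
  have hg : ∀ g ∈ A.poly.gens Finset.univ, A.π g ∈ polyMatrices F ι := by
    rintro g (⟨h, -, rfl⟩ | ⟨k, hk, f, hf, rfl⟩)
    · exact ⟨_, (A.poly.π_α h).symm⟩
    · exact ⟨_, (A.poly.π_ρ k f (hf k (by simp))).symm⟩
  let H : Subgroup Γ :=
    { carrier := {γ | A.π γ ∈ polyMatrices F ι ∧ A.π γ⁻¹ ∈ polyMatrices F ι}
      one_mem' := by
        simp only [Set.mem_ofPred_eq, inv_one, map_one, and_self]
        exact one_mem _
      mul_mem' := by
        rintro a b ⟨h1, h2⟩ ⟨h3, h4⟩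
        simp only [Set.mem_ofPred_eq, mul_inv_rev, map_mul]
        exact ⟨mul_mem h1 h3, mul_mem h4 h2⟩
      inv_mem' := by
        rintro a ⟨h1, h2⟩
        exact ⟨h2, by rwa [inv_inv]⟩ }
  have : A.polyGroup ≤ H := (Subgroup.closure_le _).2 fun g h =>
    ⟨hg g h, hg _ (A.poly.inv_mem_gen h)⟩
  exact (this hγ).1

theorem π_s (m : ι) : A.π (A.s m) = Matrix.diagonal fun i => T ((Pi.single m 1 : ι → ℤ) i) :=
  A.π_τ _

theorem π_s_mem (m : ι) : A.π (A.s m) ∈ polyMatrices F ι := by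
  refine ⟨Matrix.diagonal fun i => if i = m then Polynomial.X else 1, ?_⟩
  rw [π_s, RingHom.mapMatrix_apply, Matrix.diagonal_map (map_zero _)]
  congr 1
  ext1 i
  by_cases hi : i = m
  · subst hi; simp
  · simp [hi]

theorem π_mem_of_mem_cell {m : ι} {k : ℕ} {γ : Γ} (hγ : γ ∈ A.cell m k) :
    A.π γ ∈ polyMatrices F ι := by
  induction k generalizing γ with
  | zero => exact π_mem_of_mem_polyGroup hγ
  | succ k ih =>
    obtain ⟨h, δ, hδ, rfl⟩ := hγ
    rw [map_mul, map_mul]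
    exact mul_mem (mul_mem (π_mem_of_mem_polyGroup (A.α_mem h)) (π_s_mem m)) (ih hδ)

/-- All entries of the row are divisible by the indeterminate in the polynomial ring. -/
def DvdRow (v : ι → F[T;T⁻¹]) : Prop := ∀ j, ∃ p : Polynomial F, v j = toLaurent (Polynomial.X * p)

theorem not_dvdRow_of_mem_polyGroup {γ : Γ} (hγ : γ ∈ A.polyGroup) (l : ι) :
    ¬ DvdRow (A.π γ l) := by
  intro h
  choose p hp using h
  choose q hq using fun j => exists_toLaurent (π_mem_of_mem_polyGroup (inv_mem hγ)) j l
  have h1 : (A.π γ * A.π γ⁻¹) l l = 1 := by rw [← map_mul, mul_inv_cancel, map_one]; simp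
  have h2 : toLaurent (Polynomial.X * ∑ j, p j * q j) = toLaurent (1 : Polynomial F) := by
    rw [map_one, ← h1, Matrix.mul_apply, Finset.mul_sum, map_sum]
    refine Finset.sum_congr rfl fun j _ => ?_
    rw [hp, hq, ← map_mul, mul_assoc]
  have h3 := congrArg (fun r => Polynomial.coeff r 0) (Polynomial.toLaurent_injective h2)
  simp at h3

theorem dvdRow_s_mul {m : ι} {γ : Γ} (hγ : A.π γ ∈ polyMatrices F ι) :
    DvdRow (A.π (A.s m * γ) m) := by
  intro j
  obtain ⟨p, hp⟩ := exists_toLaurent hγ m j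
  refine ⟨p, ?_⟩
  rw [map_mul, π_s, Matrix.diagonal_mul, hp, map_mul]
  simp

theorem DvdRow.add {v w : ι → F[T;T⁻¹]} (hv : DvdRow v) (hw : DvdRow w) : DvdRow (v + w) := by
  intro j
  obtain ⟨p, hp⟩ := hv j
  obtain ⟨q, hq⟩ := hw j
  exact ⟨p + q, by rw [Pi.add_apply, hp, hq, ← map_add, mul_add]⟩

theorem DvdRow.smul {v : ι → F[T;T⁻¹]} (hv : DvdRow v) (c : F) :
    DvdRow ((C c : F[T;T⁻¹]) • v) := by
  intro j
  obtain ⟨p, hp⟩ := hv j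
  refine ⟨Polynomial.C c * p, ?_⟩
  rw [Pi.smul_apply, hp, smul_eq_mul, ← Polynomial.toLaurent_C, ← map_mul]
  congr 1
  ring

theorem row_mul_inv {h p : GL ι F} {l i : ι} (hp : ∀ j, h l j = p i j) (j : ι) :
    (h * p⁻¹) l j = if j = i then 1 else 0 := by
  have h1 : ((h * p⁻¹ : GL ι F) : Matrix ι ι F) l = ((p * p⁻¹ : GL ι F) : Matrix ι ι F) i := by
    rw [Units.val_mul, Units.val_mul, Matrix.mul_apply_eq_vecMul, Matrix.mul_apply_eq_vecMul,
      show (h : Matrix ι ι F) l = (p : Matrix ι ι F) i from funext hp]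
  rw [congrFun h1 j, mul_inv_cancel, Units.val_one, Matrix.one_apply]
  simp [eq_comm]

theorem exists_s_inv_mul_mem {m : ι} {k : ℕ} {γ : Γ} (hγ : γ ∈ A.cell m k) {l : ι}
    (hd : DvdRow (A.π γ l)) : ∃ k', k = k' + 1 ∧ (A.s l)⁻¹ * γ ∈ A.cell m k' := by
  induction k generalizing γ l with
  | zero => exact (not_dvdRow_of_mem_polyGroup hγ l hd).elim
  | succ k ih =>
    obtain ⟨h, δ, hδ, rfl⟩ := hγ
    refine ⟨k, rfl, ?_⟩
    by_cases hcol : ∀ j, j ≠ m → h l j = 0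
    · have := s_inv_mul_mem_cell (c := h l m) (l := l) (i := m) (h := h) (fun j => ?_) hδ
      · simpa only [mul_assoc] using this
      · split_ifs with hj
        · rw [hj]
        · exact hcol j hj
    push Not at hcol
    obtain ⟨j₀, hj₀, hne⟩ := hcol
    set r : ι → F := Function.update (h l) m 0 with hr
    have hrj : r j₀ ≠ 0 := by rwa [hr, Function.update_of_ne hj₀]
    set g : GL ι F := transposeGL (colUnit j₀ r hrj) with hg
    have hg_apply : ∀ i j, g i j = if i = j₀ then r j else (1 : Matrix ι ι F) j i := by
      intro i j
      rw [hg, transposeGL_apply, colUnit_apply]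
    have hgm : ∀ j, g m j = if j = m then 1 else 0 := by
      intro j
      rw [hg_apply, if_neg hj₀.symm, Matrix.one_apply]
    have hgs : A.α g * A.s m = A.s m * A.α g := by
      refine A.mono g m m 1 (fun i => ?_) hgm
      rw [hg_apply]
      split_ifs with h1 h2 h2
      · exact absurd (h1.symm.trans h2) hj₀
      · simp [hr]
      · rw [h2]; simp
      · exact Matrix.one_apply_ne (Ne.symm h2)
    have hrow : DvdRow (A.π (A.α g * δ) j₀) := by
      have h1 : A.π (A.α g * δ) j₀ = A.π (A.α h * A.s m * δ) l +
          (C (-h l m) : F[T;T⁻¹]) • A.π (A.s m * δ) m := by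
        ext1 j
        rw [mul_assoc, map_mul, map_mul A.π (A.α h), A.π_α, A.π_α, Pi.add_apply, Pi.smul_apply,
          Matrix.mul_apply, Matrix.mul_apply,
          ← Finset.sum_erase_add _ _ (Finset.mem_univ m),
          ← Finset.sum_erase_add _ _ (Finset.mem_univ m)]
        simp only [Matrix.map_apply, hg_apply, if_true, smul_eq_mul, map_neg]
        rw [hr, Function.update_self, map_zero, zero_mul, add_zero, add_assoc, neg_mul,
          add_neg_cancel, add_zero]
        refine Finset.sum_congr rfl fun i hi => ?_
        have him : i ≠ m := Finset.ne_of_mem_erase hi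
        rw [Function.update_of_ne him, map_mul, π_s, Matrix.diagonal_mul,
          Pi.single_eq_of_ne him, T_zero, one_mul]
      rw [h1]
      exact hd.add ((dvdRow_s_mul (π_mem_of_mem_cell hδ)).smul _)
    obtain ⟨k', rfl, h1⟩ := ih (α_mul_mem_cell hδ) hrow
    set δ' := (A.s j₀)⁻¹ * (A.α g * δ) with hδ'
    set y : GL ι F := rowUnit j₀ (Pi.single m (h l m)) with hy
    have hq : ∀ j, (h * (y * g)⁻¹) l j = if j = j₀ then 1 else 0 := by
      refine row_mul_inv fun j => ?_
      change _ = (rowMat j₀ (Pi.single m (h l m)) * (g : Matrix ι ι F)) j₀ j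
      rw [rowMat_single hj₀, Matrix.transvection_mul_apply_same]
      change _ = g j₀ j + h l m * g m j
      rw [hg_apply, if_pos rfl, hgm, hr]
      by_cases hj : j = m
      · subst hj; simp
      · simp [hj]
    have hc : A.s m * A.s j₀ * A.α y = A.α y * (A.s m * A.s j₀) := by
      have := (A.pair j₀ m hj₀ (h l m)).eq
      rwa [add_comm, A.τ_add] at this
    have h2 := s_inv_mul_mem_cell (l := l) hq (s_mul_mem_cell m (α_mul_mem_cell (h := y) h1))
    convert h2 using 1
    have h3 : A.s j₀ * A.s m = A.s m * A.s j₀ := by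
      rw [s, s, ← A.τ_add, add_comm, A.τ_add]
    calc (A.s l)⁻¹ * (A.α h * A.s m * δ)
        = (A.s l)⁻¹ * A.α h * (A.s m * (A.α g)⁻¹) * (A.s j₀ * δ') := by rw [hδ']; group
      _ = (A.s l)⁻¹ * A.α h * ((A.α g)⁻¹ * A.s m) * (A.s j₀ * δ') := by
        congr 2
        rw [eq_inv_mul_iff_mul_eq, ← mul_assoc, hgs, mul_inv_cancel_right]
      _ = (A.s l)⁻¹ * A.α h * (A.α g)⁻¹ * ((A.α y)⁻¹ * (A.α y * (A.s m * A.s j₀))) * δ' := by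
        group
      _ = _ := by
        rw [← hc, ← h3, map_mul, map_inv, map_mul]
        group

theorem eq_of_mem_cell {m : ι} {k k' : ℕ} {γ γ' : Γ} (hγ : γ ∈ A.cell m k)
    (hγ' : γ' ∈ A.cell m k') (hπ : A.π γ = A.π γ') : γ = γ' := by
  induction k generalizing k' γ γ' with
  | zero =>
    cases k' with
    | zero =>
      have h1 : γ⁻¹ * γ' ∈ A.polyGroup := mul_mem (inv_mem hγ) hγ'
      have h2 : A.π (γ⁻¹ * γ') = 1 := by rw [map_mul, ← hπ, ← map_mul, inv_mul_cancel, map_one]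
      exact inv_mul_eq_one.1 (A.poly.eq_one_of_mem_level _ _ h1 h2)
    | succ k' =>
      obtain ⟨h, δ, hδ, rfl⟩ := hγ'
      have h1 : A.π (A.α h⁻¹ * γ) = A.π (A.s m * δ) := by
        rw [map_mul, hπ, ← map_mul, map_inv]
        congr 1; group
      have h2 := dvdRow_s_mul (m := m) (π_mem_of_mem_cell hδ)
      rw [← h1] at h2
      exact (not_dvdRow_of_mem_polyGroup (mul_mem (A.α_mem _) hγ) m h2).elim
  | succ k ih =>
    obtain ⟨h, δ, hδ, rfl⟩ := hγ
    have h1 : A.π (A.α h⁻¹ * γ') = A.π (A.s m * δ) := by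
      rw [map_mul, ← hπ, ← map_mul, map_inv]
      congr 1; group
    have h2 := dvdRow_s_mul (m := m) (π_mem_of_mem_cell hδ)
    rw [← h1] at h2
    obtain ⟨k'', rfl, h3⟩ := exists_s_inv_mul_mem (α_mul_mem_cell hγ') h2
    have h4 := ih hδ h3 (by rw [map_mul, h1, ← map_mul, inv_mul_cancel_left])
    rw [h4, map_inv]
    group

variable (A)

theorem τ_commute (d e : ι → ℤ) : Commute (A.τ d) (A.τ e) := by
  rw [commute_iff_eq, ← A.τ_add, add_comm, A.τ_add]

theorem commute_one_α (h : GL ι F) : Commute (A.τ 1) (A.α h) := by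
  induction h using GL_induction with
  | hmul g h hg hh => rw [map_mul]; exact hg.mul_right hh
  | hdiag d =>
    have h1 : ∀ m, (Pi.single m 1 : ι → ℤ) ∈ commDeg A.τ A.τ_add (A.α (diagUnit d)) := by
      intro m
      refine (A.mono (diagUnit d) m m (d m) (fun i => ?_) fun j => ?_).symm
      · change Matrix.diagonal _ _ _ = _
        rw [Matrix.diagonal_apply]
        split_ifs with h <;> simp [h]
      · change Matrix.diagonal _ _ _ = _
        rw [Matrix.diagonal_apply]
        simp [eq_comm]
    have h2 : (1 : ι → ℤ) ∈ commDeg A.τ A.τ_add (A.α (diagUnit d)) := by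
      rw [← Finset.univ_sum_single (1 : ι → ℤ)]
      exact sum_mem fun i _ => h1 i
    exact h2
  | helem i j hij c => exact A.commute_τ_rowUnit hij rfl c

variable {A}

theorem τ_sum_mul_mem_cell {m : ι} (t : Finset ι) {k : ℕ} {γ : Γ} (hγ : γ ∈ A.cell m k) :
    A.τ (∑ i ∈ t, Pi.single i 1) * γ ∈ A.cell m (k + t.card) := by
  induction t using Finset.induction_on with
  | empty => rw [Finset.sum_empty, τ_zero, one_mul]; exact hγ
  | insert i t hi ih =>
    rw [Finset.sum_insert hi, A.τ_add, mul_assoc, Finset.card_insert_of_notMem hi]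
    exact s_mul_mem_cell i ih

theorem one_eq_sum : (1 : ι → ℤ) = ∑ i, Pi.single i 1 :=
  (Finset.univ_sum_single (1 : ι → ℤ)).symm

theorem one_pow_mem_cell (m : ι) (N : ℕ) : ∃ k, A.τ 1 ^ N ∈ A.cell m k := by
  induction N with
  | zero => exact ⟨0, by rw [pow_zero]; exact one_mem _⟩
  | succ N ih =>
    obtain ⟨k, hk⟩ := ih
    refine ⟨k + (Finset.univ : Finset ι).card, ?_⟩
    have h1 := τ_sum_mul_mem_cell Finset.univ hk
    rwa [← one_eq_sum, ← pow_succ'] at h1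

/-- Elements which lie in some `cell` after multiplication by a power of `τ 1`. -/
def MemCells (A : TorusSys F ι Γ) (m : ι) (γ : Γ) : Prop := ∃ N k : ℕ, A.τ 1 ^ N * γ ∈ A.cell m k

/-- The elements whose multiplication preserves `MemCells`. -/
def cellStab (A : TorusSys F ι Γ) (m : ι) : Subgroup Γ where
  carrier := {x | ∀ γ, MemCells A m γ ↔ MemCells A m (x * γ)}
  one_mem' := by simp
  mul_mem' := by
    intro a b ha hb γ
    rw [hb, ha, mul_assoc]
  inv_mem' := by
    intro a ha γ
    rw [ha (a⁻¹ * γ), mul_inv_cancel_left]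

theorem α_mem_cellStab (m : ι) (h : GL ι F) : A.α h ∈ A.cellStab m := by
  have h1 : ∀ h γ, MemCells A m γ → MemCells A m (A.α h * γ) := by
    rintro h γ ⟨N, k, hk⟩
    refine ⟨N, k, ?_⟩
    rw [← mul_assoc, ((A.commute_one_α h).pow_left N).eq, mul_assoc]
    exact α_mul_mem_cell hk
  refine fun γ => ⟨h1 h γ, fun h2 => ?_⟩
  have h3 := h1 h⁻¹ _ h2
  rwa [map_inv, inv_mul_cancel_left] at h3

theorem s_mem_cellStab (m i : ι) : A.s i ∈ A.cellStab m := by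
  have h0 : ∀ N : ℕ, A.τ 1 ^ N * A.s i = A.s i * A.τ 1 ^ N := fun N =>
    ((A.τ_commute 1 (Pi.single i 1)).pow_left N).eq
  intro γ
  constructor
  · rintro ⟨N, k, hk⟩
    refine ⟨N, k + 1, ?_⟩
    rw [← mul_assoc, h0, mul_assoc]
    exact s_mul_mem_cell i hk
  · rintro ⟨N, k, hk⟩
    refine ⟨N + 1, k + (Finset.univ.erase i).card, ?_⟩
    have h1 := τ_sum_mul_mem_cell (Finset.univ.erase i) hk
    convert h1 using 1
    have h2 : A.τ 1 = A.τ (∑ i ∈ Finset.univ.erase i, Pi.single i 1) * A.s i := by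
      rw [s, ← A.τ_add, Finset.sum_erase_add _ _ (Finset.mem_univ i), ← one_eq_sum]
    rw [← mul_assoc (A.τ 1 ^ N), h0, pow_succ', ← mul_assoc, ← mul_assoc, ← h2]

theorem τ_mem_cellStab (m : ι) (d : ι → ℤ) : A.τ d ∈ A.cellStab m := by
  let H : AddSubgroup (ι → ℤ) :=
    { carrier := {d | A.τ d ∈ A.cellStab m}
      zero_mem' := by
        simp only [Set.mem_ofPred_eq, τ_zero]
        exact one_mem _
      add_mem' := by
        intro d e hd he
        simp only [Set.mem_ofPred_eq, A.τ_add]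
        exact mul_mem hd he
      neg_mem' := by
        intro d hd
        simp only [Set.mem_ofPred_eq, τ_neg]
        exact inv_mem hd }
  have h1 : d ∈ H := by
    rw [← Finset.univ_sum_single d]
    refine sum_mem fun i _ => ?_
    have h2 : (Pi.single i 1 : ι → ℤ) ∈ H := s_mem_cellStab m i
    have := zsmul_mem h2 (d i)
    rwa [← Pi.single_smul, smul_eq_mul, mul_one] at this
  exact h1

variable (A)

theorem eq_one_of_π_eq_one {γ : Γ}
    (hγ : γ ∈ Subgroup.closure (Set.range A.α ∪ Set.range A.τ)) (hπ : A.π γ = 1) (m : ι) :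
    γ = 1 := by
  have h1 : Subgroup.closure (Set.range A.α ∪ Set.range A.τ) ≤ A.cellStab m := by
    refine (Subgroup.closure_le _).2 ?_
    rintro _ (⟨h, rfl⟩ | ⟨d, rfl⟩)
    · exact α_mem_cellStab m h
    · exact τ_mem_cellStab m d
  have h2 : MemCells A m γ := by
    have := (h1 hγ 1).1 ⟨0, 0, by rw [pow_zero, one_mul]; exact one_mem _⟩
    rwa [mul_one] at this
  obtain ⟨N, k, hk⟩ := h2
  obtain ⟨k', hk'⟩ := one_pow_mem_cell (A := A) m N
  have := eq_of_mem_cell hk hk' (by rw [map_mul, hπ, mul_one])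
  exact mul_eq_left.1 this

end TorusSys
end

section
open LaurentPolynomial
open scoped Matrix MatrixGroups

/-- An additively indexed torus generated by commuting elements. -/
theorem exists_torus {Γ κ : Type*} [Group Γ] [Fintype κ] [DecidableEq κ] (s : κ → Γ)
    (hs : ∀ i j, s i * s j = s j * s i) : ∃ τ : (κ → ℤ) → Γ,
      (∀ d e, τ (d + e) = τ d * τ e) ∧ ∀ k, τ (Pi.single k 1) = s k := by
  have hc : ∀ x ∈ Set.range s, ∀ y ∈ Set.range s, x * y = y * x := by
    rintro _ ⟨i, rfl⟩ _ ⟨j, rfl⟩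
    exact hs i j
  have := Subgroup.isMulCommutative_closure hc
  let _ : CommGroup (Subgroup.closure (Set.range s)) :=
    { (inferInstance : Group (Subgroup.closure (Set.range s))) with mul_comm := this.is_comm.comm }
  let s' : κ → Subgroup.closure (Set.range s) := fun k => ⟨s k, Subgroup.subset_closure ⟨k, rfl⟩⟩
  refine ⟨fun d => ((∏ k, s' k ^ d k : Subgroup.closure (Set.range s)) : Γ), fun d e => ?_,
    fun k => ?_⟩
  · rw [← Subgroup.coe_mul, ← Finset.prod_mul_distrib]
    simp only [Pi.add_apply, zpow_add]
  · dsimp only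
    rw [Finset.prod_eq_single k (fun l _ hl => by rw [Pi.single_eq_of_ne hl, zpow_zero])
      (fun h => absurd (Finset.mem_univ k) h), Pi.single_eq_same, zpow_one]

theorem mem_of_single_mem {κ : Type*} [Fintype κ] [DecidableEq κ] {H : AddSubgroup (κ → ℤ)}
    (h : ∀ k, Pi.single k 1 ∈ H) (d : κ → ℤ) : d ∈ H := by
  rw [← Finset.univ_sum_single d]
  refine sum_mem fun k _ => ?_
  have := zsmul_mem (h k) (d k)
  rwa [← Pi.single_smul, smul_eq_mul, mul_one] at this

section
variable {Γ κ : Type*} [Group Γ] [Fintype κ] [DecidableEq κ] {τ : (κ → ℤ) → Γ}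

theorem torus_zero (hτ : ∀ d e, τ (d + e) = τ d * τ e) : τ 0 = 1 := by
  have := hτ 0 0
  rw [add_zero] at this
  exact left_eq_mul.1 this

theorem torus_neg (hτ : ∀ d e, τ (d + e) = τ d * τ e) (d : κ → ℤ) : τ (-d) = (τ d)⁻¹ := by
  rw [eq_inv_iff_mul_eq_one, ← hτ, neg_add_cancel, torus_zero hτ]

theorem torus_mem (hτ : ∀ d e, τ (d + e) = τ d * τ e) {H : Subgroup Γ}
    (h : ∀ k, τ (Pi.single k 1) ∈ H) (d : κ → ℤ) : τ d ∈ H := by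
  let K : AddSubgroup (κ → ℤ) :=
    { carrier := {d | τ d ∈ H}
      zero_mem' := by
        simp only [Set.mem_ofPred_eq, torus_zero hτ]
        exact one_mem _
      add_mem' := by
        intro d e hd he
        simp only [Set.mem_ofPred_eq, hτ]
        exact mul_mem hd he
      neg_mem' := by
        intro d hd
        simp only [Set.mem_ofPred_eq, torus_neg hτ]
        exact inv_mem hd }
  exact mem_of_single_mem (H := K) h d

theorem torus_map (hτ : ∀ d e, τ (d + e) = τ d * τ e) {M : Type*} [Monoid M]
    (π : Γ →* M) {σ : (κ → ℤ) → M} (hσ₀ : σ 0 = 1)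
    (hσ : ∀ d e, σ (d + e) = σ d * σ e) (h : ∀ k, π (τ (Pi.single k 1)) = σ (Pi.single k 1))
    (d : κ → ℤ) : π (τ d) = σ d := by
  let K : AddSubgroup (κ → ℤ) :=
    { carrier := {d | π (τ d) = σ d}
      zero_mem' := by simp only [Set.mem_ofPred_eq, torus_zero hτ, map_one, hσ₀]
      add_mem' := by
        intro d e hd he
        simp only [Set.mem_ofPred_eq] at hd he
        simp only [Set.mem_ofPred_eq, hτ, hσ, map_mul, hd, he]
      neg_mem' := by
        intro d hd
        simp only [Set.mem_ofPred_eq] at hd ⊢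
        rw [← mul_one (π (τ (-d))), ← hσ₀, ← add_neg_cancel d, hσ, ← hd, ← mul_assoc, ← map_mul,
          ← hτ, neg_add_cancel, torus_zero hτ, map_one, one_mul] }
  exact mem_of_single_mem (H := K) h d

end

section
variable {S : Type*} [CommRing S]

theorem diagonal_T_add {F ι : Type*} [Field F] [Fintype ι] [DecidableEq ι] (d e : ι → ℤ) :
    (Matrix.diagonal fun i => (T ((d + e) i) : F[T;T⁻¹])) =
      (Matrix.diagonal fun i => T (d i)) * Matrix.diagonal fun i => T (e i) := by
  rw [Matrix.diagonal_mul_diagonal]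
  simp only [Pi.add_apply, T_add]

theorem diagonal_T_zero {F ι : Type*} [Field F] [DecidableEq ι] :
    (Matrix.diagonal fun i => (T ((0 : ι → ℤ) i) : F[T;T⁻¹])) = 1 := by
  simp only [Pi.zero_apply, T_zero, Matrix.diagonal_one]

end

theorem TorusSys.exists_of_letters {F κ Γ : Type*} [Field F] [Fintype κ] [DecidableEq κ] [Group Γ]
    (α : GL κ F →* Γ) (s : κ → Γ) (π : Γ →* Matrix κ κ F[T;T⁻¹])
    (hs : ∀ i j, s i * s j = s j * s i) (hα : ∀ h : GL κ F, π (α h) = (h : Matrix κ κ F).map C)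
    (hπ : ∀ k, π (s k) = Matrix.diagonal fun i => T ((Pi.single k 1 : κ → ℤ) i))
    (mono : ∀ (h : GL κ F) m k c, (∀ i, h i k = if i = m then c else 0) →
      (∀ j, h m j = if j = k then c else 0) → α h * s k = s m * α h)
    (pair : ∀ i j, i ≠ j → ∀ c, Commute (s i * s j) (α (rowUnit i (Pi.single j c))))
    (mid : ∀ i j : κ, ∃ k, k ≠ i ∧ k ≠ j) :
    ∃ A : TorusSys F κ Γ, A.α = α ∧ A.π = π ∧ ∀ k, A.τ (Pi.single k 1) = s k := by
  obtain ⟨τ, h1, h2⟩ := exists_torus s hs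
  refine ⟨⟨α, τ, π, h1, hα, fun d => ?_, fun h m k c hc hr => ?_, fun i j hij c => ?_, mid⟩,
    rfl, rfl, h2⟩
  · exact torus_map h1 π (σ := fun d => Matrix.diagonal fun i => T (d i)) diagonal_T_zero
      diagonal_T_add (fun k => by rw [h2, hπ]) d
  · rw [h2, h2]; exact mono h m k c hc hr
  · rw [h1, h2, h2]; exact pair i j hij c

section
variable {F ι : Type*} [Field F] [Fintype ι] [DecidableEq ι]

theorem det_rowMat_single {S : Type*} [CommRing S] (i j : ι) (r : S) :
    (rowMat i (Pi.single j r)).det = 1 := by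
  by_cases h : i = j
  · subst h; rw [rowMat_self, Matrix.det_one]
  · rw [rowMat_single h, Matrix.det_transvection_of_ne i j h]

/-- Elementary matrices in the special linear group, with value `1` on the diagonal. -/
def elSL {S : Type*} [CommRing S] (i j : ι) (r : S) : Matrix.SpecialLinearGroup ι S :=
  ⟨rowMat i (Pi.single j r), det_rowMat_single i j r⟩

section
variable {S : Type*} [CommRing S]

theorem elSL_add (i j : ι) (r r' : S) : elSL i j (r + r') = elSL i j r * elSL i j r' := by
  apply Subtype.ext
  change rowMat _ _ = rowMat _ _ * rowMat _ _
  rw [rowMat_mul, Pi.single_add]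

theorem elSL_commute {i j k l : ι} (hij : i ≠ j) (hkl : k ≠ l) (hjk : j ≠ k)
    (hil : i ≠ l) (c c' : S) : elSL i j c * elSL k l c' = elSL k l c' * elSL i j c :=
  Subtype.ext (congrArg Units.val (rowUnit_single_commute hij hkl hjk hil c c').eq)

theorem elSL_mul {i j k : ι} (hij : i ≠ j) (hjk : j ≠ k) (hik : i ≠ k) (c c' : S) :
    elSL i j c * elSL j k c' = elSL j k c' * elSL i j c * elSL i k (c * c') :=
  Subtype.ext (congrArg Units.val (rowUnit_single_mul hij hjk hik c c'))

theorem elSL_conj_diagonal {g : Matrix.SpecialLinearGroup ι S} {a : ι → S}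
    (hg : (g : Matrix ι ι S) = Matrix.diagonal a) {i j : ι} {r r' : S} (h : a i * r = r' * a j) :
    g * elSL i j r = elSL i j r' * g := by
  apply Subtype.ext
  change (g : Matrix ι ι S) * rowMat _ _ = rowMat _ _ * (g : Matrix ι ι S)
  rw [hg]
  refine diagonal_mul_rowMat fun k _ => ?_
  by_cases hk : k = j
  · subst hk; simpa using h
  · simp [hk]

end

/-- The diagonal matrix with `T` at `i` and `T⁻¹` at `j`. -/
noncomputable def torSL (F : Type*) [Field F] (i j : ι) : Matrix.SpecialLinearGroup ι F[T;T⁻¹] :=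
  ⟨Matrix.diagonal fun k => T ((Pi.single i 1 - Pi.single j 1 : ι → ℤ) k), by
    have h : ∀ (t : Finset ι) (d : ι → ℤ), ∏ k ∈ t, (T (d k) : F[T;T⁻¹]) = T (∑ k ∈ t, d k) := by
      intro t d
      induction t using Finset.induction_on with
      | empty => simp
      | insert k t hk ih => rw [Finset.prod_insert hk, Finset.sum_insert hk, ih, T_add]
    rw [Matrix.det_diagonal, h]
    simp⟩

theorem torSL_val (i j : ι) : (torSL F i j : Matrix ι ι F[T;T⁻¹]) =
    Matrix.diagonal fun k => T ((Pi.single i 1 - Pi.single j 1 : ι → ℤ) k) := rfl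

theorem commute_of_diagonal {S : Type*} [CommRing S] {g h : Matrix.SpecialLinearGroup ι S}
    {a b : ι → S} (hg : (g : Matrix ι ι S) = Matrix.diagonal a)
    (hh : (h : Matrix ι ι S) = Matrix.diagonal b) : g * h = h * g := by
  apply Subtype.ext
  rw [Matrix.SpecialLinearGroup.coe_mul, Matrix.SpecialLinearGroup.coe_mul, hg, hh,
    Matrix.diagonal_mul_diagonal, Matrix.diagonal_mul_diagonal]
  simp only [mul_comm]

theorem torSL_mul (i j k : ι) : torSL F i j * torSL F j k = torSL F i k := by
  apply Subtype.ext
  rw [Matrix.SpecialLinearGroup.coe_mul, torSL_val, torSL_val, torSL_val, ← diagonal_T_add,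
    sub_add_sub_cancel]

theorem torSL_mul_elSL (i j k l : ι) (r : F[T;T⁻¹]) :
    torSL F k l * elSL i j r = elSL i j (T ((Pi.single k 1 - Pi.single l 1 : ι → ℤ) i -
      (Pi.single k 1 - Pi.single l 1 : ι → ℤ) j) * r) * torSL F k l := by
  refine elSL_conj_diagonal (torSL_val k l) ?_
  rw [mul_right_comm, ← T_add, sub_add_cancel]

end
end

section
open LaurentPolynomial
open scoped Matrix MatrixGroups

section
variable (F κ ν : Type*) [Field F] [Fintype κ] [DecidableEq κ] [Fintype ν] [DecidableEq ν]

/-- The product of the determinants of two blocks. -/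
def leviDet : GL κ F × GL ν F →* Fˣ :=
  Matrix.GeneralLinearGroup.det.comp (MonoidHom.fst _ _) *
    Matrix.GeneralLinearGroup.det.comp (MonoidHom.snd _ _)

/-- Pairs of invertible matrices whose determinants have product `1`. -/
abbrev LeviGroup := (leviDet F κ ν).ker

variable {F κ ν}

/-- The block diagonal matrix with constant blocks. -/
noncomputable def leviSL (p : LeviGroup F κ ν) : Matrix.SpecialLinearGroup (κ ⊕ ν) F[T;T⁻¹] :=
  ⟨Matrix.fromBlocks ((p.1.1 : Matrix κ κ F).map C) 0 0 ((p.1.2 : Matrix ν ν F).map C), by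
    have h1 : (p.1.1 : Matrix κ κ F).det * (p.1.2 : Matrix ν ν F).det = 1 :=
      congrArg Units.val (MonoidHom.mem_ker.1 p.2)
    rw [Matrix.det_fromBlocks_zero₂₁, ← RingHom.mapMatrix_apply, ← RingHom.mapMatrix_apply,
      ← RingHom.map_det, ← RingHom.map_det, ← map_mul, h1, map_one]⟩

theorem leviSL_val (p : LeviGroup F κ ν) : (leviSL p : Matrix (κ ⊕ ν) (κ ⊕ ν) F[T;T⁻¹]) =
    Matrix.fromBlocks ((p.1.1 : Matrix κ κ F).map C) 0 0 ((p.1.2 : Matrix ν ν F).map C) := rfl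

theorem leviSL_mul (p q : LeviGroup F κ ν) : leviSL (p * q) = leviSL p * leviSL q := by
  apply Subtype.ext
  rw [Matrix.SpecialLinearGroup.coe_mul, leviSL_val, leviSL_val, leviSL_val,
    Matrix.fromBlocks_multiply]
  simp [Matrix.map_mul]

/-- The diagonal matrix of determinant `(det g)⁻¹` supported at `o`. -/
def detInv (o : ν) : GL κ F →* GL ν F where
  toFun g := diagUnit (Pi.mulSingle o (Matrix.GeneralLinearGroup.det g)⁻¹)
  map_one' := by
    rw [map_one, inv_one, Pi.mulSingle_one]
    exact Units.ext (by simp [diagUnit])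
  map_mul' g h := by rw [diagUnit_mul, ← Pi.mulSingle_mul, map_mul, mul_inv]

theorem det_detInv (o : ν) (g : GL κ F) :
    Matrix.GeneralLinearGroup.det (detInv o g) = (Matrix.GeneralLinearGroup.det g)⁻¹ := by
  apply Units.ext
  change (Matrix.diagonal fun i => ((Pi.mulSingle o (Matrix.GeneralLinearGroup.det g)⁻¹ :
    ν → Fˣ) i : F)).det = _
  rw [Matrix.det_diagonal, Fintype.prod_eq_single o fun i hi => by
    rw [Pi.mulSingle_eq_of_ne hi, Units.val_one], Pi.mulSingle_eq_same]

/-- The embedding of the general linear group of the first block. -/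
def embA (o : ν) : GL κ F →* LeviGroup F κ ν :=
  ((MonoidHom.id _).prod (detInv o)).codRestrict _ fun g => by
    change Matrix.GeneralLinearGroup.det g * Matrix.GeneralLinearGroup.det (detInv o g) = 1
    rw [det_detInv, mul_inv_cancel]

/-- The embedding of the general linear group of the second block. -/
def embB (o : κ) : GL ν F →* LeviGroup F κ ν :=
  ((detInv o).prod (MonoidHom.id _)).codRestrict _ fun g => by
    change Matrix.GeneralLinearGroup.det (detInv o g) * Matrix.GeneralLinearGroup.det g = 1
    rw [det_detInv, inv_mul_cancel]

theorem embA_fst (o : ν) (g : GL κ F) : (embA o g).1.1 = g := rfl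
theorem embA_snd (o : ν) (g : GL κ F) : (embA o g).1.2 = detInv o g := rfl
theorem embB_fst (o : κ) (g : GL ν F) : (embB o g).1.1 = detInv o g := rfl
theorem embB_snd (o : κ) (g : GL ν F) : (embB o g).1.2 = g := rfl

theorem det_rowUnit {i j : κ} (c : F) :
    Matrix.GeneralLinearGroup.det (rowUnit i (Pi.single j c)) = 1 :=
  Units.ext (det_rowMat_single i j c)

theorem detInv_eq_one (o : ν) {g : GL κ F} (hg : Matrix.GeneralLinearGroup.det g = 1) :
    detInv o g = 1 := by
  change diagUnit (Pi.mulSingle o (Matrix.GeneralLinearGroup.det g)⁻¹) = 1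
  rw [hg, inv_one, Pi.mulSingle_one]
  exact Units.ext (by simp [diagUnit])

theorem leviSL_embA_rowUnit (o : ν) {i j : κ} (hij : i ≠ j) (c : F) :
    leviSL (embA o (rowUnit i (Pi.single j c))) = elSL (Sum.inl i) (Sum.inl j) (C c) := by
  apply Subtype.ext
  rw [leviSL_val, embA_fst, embA_snd, detInv_eq_one o (det_rowUnit c)]
  change Matrix.fromBlocks ((rowMat i _).map C) 0 0 ((1 : Matrix ν ν F).map C) = rowMat _ _
  rw [rowMat_single hij, rowMat_single (Sum.inl_injective.ne hij)]
  ext1 x y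
  rcases x with x | x <;> rcases y with y | y <;>
    simp only [Matrix.transvection, Matrix.one_apply, Matrix.single_apply, Matrix.add_apply,
      Matrix.map_apply, Matrix.fromBlocks_apply₁₁, Matrix.fromBlocks_apply₁₂,
      Matrix.fromBlocks_apply₂₁, Matrix.fromBlocks_apply₂₂, Matrix.zero_apply, Sum.inl.injEq,
      Sum.inr.injEq, reduceCtorEq, false_and, and_false, if_false, add_zero, map_add] <;>
    split_ifs <;> simp

theorem leviSL_embB_rowUnit (o : κ) {i j : ν} (hij : i ≠ j) (c : F) :
    leviSL (embB o (rowUnit i (Pi.single j c))) = elSL (Sum.inr i) (Sum.inr j) (C c) := by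
  apply Subtype.ext
  rw [leviSL_val, embB_fst, embB_snd, detInv_eq_one o (det_rowUnit c)]
  change Matrix.fromBlocks ((1 : Matrix κ κ F).map C) 0 0 ((rowMat i _).map C) = rowMat _ _
  rw [rowMat_single hij, rowMat_single (Sum.inr_injective.ne hij)]
  ext1 x y
  rcases x with x | x <;> rcases y with y | y <;>
    simp only [Matrix.transvection, Matrix.one_apply, Matrix.single_apply, Matrix.add_apply,
      Matrix.map_apply, Matrix.fromBlocks_apply₁₁, Matrix.fromBlocks_apply₁₂,
      Matrix.fromBlocks_apply₂₁, Matrix.fromBlocks_apply₂₂, Matrix.zero_apply, Sum.inl.injEq,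
      Sum.inr.injEq, reduceCtorEq, false_and, and_false, if_false, add_zero, map_add] <;>
    split_ifs <;> simp

theorem torSL_inl_inr (i : κ) (j : ν) :
    (torSL F (Sum.inl i) (Sum.inr j) : Matrix (κ ⊕ ν) (κ ⊕ ν) F[T;T⁻¹]) =
      Matrix.fromBlocks (Matrix.diagonal fun k => T ((Pi.single i 1 : κ → ℤ) k)) 0 0
        (Matrix.diagonal fun k => T ((-Pi.single j 1 : ν → ℤ) k)) := by
  rw [torSL_val, Matrix.fromBlocks_diagonal]
  congr 1
  ext1 x
  rcases x with x | x <;> simp [Pi.single_apply]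

theorem torSL_inr_inl (i : ν) (j : κ) :
    (torSL F (Sum.inr i) (Sum.inl j) : Matrix (κ ⊕ ν) (κ ⊕ ν) F[T;T⁻¹]) =
      Matrix.fromBlocks (Matrix.diagonal fun k => T ((-Pi.single j 1 : κ → ℤ) k)) 0 0
        (Matrix.diagonal fun k => T ((Pi.single i 1 : ν → ℤ) k)) := by
  rw [torSL_val, Matrix.fromBlocks_diagonal]
  congr 1
  ext1 x
  rcases x with x | x <;> simp [Pi.single_apply]

theorem map_mul_diagonal_T {h : Matrix κ κ F} {m k : κ} {c : F}
    (hc : ∀ i, h i k = if i = m then c else 0) (hr : ∀ j, h m j = if j = k then c else 0) :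
    h.map (C : F →+* F[T;T⁻¹]) * (Matrix.diagonal fun i => T ((Pi.single k 1 : κ → ℤ) i)) =
      (Matrix.diagonal fun i => T ((Pi.single m 1 : κ → ℤ) i)) * h.map C := by
  ext1 i j
  rw [Matrix.mul_diagonal, Matrix.diagonal_mul, Matrix.map_apply]
  by_cases hj : j = k
  · subst hj
    rw [hc]
    by_cases hi : i = m
    · subst hi
      rw [Pi.single_eq_same, Pi.single_eq_same, mul_comm]
    · rw [if_neg hi, map_zero, zero_mul, mul_zero]
  · rw [Pi.single_eq_of_ne hj, T_zero, mul_one]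
    by_cases hi : i = m
    · subst hi
      rw [hr, if_neg hj, map_zero, mul_zero]
    · rw [Pi.single_eq_of_ne hi, T_zero, one_mul]

theorem map_detInv_mul_diagonal (o : ν) (g : GL κ F) (a : ν → F[T;T⁻¹]) :
    (detInv o g : Matrix ν ν F).map (C : F →+* F[T;T⁻¹]) * Matrix.diagonal a =
      Matrix.diagonal a * (detInv o g : Matrix ν ν F).map C := by
  change (Matrix.diagonal _).map _ * _ = _ * (Matrix.diagonal _).map _
  rw [Matrix.diagonal_map (map_zero _), Matrix.diagonal_mul_diagonal,
    Matrix.diagonal_mul_diagonal]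
  congr 1
  ext1 i
  exact mul_comm _ _

theorem leviSL_embA_mul_torSL (o : ν) {h : GL κ F} {m k : κ} {c : F}
    (hc : ∀ i, h i k = if i = m then c else 0) (hr : ∀ j, h m j = if j = k then c else 0) :
    leviSL (embA o h) * torSL F (Sum.inl k) (Sum.inr o) =
      torSL F (Sum.inl m) (Sum.inr o) * leviSL (embA o h) := by
  apply Subtype.ext
  rw [Matrix.SpecialLinearGroup.coe_mul, Matrix.SpecialLinearGroup.coe_mul, leviSL_val,
    torSL_inl_inr, torSL_inl_inr, embA_fst, embA_snd, Matrix.fromBlocks_multiply,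
    Matrix.fromBlocks_multiply, map_mul_diagonal_T hc hr, map_detInv_mul_diagonal]
  simp

theorem leviSL_embB_mul_torSL (o : κ) {h : GL ν F} {m k : ν} {c : F}
    (hc : ∀ i, h i k = if i = m then c else 0) (hr : ∀ j, h m j = if j = k then c else 0) :
    leviSL (embB o h) * torSL F (Sum.inr k) (Sum.inl o) =
      torSL F (Sum.inr m) (Sum.inl o) * leviSL (embB o h) := by
  apply Subtype.ext
  rw [Matrix.SpecialLinearGroup.coe_mul, Matrix.SpecialLinearGroup.coe_mul, leviSL_val,
    torSL_inr_inl, torSL_inr_inl, embB_fst, embB_snd, Matrix.fromBlocks_multiply,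
    Matrix.fromBlocks_multiply, map_mul_diagonal_T hc hr, map_detInv_mul_diagonal]
  simp

theorem torSL_mul_torSL_mul_elSL {ι : Type*} [Fintype ι] [DecidableEq ι] {i j o : ι} (hij : i ≠ j)
    (hi : o ≠ i) (hj : o ≠ j) (r : F[T;T⁻¹]) :
    torSL F i o * torSL F j o * elSL i j r = elSL i j r * torSL F i o * torSL F j o := by
  rw [mul_assoc, torSL_mul_elSL, ← mul_assoc, torSL_mul_elSL, ← mul_assoc, ← T_add]
  simp [hij, hij.symm, hi.symm, hj.symm]

theorem torSL_mul_elSL_of_ne {ι : Type*} [Fintype ι] [DecidableEq ι] {i j k l : ι} (hki : k ≠ i)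
    (hkj : k ≠ j) (hli : l ≠ i) (hlj : l ≠ j) (r : F[T;T⁻¹]) :
    torSL F k l * elSL i j r = elSL i j r * torSL F k l := by
  rw [torSL_mul_elSL]
  simp [hki.symm, hkj.symm, hli.symm, hlj.symm]

variable (F κ ν) in
/-- The finite generating set of the parabolic subgroup. -/
def letters : Set (Matrix.SpecialLinearGroup (κ ⊕ ν) F[T;T⁻¹]) :=
  Set.range leviSL ∪ {g | ∃ i j c, g = elSL (Sum.inl i) (Sum.inr j) (C c)} ∪
    {g | ∃ i j, g = torSL F i j}

theorem letters_finite [Finite F] : (letters F κ ν).Finite := by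
  refine ((Set.finite_range _).union ?_).union ?_
  · refine (Set.finite_range fun x : κ × ν × F =>
      (elSL (Sum.inl x.1) (Sum.inr x.2.1) (C x.2.2) :
        Matrix.SpecialLinearGroup (κ ⊕ ν) F[T;T⁻¹])).subset ?_
    rintro _ ⟨i, j, c, rfl⟩
    exact ⟨(i, j, c), rfl⟩
  · refine (Set.finite_range fun x : (κ ⊕ ν) × (κ ⊕ ν) => torSL F x.1 x.2).subset ?_
    rintro _ ⟨i, j, rfl⟩
    exact ⟨(i, j), rfl⟩

/-- The roots of the parabolic subgroup. -/
def ParRoot : κ ⊕ ν → κ ⊕ ν → Prop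
  | Sum.inl i, Sum.inl j => i ≠ j
  | Sum.inr i, Sum.inr j => i ≠ j
  | Sum.inl _, Sum.inr _ => True
  | Sum.inr _, Sum.inl _ => False

theorem ParRoot.ne {i j : κ ⊕ ν} (h : ParRoot i j) : i ≠ j := by
  rintro rfl
  rcases i with i | i
  · exact h rfl
  · exact h rfl

theorem ParRoot.trans {i j k : κ ⊕ ν} (hij : ParRoot i j) (hjk : ParRoot j k) (hik : i ≠ k) :
    ParRoot i k := by
  rcases i with i | i <;> rcases j with j | j <;> rcases k with k | k <;>
    simp_all [ParRoot]

theorem leviSL_mem (p : LeviGroup F κ ν) : leviSL p ∈ letters F κ ν := Or.inl (Or.inl ⟨p, rfl⟩)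

theorem torSL_mem (i j : κ ⊕ ν) : torSL F i j ∈ letters F κ ν := Or.inr ⟨i, j, rfl⟩

theorem elSL_mem_letters (o : κ) (o' : ν) {i j : κ ⊕ ν} (h : ParRoot i j) (c : F) :
    elSL i j (C c) ∈ letters F κ ν := by
  rcases i with i | i <;> rcases j with j | j
  · rw [← leviSL_embA_rowUnit o' h]; exact leviSL_mem _
  · exact Or.inl (Or.inr ⟨i, j, c, rfl⟩)
  · exact h.elim
  · rw [← leviSL_embB_rowUnit o h]; exact leviSL_mem _

end

/-- A group generated by elements which satisfy the short relations between the generators of the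
parabolic subgroup. -/
structure ParSys (F κ ν Γ : Type*) [Field F] [Fintype κ] [DecidableEq κ] [Fintype ν]
    [DecidableEq ν] [Group Γ] where
  lam : Matrix.SpecialLinearGroup (κ ⊕ ν) F[T;T⁻¹] → Γ
  π : Γ →* Matrix.SpecialLinearGroup (κ ⊕ ν) F[T;T⁻¹]
  π_lam : ∀ x ∈ letters F κ ν, π (lam x) = x
  closure_eq : Subgroup.closure (lam '' letters F κ ν) = ⊤
  word : ∀ l l' : List (Matrix.SpecialLinearGroup (κ ⊕ ν) F[T;T⁻¹]),
    (∀ x ∈ l, x ∈ letters F κ ν) → (∀ x ∈ l', x ∈ letters F κ ν) → l.length ≤ 3 →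
    l'.length ≤ 3 → l.prod = l'.prod → (l.map lam).prod = (l'.map lam).prod
  a₀ : κ
  b₀ : ν
  mid : ∀ i j : κ, ∃ k, k ≠ i ∧ k ≠ j
  mid' : ∀ i j : ν, ∃ k, k ≠ i ∧ k ≠ j

namespace ParSys

variable {F κ ν Γ : Type*} [Field F] [Fintype κ] [DecidableEq κ] [Fintype ν]
    [DecidableEq ν] [Group Γ] (A : ParSys F κ ν Γ)

section
variable {x y z x' y' z' : Matrix.SpecialLinearGroup (κ ⊕ ν) F[T;T⁻¹]}

theorem lam_mul (hx : x ∈ letters F κ ν) (hy : y ∈ letters F κ ν) (hz : z ∈ letters F κ ν)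
    (h : x * y = z) : A.lam x * A.lam y = A.lam z := by
  simpa using A.word [x, y] [z] (by simp [hx, hy]) (by simp [hz]) (by simp) (by simp) (by simp [h])

theorem lam_mul_mul (hx : x ∈ letters F κ ν) (hy : y ∈ letters F κ ν)
    (hx' : x' ∈ letters F κ ν) (hy' : y' ∈ letters F κ ν) (h : x * y = x' * y') :
    A.lam x * A.lam y = A.lam x' * A.lam y' := by
  simpa using A.word [x, y] [x', y'] (by simp [hx, hy]) (by simp [hx', hy']) (by simp) (by simp)
    (by simp [h])

theorem lam_mul_mul_mul (hx : x ∈ letters F κ ν) (hy : y ∈ letters F κ ν)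
    (hx' : x' ∈ letters F κ ν) (hy' : y' ∈ letters F κ ν) (hz' : z' ∈ letters F κ ν)
    (h : x * y = x' * y' * z') :
    A.lam x * A.lam y = A.lam x' * A.lam y' * A.lam z' := by
  simpa [mul_assoc] using A.word [x, y] [x', y', z'] (by simp [hx, hy]) (by simp [hx', hy', hz'])
    (by simp) (by simp) (by simp [h, mul_assoc])

theorem lam_mul₃ (hx : x ∈ letters F κ ν) (hy : y ∈ letters F κ ν) (hz : z ∈ letters F κ ν)
    (hx' : x' ∈ letters F κ ν) (hy' : y' ∈ letters F κ ν) (hz' : z' ∈ letters F κ ν)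
    (h : x * y * z = x' * y' * z') :
    A.lam x * A.lam y * A.lam z = A.lam x' * A.lam y' * A.lam z' := by
  simpa [mul_assoc] using A.word [x, y, z] [x', y', z'] (by simp [hx, hy, hz])
    (by simp [hx', hy', hz']) (by simp) (by simp) (by simpa [mul_assoc] using h)

end

theorem elSL_mem (A : ParSys F κ ν Γ) {i j : κ ⊕ ν} (h : ParRoot i j) (c : F) :
    elSL i j (C c) ∈ letters F κ ν :=
  elSL_mem_letters A.a₀ A.b₀ h c

/-- The lift of the constant Levi subgroup. -/
noncomputable def β : LeviGroup F κ ν →* Γ :=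
  MonoidHom.mk' (fun p => A.lam (leviSL p)) fun p q =>
    (A.lam_mul (leviSL_mem p) (leviSL_mem q) (leviSL_mem _) (leviSL_mul p q).symm).symm

/-- The lift of an elementary matrix. -/
noncomputable def x (i j : κ ⊕ ν) (c : F) : Γ := A.lam (elSL i j (C c))

/-- The lift of a torus generator. -/
noncomputable def h (i j : κ ⊕ ν) : Γ := A.lam (torSL F i j)

theorem h_commute (i j k l : κ ⊕ ν) : A.h i j * A.h k l = A.h k l * A.h i j :=
  A.lam_mul_mul (torSL_mem _ _) (torSL_mem _ _) (torSL_mem _ _) (torSL_mem _ _)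
    (commute_of_diagonal (torSL_val _ _) (torSL_val _ _))

theorem h_mul (i j k : κ ⊕ ν) : A.h i j * A.h j k = A.h i k :=
  A.lam_mul (torSL_mem _ _) (torSL_mem _ _) (torSL_mem _ _) (torSL_mul i j k)

theorem h_self (i : κ ⊕ ν) : A.h i i = 1 := mul_eq_left.1 (A.h_mul i i i)

theorem h_inv (i j : κ ⊕ ν) : (A.h i j)⁻¹ = A.h j i := by
  rw [inv_eq_iff_mul_eq_one, h_mul, h_self]

theorem π_β (p : LeviGroup F κ ν) : A.π (A.β p) = leviSL p := A.π_lam _ (leviSL_mem p)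

theorem π_x {i j : κ ⊕ ν} (h : ParRoot i j) (c : F) : A.π (A.x i j c) = elSL i j (C c) :=
  A.π_lam _ (A.elSL_mem h c)

theorem π_h (i j : κ ⊕ ν) : A.π (A.h i j) = torSL F i j := A.π_lam _ (torSL_mem i j)

theorem β_embA_rowUnit {i j : κ} (hij : i ≠ j) (c : F) :
    A.β (embA A.b₀ (rowUnit i (Pi.single j c))) = A.x (Sum.inl i) (Sum.inl j) c :=
  congrArg A.lam (leviSL_embA_rowUnit _ hij c)

theorem β_embB_rowUnit {i j : ν} (hij : i ≠ j) (c : F) :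
    A.β (embB A.a₀ (rowUnit i (Pi.single j c))) = A.x (Sum.inr i) (Sum.inr j) c :=
  congrArg A.lam (leviSL_embB_rowUnit _ hij c)

theorem x_add {i j : κ ⊕ ν} (h : ParRoot i j) (c c' : F) :
    A.x i j (c + c') = A.x i j c * A.x i j c' :=
  (A.lam_mul (A.elSL_mem h c) (A.elSL_mem h c') (A.elSL_mem h _)
    (by rw [map_add, elSL_add])).symm

theorem commute_x {i j k l : κ ⊕ ν} (hij : ParRoot i j) (hkl : ParRoot k l) (hjk : j ≠ k)
    (hil : i ≠ l) (c c' : F) : Commute (A.x i j c) (A.x k l c') :=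
  A.lam_mul_mul (A.elSL_mem hij c) (A.elSL_mem hkl c') (A.elSL_mem hkl c') (A.elSL_mem hij c)
    (elSL_commute hij.ne hkl.ne hjk hil _ _)

theorem x_mul {i j k : κ ⊕ ν} (hij : ParRoot i j) (hjk : ParRoot j k) (hik : i ≠ k) (c c' : F) :
    A.x i j c * A.x j k c' = A.x j k c' * A.x i j c * A.x i k (c * c') :=
  A.lam_mul_mul_mul (A.elSL_mem hij c) (A.elSL_mem hjk c') (A.elSL_mem hjk c') (A.elSL_mem hij c)
    (A.elSL_mem (hij.trans hjk hik) _) (by rw [map_mul, elSL_mul hij.ne hjk.ne hik])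

theorem h_mul_x {i j k l : κ ⊕ ν} (hij : ParRoot i j) (hki : k ≠ i) (hkj : k ≠ j)
    (hli : l ≠ i) (hlj : l ≠ j) (c : F) : Commute (A.h k l) (A.x i j c) :=
  A.lam_mul_mul (torSL_mem _ _) (A.elSL_mem hij c) (A.elSL_mem hij c) (torSL_mem _ _)
    (torSL_mul_elSL_of_ne hki hkj hli hlj _)

theorem h_mul_h_mul_x {i j o : κ ⊕ ν} (hij : ParRoot i j) (hi : o ≠ i) (hj : o ≠ j) (c : F) :
    Commute (A.h i o * A.h j o) (A.x i j c) := by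
  rw [commute_iff_eq, ← mul_assoc]
  exact A.lam_mul₃ (torSL_mem _ _) (torSL_mem _ _) (A.elSL_mem hij c) (A.elSL_mem hij c)
    (torSL_mem _ _) (torSL_mem _ _) (torSL_mul_torSL_mul_elSL hij.ne hi hj _)

/-- Degrees with sum zero. -/
def degrees (ι : Type*) [Fintype ι] : AddSubgroup (ι → ℤ) where
  carrier := {d | ∑ i, d i = 0}
  zero_mem' := by simp
  add_mem' := by
    intro a b ha hb
    simp only [Set.mem_ofPred_eq] at ha hb
    simp only [Set.mem_ofPred_eq, Pi.add_apply, Finset.sum_add_distrib, ha, hb, add_zero]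
  neg_mem' := by
    intro a ha
    simp only [Set.mem_ofPred_eq] at ha
    simp only [Set.mem_ofPred_eq, Pi.neg_apply, Finset.sum_neg_distrib, ha, neg_zero]

/-- The torus with base point in the second block. -/
theorem exists_τ : ∃ τ : (κ ⊕ ν → ℤ) → Γ, (∀ d e, τ (d + e) = τ d * τ e) ∧
    ∀ k, τ (Pi.single k 1) = A.h k (Sum.inr A.b₀) :=
  exists_torus _ fun _ _ => A.h_commute _ _ _ _

theorem exists_outside (A : ParSys F κ ν Γ) (i j : κ ⊕ ν) : ∃ k, k ≠ i ∧ k ≠ j := by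
  rcases i with i | i
  · obtain ⟨k, hk, -⟩ := A.mid i i
    by_cases h : j = Sum.inl k
    · exact ⟨Sum.inr A.b₀, by simp, by simp [h]⟩
    · exact ⟨Sum.inl k, by simpa using hk, Ne.symm h⟩
  · obtain ⟨k, hk, -⟩ := A.mid' i i
    by_cases h : j = Sum.inr k
    · exact ⟨Sum.inl A.a₀, by simp, by simp [h]⟩
    · exact ⟨Sum.inr k, by simpa using hk, Ne.symm h⟩

theorem commute_τ_x {τ : (κ ⊕ ν → ℤ) → Γ} (hτ : ∀ d e, τ (d + e) = τ d * τ e)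
    (hs : ∀ k, τ (Pi.single k 1) = A.h k (Sum.inr A.b₀)) {i j : κ ⊕ ν} (hij : ParRoot i j)
    {d : κ ⊕ ν → ℤ} (hd : d ∈ degrees (κ ⊕ ν)) (hdij : d i = d j) (c : F) :
    Commute (τ d) (A.x i j c) := by
  obtain ⟨k, hki, hkj⟩ := A.exists_outside i j
  set H := commDeg τ hτ (A.x i j c)
  have hsub : ∀ k l, τ (Pi.single k 1 - Pi.single l 1) = A.h k l := by
    intro k l
    rw [sub_eq_add_neg, hτ, torus_neg hτ, hs, hs, h_inv, h_mul]
  have h1 : ∀ l, l ≠ i → l ≠ j → (Pi.single l 1 - Pi.single k 1 : κ ⊕ ν → ℤ) ∈ H := by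
    intro l hli hlj
    change Commute (τ _) _
    rw [hsub]
    exact A.h_mul_x hij hli hlj hki hkj c
  have h2 : ((Pi.single i 1 - Pi.single k 1) + (Pi.single j 1 - Pi.single k 1) :
      κ ⊕ ν → ℤ) ∈ H := by
    change Commute (τ _) _
    rw [hτ, hsub, hsub]
    exact A.h_mul_h_mul_x hij hki hkj c
  have h3 : ∀ e : κ ⊕ ν → ℤ, e i = 0 → e j = 0 →
      ∑ l, e l • (Pi.single l 1 - Pi.single k 1 : κ ⊕ ν → ℤ) ∈ H := by
    intro e hei hej
    refine sum_mem fun l _ => ?_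
    by_cases hli : l = i
    · rw [hli, hei, zero_smul]; exact zero_mem _
    by_cases hlj : l = j
    · rw [hlj, hej, zero_smul]; exact zero_mem _
    exact zsmul_mem (h1 l hli hlj) _
  have h4 : ∀ e ∈ degrees (κ ⊕ ν),
      ∑ l, e l • (Pi.single l 1 - Pi.single k 1 : κ ⊕ ν → ℤ) = e := by
    intro e he
    have he' : ∑ l, e l = 0 := he
    simp only [smul_sub, Finset.sum_sub_distrib, ← Finset.sum_smul, he', zero_smul, sub_zero]
    conv_rhs => rw [← Finset.univ_sum_single e]
    refine Finset.sum_congr rfl fun l _ => ?_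
    rw [← Pi.single_smul, smul_eq_mul, mul_one]
  set e₀ : κ ⊕ ν → ℤ := (Pi.single i 1 - Pi.single k 1) + (Pi.single j 1 - Pi.single k 1)
  have h5 : e₀ ∈ degrees (κ ⊕ ν) := by
    change ∑ l, e₀ l = 0
    simp [e₀, Finset.sum_add_distrib, Finset.sum_sub_distrib]
  have hei : e₀ i = 1 := by simp [e₀, hij.ne, hki.symm]
  have hej : e₀ j = 1 := by simp [e₀, hij.ne.symm, hkj.symm]
  have h6 := h3 (d - d i • e₀) (by simp [hei]) (by simp [hej, hdij])
  rw [h4 _ (sub_mem hd (zsmul_mem h5 _))] at h6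
  have h7 := add_mem h6 (zsmul_mem h2 (d i))
  rwa [sub_add_cancel] at h7

end ParSys
end

section
open LaurentPolynomial
open scoped Matrix MatrixGroups

namespace RootSys

variable {F ι Γ : Type*} [Ring F] [Group Γ] (A : RootSys F ι Γ)

theorem y_conj_y {i j k : ι} (hij : A.Φ i j) (hjk : A.Φ j k) (hik : i ≠ k) (p q : ℤ) (c c' : F) :
    A.y i j p c * A.y j k q c' * (A.y i j p c)⁻¹ =
      A.y j k q c' * A.y i k (p + q) (c * c') := by
  have h := (A.commute_y hij (A.trans i j k hij hjk hik) (A.ne hij).symm hik p (p + q) c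
    (c * c')).eq
  rw [A.y_mul hij hjk hik, mul_assoc (A.y j k q c'), h]
  group

theorem y_conj_y' {i j k : ι} (hij : A.Φ i j) (hjk : A.Φ j k) (hik : i ≠ k) (p q : ℤ) (c c' : F) :
    A.y j k q c' * A.y i j p c * (A.y j k q c')⁻¹ =
      A.y i j p c * (A.y i k (p + q) (c * c'))⁻¹ := by
  have h := (A.commute_y hjk (A.trans i j k hij hjk hik) hik.symm (A.ne hjk) q (p + q) c'
    (c * c')).inv_right.eq
  rw [mul_inv_eq_iff_eq_mul, mul_assoc, ← h, ← mul_assoc, A.y_mul hij hjk hik,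
    mul_inv_cancel_right]

end RootSys

namespace ParSys

variable {F κ ν Γ : Type*} [Field F] [Fintype κ] [DecidableEq κ] [Fintype ν]
    [DecidableEq ν] [Group Γ] (A : ParSys F κ ν Γ)

/-- The torus with base point in the second block. -/
noncomputable def τ : (κ ⊕ ν → ℤ) → Γ := A.exists_τ.choose

theorem τ_add (d e) : A.τ (d + e) = A.τ d * A.τ e := A.exists_τ.choose_spec.1 d e

theorem τ_single (k) : A.τ (Pi.single k 1) = A.h k (Sum.inr A.b₀) := A.exists_τ.choose_spec.2 k

theorem τ_sub (k l) : A.τ (Pi.single k 1 - Pi.single l 1) = A.h k l := by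
  rw [sub_eq_add_neg, A.τ_add, torus_neg A.τ_add, A.τ_single, A.τ_single, h_inv, h_mul]

theorem single_sub_mem (k l : κ ⊕ ν) :
    (Pi.single k 1 - Pi.single l 1 : κ ⊕ ν → ℤ) ∈ degrees (κ ⊕ ν) := by
  change ∑ i, (Pi.single k 1 - Pi.single l 1 : κ ⊕ ν → ℤ) i = 0
  simp [Finset.sum_sub_distrib]

theorem _root_.three_le_card {α : Type*} [Fintype α] [DecidableEq α] (o : α)
    (h : ∀ i j : α, ∃ k, k ≠ i ∧ k ≠ j) : 3 ≤ Fintype.card α := by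
  obtain ⟨k, hk, -⟩ := h o o
  obtain ⟨l, hl, hl'⟩ := h o k
  exact (Fintype.two_lt_card_iff).2 ⟨o, k, l, hk.symm, hl.symm, hl'.symm⟩

theorem exists_degrees (A : ParSys F κ ν Γ) {i j k l : κ ⊕ ν} (hij : i ≠ j) (hkl : k ≠ l)
    (h1 : i = k → j ≠ l) (h2 : i = l → j ≠ k) (p q : ℤ) :
    ∃ d ∈ degrees (κ ⊕ ν), d i - d j = p ∧ d k - d l = q := by
  obtain ⟨d, h3, h4⟩ := _root_.exists_degrees hij hkl h1 h2 p q
  obtain ⟨o, ho⟩ : ∃ o, o ∉ ({i, j, k, l} : Finset (κ ⊕ ν)) := by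
    by_contra! h
    have h5 := Finset.card_le_card (fun x _ => h x : Finset.univ ⊆ {i, j, k, l})
    rw [Finset.card_univ] at h5
    have h6 := three_le_card A.a₀ A.mid
    have h7 := three_le_card A.b₀ A.mid'
    rw [Fintype.card_sum] at h5
    have := Finset.card_le_four (a := i) (b := j) (c := k) (d := l)
    lia
  simp only [Finset.mem_insert, Finset.mem_singleton, not_or] at ho
  obtain ⟨ho1, ho2, ho3, ho4⟩ := ho
  refine ⟨d - Pi.single o (∑ i, d i), ?_, ?_, ?_⟩
  · change ∑ x, (d - Pi.single o (∑ i, d i) : κ ⊕ ν → ℤ) x = 0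
    simp [Finset.sum_sub_distrib]
  · simp [Ne.symm ho1, Ne.symm ho2, h3]
  · simp [Ne.symm ho3, Ne.symm ho4, h4]

/-- The root system of a parabolic system. -/
noncomputable def roots : RootSys F (κ ⊕ ν) Γ where
  Φ := ParRoot
  x := A.x
  τ := A.τ
  D := degrees _
  irrefl i h := h.ne rfl
  trans i j k := ParRoot.trans
  τ_add := A.τ_add
  commute_τ i j hij d hd hdij c := A.commute_τ_x A.τ_add A.τ_single hij hd hdij c
  x_add i j := A.x_add
  commute_x i j k l := A.commute_x
  x_mul i j k := A.x_mul
  rich i j k l hij hkl := A.exists_degrees hij.ne hkl.ne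
  exists_mid i j hij := by
    rcases i with i | i <;> rcases j with j | j
    · obtain ⟨k, h1, h2⟩ := A.mid i j
      exact ⟨Sum.inl k, h1.symm, h2⟩
    · obtain ⟨k, h1, -⟩ := A.mid i i
      exact ⟨Sum.inl k, h1.symm, trivial⟩
    · exact hij.elim
    · obtain ⟨k, h1, h2⟩ := A.mid' i j
      exact ⟨Sum.inr k, h1.symm, h2⟩

theorem inl_root {i j : κ} (hij : i ≠ j) : ParRoot (Sum.inl i : κ ⊕ ν) (Sum.inl j) := hij

theorem inr_root {i j : ν} (hij : i ≠ j) : ParRoot (Sum.inr i : κ ⊕ ν) (Sum.inr j) := hij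

theorem y_zero {i j : κ ⊕ ν} (hij : ParRoot i j) (c : F) : A.roots.y i j 0 c = A.x i j c :=
  A.roots.y_zero hij c

theorem h_conj_y {i j : κ ⊕ ν} (hij : ParRoot i j) (k l : κ ⊕ ν) (p : ℤ) (c : F) :
    ∃ q, A.h k l * A.roots.y i j p c * (A.h k l)⁻¹ = A.roots.y i j q c := by
  rw [← A.τ_sub]
  exact ⟨_, A.roots.τ_mul_y hij (single_sub_mem k l) p c⟩

/-- Diagonal constant matrices. -/
def IsDiagLevi (p : LeviGroup F κ ν) : Prop := ∃ d d', p.1 = (diagUnit d, diagUnit d')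

theorem leviSL_diag {p : LeviGroup F κ ν} {d d'} (h : p.1 = (diagUnit d, diagUnit d')) :
    (leviSL p : Matrix (κ ⊕ ν) (κ ⊕ ν) F[T;T⁻¹]) =
      Matrix.diagonal fun i => C ((Sum.elim d d' i : Fˣ) : F) := by
  rw [leviSL_val, h]
  change Matrix.fromBlocks ((Matrix.diagonal _).map _) 0 0 ((Matrix.diagonal _).map _) = _
  rw [Matrix.diagonal_map (map_zero _), Matrix.diagonal_map (map_zero _),
    Matrix.fromBlocks_diagonal]
  congr 1
  ext1 i
  rcases i with i | i <;> rfl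

theorem β_diag_commute_h {p : LeviGroup F κ ν} (hp : IsDiagLevi p) (i j : κ ⊕ ν) :
    Commute (A.β p) (A.h i j) := by
  obtain ⟨d, d', hp⟩ := hp
  exact A.lam_mul_mul (leviSL_mem p) (torSL_mem _ _) (torSL_mem _ _) (leviSL_mem p)
    (commute_of_diagonal (leviSL_diag hp) (torSL_val _ _))

theorem β_diag_mul_x {p : LeviGroup F κ ν} {d d'} (hp : p.1 = (diagUnit d, diagUnit d'))
    {i j : κ ⊕ ν} (hij : ParRoot i j) {c c' : F}
    (hc : (Sum.elim d d' i : Fˣ) * c = c' * (Sum.elim d d' j : Fˣ)) :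
    A.β p * A.x i j c = A.x i j c' * A.β p :=
  A.lam_mul_mul (leviSL_mem p) (A.elSL_mem hij c) (A.elSL_mem hij c') (leviSL_mem p)
    (elSL_conj_diagonal (leviSL_diag hp) (by rw [← map_mul, ← map_mul, hc]))

theorem β_diag_conj_x {p : LeviGroup F κ ν} (hp : IsDiagLevi p) {i j : κ ⊕ ν}
    (hij : ParRoot i j) (c : F) : ∃ c', A.β p * A.x i j c * (A.β p)⁻¹ = A.x i j c' := by
  obtain ⟨d, d', hp⟩ := hp
  refine ⟨(Sum.elim d d' i : Fˣ) * c * ((Sum.elim d d' j)⁻¹ : Fˣ), ?_⟩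
  rw [mul_inv_eq_iff_eq_mul]
  exact A.β_diag_mul_x hp hij (by rw [mul_assoc _ _ ((Sum.elim d d' j : Fˣ) : F)]; simp)

theorem β_diag_conj_y {p : LeviGroup F κ ν} (hp : IsDiagLevi p) {i j : κ ⊕ ν}
    (hij : ParRoot i j) (q : ℤ) (c : F) :
    ∃ c', A.β p * A.roots.y i j q c * (A.β p)⁻¹ = A.roots.y i j q c' := by
  obtain ⟨c', hc'⟩ := A.β_diag_conj_x hp hij c
  obtain ⟨e, he, rfl⟩ := A.roots.exists_degree hij q
  refine ⟨c', ?_⟩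
  rw [A.roots.y_eq hij he, A.roots.y_eq hij he]
  change A.β p * (A.τ e * A.x i j c * (A.τ e)⁻¹) * (A.β p)⁻¹ = A.τ e * A.x i j c' * (A.τ e)⁻¹
  have h1 : A.τ e ∈ Subgroup.centralizer {A.β p} := torus_mem A.τ_add (fun k => by
    rw [Subgroup.mem_centralizer_singleton_iff, A.τ_single]
    exact (A.β_diag_commute_h hp _ _).eq.symm) e
  rw [Subgroup.mem_centralizer_singleton_iff] at h1
  rw [← hc']
  have h2 : (A.τ e)⁻¹ * (A.β p)⁻¹ = (A.β p)⁻¹ * (A.τ e)⁻¹ := by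
    rw [← mul_inv_rev, ← mul_inv_rev, h1]
  calc _ = (A.β p * A.τ e) * A.x i j c * ((A.τ e)⁻¹ * (A.β p)⁻¹) := by group
    _ = _ := by rw [h2, ← h1]; group

/-- The generators of the unipotent radical. -/
def unipSet : Set Γ :=
  {g | ∃ (k : κ × ν) (p : ℤ) (c : F), g = A.roots.y (Sum.inl k.1) (Sum.inr k.2) p c}

/-- Letters acting on the unipotent radical. -/
def actSet : Set Γ :=
  {g | ∃ (i j : κ ⊕ ν) (c : F), i.isLeft = j.isLeft ∧ ParRoot i j ∧ g = A.x i j c} ∪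
    {g | ∃ i j, g = A.h i j} ∪ {g | ∃ p, IsDiagLevi p ∧ g = A.β p}

theorem x_inv {i j : κ ⊕ ν} (hij : ParRoot i j) (c : F) : (A.x i j c)⁻¹ = A.x i j (-c) := by
  have h0 : A.x i j 0 = 1 := by
    have := A.x_add hij 0 0
    rw [add_zero] at this
    exact left_eq_mul.1 this
  rw [inv_eq_iff_mul_eq_one, ← A.x_add hij, add_neg_cancel, h0]

theorem diagUnit_inv {ι S : Type*} [CommRing S] [Fintype ι] [DecidableEq ι] (d : ι → Sˣ) :
    (diagUnit d)⁻¹ = diagUnit d⁻¹ := by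
  rw [inv_eq_iff_mul_eq_one, diagUnit_mul, mul_inv_cancel]
  exact Units.ext (by simp [diagUnit])

theorem IsDiagLevi.inv {p : LeviGroup F κ ν} (hp : IsDiagLevi p) : IsDiagLevi p⁻¹ := by
  obtain ⟨d, d', hp⟩ := hp
  refine ⟨d⁻¹, d'⁻¹, ?_⟩
  rw [Subgroup.coe_inv, hp, Prod.inv_mk, diagUnit_inv, diagUnit_inv]

theorem actSet_inv : ∀ s ∈ A.actSet, s⁻¹ ∈ A.actSet := by
  rintro _ ((⟨i, j, c, h, hij, rfl⟩ | ⟨i, j, rfl⟩) | ⟨p, hp, rfl⟩)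
  · exact Or.inl (Or.inl ⟨i, j, -c, h, hij, A.x_inv hij c⟩)
  · exact Or.inl (Or.inr ⟨j, i, A.h_inv i j⟩)
  · exact Or.inr ⟨p⁻¹, hp.inv, (map_inv A.β p).symm⟩

theorem actSet_conj_unipSet : ∀ s ∈ A.actSet, ∀ y ∈ A.unipSet,
    s * y * s⁻¹ ∈ Subgroup.closure A.unipSet := by
  have hy : ∀ i j p c, A.roots.y (Sum.inl i) (Sum.inr j) p c ∈ Subgroup.closure A.unipSet :=
    fun i j p c => Subgroup.subset_closure ⟨(i, j), p, c, rfl⟩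
  have hR : ∀ i j, A.roots.Φ (Sum.inl i) (Sum.inr j) := fun _ _ => trivial
  have hR' : ∀ i j, ParRoot (Sum.inl i : κ ⊕ ν) (Sum.inr j) := fun _ _ => trivial
  rintro _ ((⟨i, j, c, h, hij, rfl⟩ | ⟨i, j, rfl⟩) | ⟨p, hp, rfl⟩) _ ⟨⟨k, l⟩, q, c', rfl⟩
  · rw [← A.y_zero hij]
    have hij' : A.roots.Φ i j := hij
    rcases i with i | i <;> rcases j with j | j
    · by_cases hjk : j = k
      · subst hjk
        rw [A.roots.y_conj_y hij' (hR _ _) (by simp)]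
        exact mul_mem (hy _ _ _ _) (hy _ _ _ _)
      · rw [(A.roots.commute_y hij' (hR k l) (Sum.inl_injective.ne hjk) (by simp) _ _ _ _).eq,
          mul_inv_cancel_right]
        exact hy _ _ _ _
    · simp at h
    · exact hij.elim
    · by_cases hil : i = l
      · subst hil
        rw [A.roots.y_conj_y' (hR k i) hij' (by simp)]
        exact mul_mem (hy _ _ _ _) (inv_mem (hy _ _ _ _))
      · rw [(A.roots.commute_y hij' (hR k l) (by simp) (Sum.inr_injective.ne hil) _ _ _ _).eq,
          mul_inv_cancel_right]
        exact hy _ _ _ _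
  · obtain ⟨q', hq'⟩ := A.h_conj_y (hR' k l) i j q c'
    rw [hq']
    exact hy _ _ _ _
  · obtain ⟨c'', hc''⟩ := A.β_diag_conj_y hp (hR' k l) q c'
    rw [hc'']
    exact hy _ _ _ _

/-- The generators of the constant group of the second block and its torus. -/
def rightSet : Set Γ :=
  {g | ∃ (i j : ν) (c : F), i ≠ j ∧ g = A.x (Sum.inr i) (Sum.inr j) c} ∪
    {g | ∃ i j, g = A.h (Sum.inr i) (Sum.inr j)} ∪
      {g | ∃ p : LeviGroup F κ ν, p.1.1 = 1 ∧ (∃ d, p.1.2 = diagUnit d) ∧ g = A.β p}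

/-- The generators of the constant group of the first block and the torus. -/
def leftSet : Set Γ :=
  {g | ∃ (i j : κ) (c : F), i ≠ j ∧ g = A.x (Sum.inl i) (Sum.inl j) c} ∪
    {g | ∃ i j, g = A.h i j} ∪ {g | ∃ p, IsDiagLevi p ∧ g = A.β p}

theorem diagUnit_one {ι S : Type*} [CommRing S] [Fintype ι] [DecidableEq ι] :
    diagUnit (1 : ι → Sˣ) = 1 := Units.ext (by simp [diagUnit])

theorem rightSet_subset : A.rightSet ⊆ A.actSet := by
  rintro _ ((⟨i, j, c, hij, rfl⟩ | ⟨i, j, rfl⟩) | ⟨p, hp, ⟨d, hd⟩, rfl⟩)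
  · refine Or.inl (Or.inl ⟨Sum.inr i, Sum.inr j, c, rfl, ?_, rfl⟩)
    exact hij
  · exact Or.inl (Or.inr ⟨Sum.inr i, Sum.inr j, rfl⟩)
  · exact Or.inr ⟨p, ⟨1, d, Prod.ext (hp.trans diagUnit_one.symm) hd⟩, rfl⟩

theorem leftSet_subset : A.leftSet ⊆ A.actSet := by
  rintro _ ((⟨i, j, c, hij, rfl⟩ | ⟨i, j, rfl⟩) | ⟨p, hp, rfl⟩)
  · refine Or.inl (Or.inl ⟨Sum.inl i, Sum.inl j, c, rfl, ?_, rfl⟩)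
    exact hij
  · exact Or.inl (Or.inr ⟨i, j, rfl⟩)
  · exact Or.inr ⟨p, hp, rfl⟩

theorem leftSet_inv : ∀ s ∈ A.leftSet, s⁻¹ ∈ A.leftSet := by
  rintro _ ((⟨i, j, c, hij, rfl⟩ | ⟨i, j, rfl⟩) | ⟨p, hp, rfl⟩)
  · exact Or.inl (Or.inl ⟨i, j, -c, hij, A.x_inv (inl_root hij) c⟩)
  · exact Or.inl (Or.inr ⟨j, i, A.h_inv i j⟩)
  · exact Or.inr ⟨p⁻¹, hp.inv, (map_inv A.β p).symm⟩

theorem leftSet_conj_rightSet : ∀ s ∈ A.leftSet, ∀ y ∈ A.rightSet,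
    s * y * s⁻¹ ∈ Subgroup.closure A.rightSet := by
  have hx : ∀ i j c, i ≠ j → A.x (Sum.inr i) (Sum.inr j) c ∈ Subgroup.closure A.rightSet :=
    fun i j c hij => Subgroup.subset_closure (Or.inl (Or.inl ⟨i, j, c, hij, rfl⟩))
  have hh : ∀ i j, A.h (Sum.inr i) (Sum.inr j) ∈ Subgroup.closure A.rightSet :=
    fun i j => Subgroup.subset_closure (Or.inl (Or.inr ⟨i, j, rfl⟩))
  have hc : ∀ {s y : Γ}, y ∈ A.rightSet → Commute s y →
      s * y * s⁻¹ ∈ Subgroup.closure A.rightSet := by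
    intro s y hy h
    rw [h.eq, mul_inv_cancel_right]
    exact Subgroup.subset_closure hy
  have hd' : ∀ {p : LeviGroup F κ ν} {d}, p.1.1 = 1 → p.1.2 = diagUnit d →
      p.1 = (diagUnit 1, diagUnit d) := fun h1 h2 => Prod.ext (h1.trans diagUnit_one.symm) h2
  intro s hs y hy
  have hy' := hy
  rcases hs with (⟨i, j, c, hij, rfl⟩ | ⟨i, j, rfl⟩) | ⟨p, hp, rfl⟩ <;>
    rcases hy' with (⟨k, l, c', hkl, rfl⟩ | ⟨k, l, rfl⟩) | ⟨p', hp', ⟨d, hd⟩, rfl⟩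
  · exact hc hy (A.commute_x (inl_root hij) (inr_root hkl) (by simp) (by simp) _ _)
  · exact hc hy (A.h_mul_x (inl_root hij) (by simp) (by simp) (by simp) (by simp) c).symm
  · refine hc hy (Commute.symm ?_)
    exact A.β_diag_mul_x (hd' hp' hd) (inl_root hij) (by simp)
  · obtain ⟨o, h1, h2⟩ := A.mid' k l
    have hcomm : ∀ i, Commute (A.h (Sum.inl i) (Sum.inr o)) (A.x (Sum.inr k) (Sum.inr l) c') :=
      fun i => A.h_mul_x (inr_root hkl) (by simp) (by simp) (Sum.inr_injective.ne h1)
          (Sum.inr_injective.ne h2) c'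
    have hi : A.h i (Sum.inr o) * A.x (Sum.inr k) (Sum.inr l) c' * (A.h i (Sum.inr o))⁻¹ ∈
        Subgroup.closure A.rightSet := by
      rcases i with i | i
      · exact hc hy (hcomm i)
      · exact mul_mem (mul_mem (hh _ _) (hx _ _ _ hkl)) (inv_mem (hh _ _))
    rcases j with j | j
    · rw [← A.h_mul i (Sum.inr o) (Sum.inl j), ← A.h_inv (Sum.inl j)]
      have := (hcomm j).inv_left.eq
      have h3 : ∀ g h z : Γ, h * z = z * h → g * h * z * (g * h)⁻¹ = g * z * g⁻¹ := by
        intro g h z e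
        rw [mul_assoc g, e]
        group
      rw [h3 _ _ _ this]
      exact hi
    · rw [← A.h_mul i (Sum.inr o) (Sum.inr j), A.h_commute]
      have h3 : ∀ g h z : Γ, g * h * z * (g * h)⁻¹ = g * (h * z * h⁻¹) * g⁻¹ := by
        intro g h z
        group
      rw [h3]
      exact mul_mem (mul_mem (hh _ _) hi) (inv_mem (hh _ _))
  · exact hc hy (A.h_commute _ _ _ _)
  · exact hc hy (A.β_diag_commute_h ⟨1, d, hd' hp' hd⟩ _ _).symm
  · obtain ⟨c'', hc''⟩ := A.β_diag_conj_x hp (inr_root hkl) c'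
    rw [hc'']
    exact hx _ _ _ hkl
  · exact hc hy (A.β_diag_commute_h hp _ _)
  · obtain ⟨e, e', hp⟩ := hp
    exact hc hy (A.lam_mul_mul (leviSL_mem _) (leviSL_mem _) (leviSL_mem _) (leviSL_mem _)
      (commute_of_diagonal (leviSL_diag hp) (leviSL_diag (hd' hp' hd))))

end ParSys
end

section
open LaurentPolynomial
open scoped Matrix MatrixGroups

namespace ParSys

section
variable {F κ ν : Type*} [Field F] [Fintype κ] [DecidableEq κ] [Fintype ν] [DecidableEq ν]

theorem toBlocks_mul {S : Type*} [CommRing S] (g h : Matrix (κ ⊕ ν) (κ ⊕ ν) S)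
    (hg : g.toBlocks₂₁ = 0) (hh : h.toBlocks₂₁ = 0) :
    (g * h).toBlocks₁₁ = g.toBlocks₁₁ * h.toBlocks₁₁ ∧ (g * h).toBlocks₂₁ = 0 ∧
      (g * h).toBlocks₂₂ = g.toBlocks₂₂ * h.toBlocks₂₂ := by
  have h1 : ∀ m : Matrix (κ ⊕ ν) (κ ⊕ ν) S, m.toBlocks₂₁ = 0 →
      m = Matrix.fromBlocks m.toBlocks₁₁ m.toBlocks₁₂ 0 m.toBlocks₂₂ := fun m hm => by
    rw [← hm, Matrix.fromBlocks_toBlocks]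
  rw [h1 g hg, h1 h hh, Matrix.fromBlocks_multiply]
  simp

variable (F κ ν) in
/-- Block upper triangular matrices. -/
noncomputable def blockUpper : Subgroup (Matrix.SpecialLinearGroup (κ ⊕ ν) F[T;T⁻¹]) where
  carrier := {g | (g : Matrix (κ ⊕ ν) (κ ⊕ ν) F[T;T⁻¹]).toBlocks₂₁ = 0 ∧
    ((g⁻¹ : Matrix.SpecialLinearGroup (κ ⊕ ν) F[T;T⁻¹]) :
      Matrix (κ ⊕ ν) (κ ⊕ ν) F[T;T⁻¹]).toBlocks₂₁ = 0}
  mul_mem' := by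
    rintro g h ⟨h1, h2⟩ ⟨h3, h4⟩
    rw [Set.mem_ofPred_eq, mul_inv_rev, Matrix.SpecialLinearGroup.coe_mul,
      Matrix.SpecialLinearGroup.coe_mul]
    exact ⟨(toBlocks_mul _ _ h1 h3).2.1, (toBlocks_mul _ _ h4 h2).2.1⟩
  one_mem' := by
    rw [Set.mem_ofPred_eq, inv_one, Matrix.SpecialLinearGroup.coe_one, ← Matrix.fromBlocks_one,
      Matrix.toBlocks_fromBlocks₂₁, and_self]
  inv_mem' := by
    rintro g ⟨h1, h2⟩
    exact ⟨h2, by rwa [inv_inv]⟩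

theorem leviSL_toBlocks (p : LeviGroup F κ ν) :
    (leviSL p : Matrix (κ ⊕ ν) (κ ⊕ ν) F[T;T⁻¹]).toBlocks₂₁ = 0 := by
  rw [leviSL_val, Matrix.toBlocks_fromBlocks₂₁]

theorem torSL_toBlocks (i j : κ ⊕ ν) :
    (torSL F i j : Matrix (κ ⊕ ν) (κ ⊕ ν) F[T;T⁻¹]).toBlocks₂₁ = 0 := by
  ext1 k l
  rw [torSL_val]
  exact Matrix.diagonal_apply_ne
    (fun k => (T ((Pi.single i 1 - Pi.single j 1 : κ ⊕ ν → ℤ) k) : F[T;T⁻¹]))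
    (Sum.inr_ne_inl : (Sum.inr k : κ ⊕ ν) ≠ Sum.inl l)

theorem elSL_toBlocks (i : κ) (j : ν) (r : F[T;T⁻¹]) :
    (elSL (Sum.inl i) (Sum.inr j) r : Matrix (κ ⊕ ν) (κ ⊕ ν) F[T;T⁻¹]) =
      Matrix.fromBlocks 1 (Matrix.single i j r) 0 1 := by
  change rowMat _ _ = _
  rw [rowMat_single (by simp)]
  ext1 k l
  rcases k with k | k <;> rcases l with l | l <;>
    simp [Matrix.transvection, Matrix.one_apply, Matrix.single_apply]

theorem inv_mem_letters {g : Matrix.SpecialLinearGroup (κ ⊕ ν) F[T;T⁻¹]}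
    (hg : g ∈ letters F κ ν) : g⁻¹ ∈ letters F κ ν := by
  rcases hg with (⟨p, rfl⟩ | ⟨i, j, c, rfl⟩) | ⟨i, j, rfl⟩
  · rw [show (leviSL p)⁻¹ = leviSL p⁻¹ from ?_]
    · exact leviSL_mem _
    · rw [inv_eq_iff_mul_eq_one, ← leviSL_mul, mul_inv_cancel]
      apply Subtype.ext
      rw [leviSL_val]
      simp
  · rw [show (elSL (Sum.inl i) (Sum.inr j) (C c))⁻¹ = elSL (Sum.inl i) (Sum.inr j) (C (-c)) from ?_]
    · exact Or.inl (Or.inr ⟨i, j, -c, rfl⟩)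
    · rw [inv_eq_iff_mul_eq_one, ← elSL_add, ← map_add, add_neg_cancel, map_zero]
      apply Subtype.ext
      change rowMat _ _ = 1
      rw [Pi.single_zero, rowMat_zero]
  · rw [show (torSL F i j)⁻¹ = torSL F j i from ?_]
    · exact torSL_mem _ _
    · rw [inv_eq_iff_mul_eq_one, torSL_mul]
      apply Subtype.ext
      rw [torSL_val, sub_self, diagonal_T_zero]
      rfl

theorem letters_subset_blockUpper : letters F κ ν ⊆ blockUpper F κ ν := by
  have key : ∀ g ∈ letters F κ ν,
      (g : Matrix (κ ⊕ ν) (κ ⊕ ν) F[T;T⁻¹]).toBlocks₂₁ = 0 := by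
    rintro _ ((⟨p, rfl⟩ | ⟨i, j, c, rfl⟩) | ⟨i, j, rfl⟩)
    · exact leviSL_toBlocks p
    · rw [elSL_toBlocks, Matrix.toBlocks_fromBlocks₂₁]
    · exact torSL_toBlocks i j
  exact fun g hg => ⟨key g hg, key _ (inv_mem_letters hg)⟩

end

variable {F κ ν Γ : Type*} [Field F] [Fintype κ] [DecidableEq κ] [Fintype ν]
    [DecidableEq ν] [Group Γ] (A : ParSys F κ ν Γ)

/-- The matrix of an element. -/
noncomputable def mat (γ : Γ) : Matrix (κ ⊕ ν) (κ ⊕ ν) F[T;T⁻¹] := A.π γ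

theorem mat_mul (γ δ : Γ) : A.mat (γ * δ) = A.mat γ * A.mat δ := by
  rw [mat, map_mul, Matrix.SpecialLinearGroup.coe_mul]; rfl

theorem mat_one : A.mat 1 = 1 := by
  rw [mat, map_one, Matrix.SpecialLinearGroup.coe_one]

theorem mat_toBlocks (γ : Γ) : (A.mat γ).toBlocks₂₁ = 0 := by
  have h1 : (⊤ : Subgroup Γ) ≤ (blockUpper F κ ν).comap A.π := by
    rw [← A.closure_eq, Subgroup.closure_le]
    rintro _ ⟨x, hx, rfl⟩
    change A.π (A.lam x) ∈ blockUpper F κ ν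
    rw [A.π_lam x hx]
    exact letters_subset_blockUpper hx
  exact (h1 (Subgroup.mem_top γ)).1

/-- The first diagonal block. -/
noncomputable def projA : Γ →* Matrix κ κ F[T;T⁻¹] where
  toFun γ := (A.mat γ).toBlocks₁₁
  map_one' := by rw [mat_one, ← Matrix.fromBlocks_one, Matrix.toBlocks_fromBlocks₁₁]
  map_mul' γ δ := by
    rw [mat_mul]; exact (toBlocks_mul _ _ (A.mat_toBlocks γ) (A.mat_toBlocks δ)).1

/-- The second diagonal block. -/
noncomputable def projB : Γ →* Matrix ν ν F[T;T⁻¹] where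
  toFun γ := (A.mat γ).toBlocks₂₂
  map_one' := by rw [mat_one, ← Matrix.fromBlocks_one, Matrix.toBlocks_fromBlocks₂₂]
  map_mul' γ δ := by
    rw [mat_mul]; exact (toBlocks_mul _ _ (A.mat_toBlocks γ) (A.mat_toBlocks δ)).2.2

theorem projA_β (p : LeviGroup F κ ν) : A.projA (A.β p) = (p.1.1 : Matrix κ κ F).map C := by
  change (A.mat (A.β p)).toBlocks₁₁ = _
  rw [mat, π_β, leviSL_val, Matrix.toBlocks_fromBlocks₁₁]

theorem projB_β (p : LeviGroup F κ ν) : A.projB (A.β p) = (p.1.2 : Matrix ν ν F).map C := by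
  change (A.mat (A.β p)).toBlocks₂₂ = _
  rw [mat, π_β, leviSL_val, Matrix.toBlocks_fromBlocks₂₂]

theorem mat_h (i j : κ ⊕ ν) : A.mat (A.h i j) = torSL F i j := by rw [mat, π_h]

theorem exists_torusSys_left : ∃ B : TorusSys F κ Γ, B.α = A.β.comp (embA A.b₀) ∧
    B.π = A.projA ∧ ∀ k, B.τ (Pi.single k 1) = A.h (Sum.inl k) (Sum.inr A.b₀) := by
  refine TorusSys.exists_of_letters _ _ _ (fun i j => A.h_commute _ _ _ _) (fun h => ?_)
    (fun k => ?_) (fun h m k c hc hr => ?_) (fun i j hij c => ?_) A.mid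
  · exact A.projA_β _
  · change (A.mat _).toBlocks₁₁ = _
    rw [mat_h, torSL_inl_inr, Matrix.toBlocks_fromBlocks₁₁]
  · exact A.lam_mul_mul (leviSL_mem _) (torSL_mem _ _) (torSL_mem _ _) (leviSL_mem _)
      (leviSL_embA_mul_torSL _ hc hr)
  · rw [MonoidHom.comp_apply, β_embA_rowUnit _ hij]
    exact A.h_mul_h_mul_x (inl_root hij) (by simp) (by simp) c

theorem exists_torusSys_right : ∃ B : TorusSys F ν Γ, B.α = A.β.comp (embB A.a₀) ∧
    B.π = A.projB ∧ ∀ k, B.τ (Pi.single k 1) = A.h (Sum.inr k) (Sum.inl A.a₀) := by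
  refine TorusSys.exists_of_letters _ _ _ (fun i j => A.h_commute _ _ _ _) (fun h => ?_)
    (fun k => ?_) (fun h m k c hc hr => ?_) (fun i j hij c => ?_) A.mid'
  · exact A.projB_β _
  · change (A.mat _).toBlocks₂₂ = _
    rw [mat_h, torSL_inr_inl, Matrix.toBlocks_fromBlocks₂₂]
  · exact A.lam_mul_mul (leviSL_mem _) (torSL_mem _ _) (torSL_mem _ _) (leviSL_mem _)
      (leviSL_embB_mul_torSL _ hc hr)
  · rw [MonoidHom.comp_apply, β_embB_rowUnit _ hij]
    exact A.h_mul_h_mul_x (inr_root hij) (by simp) (by simp) c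

/-- The torus system of the first block. -/
noncomputable def left : TorusSys F κ Γ := A.exists_torusSys_left.choose

theorem left_α (h : GL κ F) : A.left.α h = A.β (embA A.b₀ h) := by
  rw [left, A.exists_torusSys_left.choose_spec.1]; rfl

theorem left_π : A.left.π = A.projA := A.exists_torusSys_left.choose_spec.2.1

theorem left_τ (k : κ) : A.left.τ (Pi.single k 1) = A.h (Sum.inl k) (Sum.inr A.b₀) :=
  A.exists_torusSys_left.choose_spec.2.2 k

/-- The torus system of the second block. -/
noncomputable def right : TorusSys F ν Γ := A.exists_torusSys_right.choose

theorem right_α (h : GL ν F) : A.right.α h = A.β (embB A.a₀ h) := by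
  rw [right, A.exists_torusSys_right.choose_spec.1]; rfl

theorem right_π : A.right.π = A.projB := A.exists_torusSys_right.choose_spec.2.1

theorem right_τ (k : ν) : A.right.τ (Pi.single k 1) = A.h (Sum.inr k) (Sum.inl A.a₀) :=
  A.exists_torusSys_right.choose_spec.2.2 k

/-- The subgroup of a torus system. -/
def _root_.TorusSys.sub {F κ Γ : Type*} [Field F] [Fintype κ] [DecidableEq κ] [Group Γ]
    (B : TorusSys F κ Γ) : Subgroup Γ := Subgroup.closure (Set.range B.α ∪ Set.range B.τ)

theorem right_α_mem (h : GL ν F) : A.β (embB A.a₀ h) ∈ A.right.sub :=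
  Subgroup.subset_closure (Or.inl ⟨h, A.right_α h⟩)

theorem left_α_mem (h : GL κ F) : A.β (embA A.b₀ h) ∈ A.left.sub :=
  Subgroup.subset_closure (Or.inl ⟨h, A.left_α h⟩)

theorem left_h_mem (k : κ) : A.h (Sum.inl k) (Sum.inr A.b₀) ∈ A.left.sub :=
  Subgroup.subset_closure (Or.inr ⟨_, A.left_τ k⟩)

theorem right_h_mem (k : ν) : A.h (Sum.inr k) (Sum.inl A.a₀) ∈ A.right.sub :=
  Subgroup.subset_closure (Or.inr ⟨_, A.right_τ k⟩)

theorem eq_embB {p : LeviGroup F κ ν} (hp : p.1.1 = 1) (o : κ) : p = embB o p.1.2 := by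
  have h1 : Matrix.GeneralLinearGroup.det p.1.1 * Matrix.GeneralLinearGroup.det p.1.2 = 1 := p.2
  rw [hp, map_one, one_mul] at h1
  refine Subtype.ext (Prod.ext ?_ rfl)
  rw [hp, embB_fst, detInv_eq_one o h1]

theorem closure_rightSet_le : Subgroup.closure A.rightSet ≤ A.right.sub := by
  rw [Subgroup.closure_le]
  rintro _ ((⟨i, j, c, hij, rfl⟩ | ⟨i, j, rfl⟩) | ⟨p, hp, -, rfl⟩)
  · rw [← β_embB_rowUnit _ hij]
    exact A.right_α_mem _
  · rw [← A.h_mul _ (Sum.inl A.a₀), ← A.h_inv (Sum.inr j)]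
    exact mul_mem (A.right_h_mem i) (inv_mem (A.right_h_mem j))
  · rw [eq_embB hp A.a₀]
    exact A.right_α_mem _

theorem projA_rightSet {γ : Γ} (hγ : γ ∈ Subgroup.closure A.rightSet) : A.projA γ = 1 := by
  have h1 : Subgroup.closure A.rightSet ≤ A.projA.ker := by
    rw [Subgroup.closure_le]
    rintro _ ((⟨i, j, c, hij, rfl⟩ | ⟨i, j, rfl⟩) | ⟨p, hp, -, rfl⟩)
    · rw [SetLike.mem_coe, MonoidHom.mem_ker, ← β_embB_rowUnit _ hij, projA_β, embB_fst,
        detInv_eq_one _ (det_rowUnit c)]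
      simp
    · rw [SetLike.mem_coe, MonoidHom.mem_ker]
      change (A.mat _).toBlocks₁₁ = 1
      rw [mat_h, torSL_val]
      ext1 k l
      by_cases hkl : k = l
      · subst hkl
        simp [Matrix.toBlocks₁₁]
      · simp [Matrix.toBlocks₁₁, hkl]
    · rw [SetLike.mem_coe, MonoidHom.mem_ker, projA_β, hp]
      simp
  exact h1 hγ

theorem left_sub_le : A.left.sub ≤ Subgroup.closure A.leftSet := by
  refine (Subgroup.closure_le _).2 ?_
  rintro _ (⟨h, rfl⟩ | ⟨d, rfl⟩)
  · rw [left_α]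
    change _ ∈ Subgroup.closure A.leftSet
    induction h using GL_induction with
    | hmul g h hg hh => rw [map_mul, map_mul]; exact mul_mem hg hh
    | hdiag d => exact Subgroup.subset_closure (Or.inr ⟨_, ⟨d, _, rfl⟩, rfl⟩)
    | helem i j hij c =>
      rw [β_embA_rowUnit _ hij]
      exact Subgroup.subset_closure (Or.inl (Or.inl ⟨i, j, c, hij, rfl⟩))
  · refine torus_mem A.left.τ_add (fun k => ?_) d
    rw [left_τ]
    exact Subgroup.subset_closure (Or.inl (Or.inr ⟨_, _, rfl⟩))

/-- Products of an element of the unipotent radical and one of the second block. -/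
noncomputable def unipRight : Subgroup Γ :=
  normProd (Subgroup.closure A.unipSet) (Subgroup.closure A.rightSet) fun _ hx _ hy =>
    closure_conj_mem A.actSet_inv A.actSet_conj_unipSet
      (Subgroup.closure_mono A.rightSet_subset hx) hy

theorem left_conj_unipRight : ∀ x ∈ A.left.sub, ∀ y ∈ A.unipRight, x * y * x⁻¹ ∈ A.unipRight := by
  rintro x hx _ ⟨u, hu, b, hb, rfl⟩
  have hx' := A.left_sub_le hx
  exact ⟨x * u * x⁻¹, closure_conj_mem A.actSet_inv A.actSet_conj_unipSet
    (Subgroup.closure_mono A.leftSet_subset hx') hu, x * b * x⁻¹,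
    closure_conj_mem A.leftSet_inv A.leftSet_conj_rightSet hx' hb, by group⟩

theorem exists_eq_mul (γ : Γ) : ∃ u ∈ Subgroup.closure A.unipSet,
    ∃ b ∈ Subgroup.closure A.rightSet, ∃ g ∈ A.left.sub, γ = u * b * g := by
  let M := normProd A.unipRight A.left.sub A.left_conj_unipRight
  have hU : ∀ u ∈ Subgroup.closure A.unipSet, u ∈ M := fun u hu =>
    ⟨u, ⟨u, hu, 1, one_mem _, by simp⟩, 1, one_mem _, by simp⟩
  have hB : ∀ b ∈ Subgroup.closure A.rightSet, b ∈ M := fun b hb =>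
    ⟨b, ⟨1, one_mem _, b, hb, by simp⟩, 1, one_mem _, by simp⟩
  have hA : ∀ g ∈ A.left.sub, g ∈ M := fun g hg => ⟨1, one_mem _, g, hg, by simp⟩
  have hdec : ∀ p : LeviGroup F κ ν, (p * (embA A.b₀ p.1.1)⁻¹).1.1 = 1 := fun p => by
    rw [Subgroup.coe_mul, Subgroup.coe_inv, Prod.fst_mul, Prod.fst_inv, embA_fst, mul_inv_cancel]
  have hred : ∀ p, A.β (p * (embA A.b₀ p.1.1)⁻¹) ∈ M → A.β p ∈ M := fun p hp => by
    have := mul_mem hp (hA _ (A.left_α_mem p.1.1))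
    rwa [← map_mul, inv_mul_cancel_right] at this
  have hβB : ∀ h, A.β (embB A.a₀ h) ∈ M := by
    intro h
    induction h using GL_induction with
    | hmul g h hg hh => rw [map_mul, map_mul]; exact mul_mem hg hh
    | hdiag d =>
      refine hred _ (hB _ (Subgroup.subset_closure (Or.inr ⟨_, hdec _, ?_, rfl⟩)))
      refine ⟨d * (Pi.mulSingle A.b₀ (Matrix.GeneralLinearGroup.det
        (detInv A.a₀ (diagUnit d)))⁻¹)⁻¹, ?_⟩
      rw [← diagUnit_mul, ← diagUnit_inv]
      rfl
    | helem i j hij c =>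
      rw [β_embB_rowUnit _ hij]
      exact hB _ (Subgroup.subset_closure (Or.inl (Or.inl ⟨i, j, c, hij, rfl⟩)))
  have hh : ∀ i, A.h i (Sum.inr A.b₀) ∈ M := by
    rintro (i | i)
    · exact hA _ (A.left_h_mem i)
    · exact hB _ (Subgroup.subset_closure (Or.inl (Or.inr ⟨i, _, rfl⟩)))
  have htop : (⊤ : Subgroup Γ) ≤ M := by
    rw [← A.closure_eq, Subgroup.closure_le]
    rintro _ ⟨_, (⟨p, rfl⟩ | ⟨i, j, c, rfl⟩) | ⟨i, j, rfl⟩, rfl⟩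
    · change A.β p ∈ M
      refine hred p ?_
      rw [eq_embB (hdec p) A.a₀]
      exact hβB _
    · refine hU _ (Subgroup.subset_closure ⟨(i, j), 0, c, ?_⟩)
      exact (A.y_zero (show ParRoot (Sum.inl i) (Sum.inr j) from trivial) c).symm
    · change A.h i j ∈ M
      rw [← A.h_mul _ (Sum.inr A.b₀), ← A.h_inv j]
      exact mul_mem (hh i) (inv_mem (hh j))
  obtain ⟨_, ⟨u, hu, b, hb, rfl⟩, g, hg, rfl⟩ := htop (Subgroup.mem_top γ)
  exact ⟨u, hu, b, hb, g, hg, rfl⟩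

theorem mat_τ {d : κ ⊕ ν → ℤ} (hd : d ∈ degrees (κ ⊕ ν)) :
    A.mat (A.τ d) = Matrix.diagonal fun i => T (d i) := by
  let f : (κ ⊕ ν → ℤ) → (κ ⊕ ν → ℤ) := fun d => d - Pi.single (Sum.inr A.b₀) (∑ i, d i)
  let ρ : Γ →* Matrix (κ ⊕ ν) (κ ⊕ ν) F[T;T⁻¹] :=
    { toFun := A.mat, map_one' := A.mat_one, map_mul' := A.mat_mul }
  have h1 := torus_map A.τ_add ρ (σ := fun d => Matrix.diagonal fun i => T (f d i))
    (by simp [f]) (fun d e => by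
      rw [← diagonal_T_add]
      congr! 3
      simp only [f, Pi.add_apply, Finset.sum_add_distrib, Pi.single_add, Pi.sub_apply]
      ring) (fun k => by
        change A.mat _ = _
        rw [A.τ_single, mat_h, torSL_val]
        simp [f, -Fintype.sum_sum_type]) d
  change A.mat (A.τ d) = _ at h1
  rw [h1]
  have hd' : ∑ i, d i = 0 := hd
  simp [f, hd', -Fintype.sum_sum_type]

theorem mat_y (i : κ) (j : ν) (p : ℤ) (c : F) :
    A.mat (A.roots.y (Sum.inl i) (Sum.inr j) p c) =
      Matrix.fromBlocks 1 (Matrix.single i j (C c * T p)) 0 1 := by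
  have hR' : ParRoot (Sum.inl i : κ ⊕ ν) (Sum.inr j) := trivial
  have hR : A.roots.Φ (Sum.inl i) (Sum.inr j) := hR'
  obtain ⟨d, hd, rfl⟩ := A.roots.exists_degree hR p
  rw [A.roots.y_eq hR hd, ← elSL_toBlocks]
  rw [mat]
  congr 1
  change A.π (A.τ d * A.x _ _ c * (A.τ d)⁻¹) = _
  rw [map_mul, map_mul, map_inv, mul_inv_eq_iff_eq_mul, A.π_x hR']
  refine elSL_conj_diagonal (A.mat_τ hd) ?_
  rw [mul_assoc, ← T_add, sub_add_cancel, mul_comm]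

theorem unip_eq {u : Γ} (hu : u ∈ Subgroup.closure A.unipSet) :
    A.projA u = 1 ∧ A.projB u = 1 ∧ (A.π u = 1 → u = 1) := by
  have hR : ∀ k : κ × ν, A.roots.Φ (Sum.inl k.1) (Sum.inr k.2) := fun _ => trivial
  obtain ⟨θ, h1, h2, h3⟩ := exists_hom_of_commuting (F := F)
    (fun (k : κ × ν) p c => A.roots.y (Sum.inl k.1) (Sum.inr k.2) p c)
    (fun k p c c' => A.roots.y_add (hR k) p c c')
    (fun k p c k' p' c' => (A.roots.commute_y (hR k) (hR k') (by simp) (by simp) p p' c c').eq)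
  have h0 : θ 0 = 1 := by
    have := h1 0 0
    rw [add_zero] at this
    exact left_eq_mul.1 this
  have hmat : ∀ f, A.mat (θ f) = Matrix.fromBlocks 1 (Matrix.of fun i j => f (i, j)) 0 1 := by
    intro f
    refine vec_induction (P := fun f => A.mat (θ f) =
      Matrix.fromBlocks 1 (Matrix.of fun i j => f (i, j)) 0 1) (fun _ => True) ?_ ?_ ?_ f
      (fun k hk => absurd trivial hk)
    · rw [h0, mat_one, ← Matrix.fromBlocks_one]
      congr 1
    · intro f g hf hg
      rw [h1, mat_mul, hf, hg, Matrix.fromBlocks_multiply]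
      simp only [Matrix.mul_one, Matrix.one_mul, Matrix.mul_zero, Matrix.zero_mul, add_zero,
        zero_add]
      congr 1
      ext1 i j
      simp [add_comm]
    · intro k _ p c
      rw [h2, mat_y]
      congr 1
      ext1 i j
      simp only [Matrix.single_apply, Matrix.of_apply, Pi.single_apply, Prod.ext_iff]
      congr 1
      simp only [eq_comm]
  have hsurj : ∃ f, u = θ f := by
    induction hu using Subgroup.closure_induction with
    | mem x hx =>
      obtain ⟨k, p, c, rfl⟩ := hx
      exact ⟨_, (h2 k p c).symm⟩
    | one => exact ⟨0, h0.symm⟩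
    | mul x y _ _ hx hy =>
      obtain ⟨f, rfl⟩ := hx
      obtain ⟨g, rfl⟩ := hy
      exact ⟨f + g, (h1 f g).symm⟩
    | inv x _ hx =>
      obtain ⟨f, rfl⟩ := hx
      refine ⟨-f, ?_⟩
      rw [inv_eq_iff_mul_eq_one, ← h1, add_neg_cancel, h0]
  obtain ⟨f, rfl⟩ := hsurj
  refine ⟨?_, ?_, fun h => ?_⟩
  · change (A.mat _).toBlocks₁₁ = _
    rw [hmat, Matrix.toBlocks_fromBlocks₁₁]
  · change (A.mat _).toBlocks₂₂ = _
    rw [hmat, Matrix.toBlocks_fromBlocks₂₂]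
  · have h4 : A.mat (θ f) = 1 := by rw [mat, h, Matrix.SpecialLinearGroup.coe_one]
    rw [hmat, ← Matrix.fromBlocks_one, Matrix.fromBlocks_inj] at h4
    have h5 : f = 0 := by
      ext1 k
      exact congrFun (congrFun h4.2.1 k.1) k.2
    rw [h5, h0]

theorem π_injective : Function.Injective A.π := by
  rw [injective_iff_map_eq_one]
  intro γ hγ
  obtain ⟨u, hu, b, hb, g, hg, rfl⟩ := A.exists_eq_mul γ
  obtain ⟨h1, h2, h3⟩ := A.unip_eq hu
  have hmat : A.mat (u * b * g) = 1 := by rw [mat, hγ, Matrix.SpecialLinearGroup.coe_one]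
  have hA : A.projA (u * b * g) = 1 := by
    change (A.mat _).toBlocks₁₁ = 1
    rw [hmat, ← Matrix.fromBlocks_one, Matrix.toBlocks_fromBlocks₁₁]
  have hB : A.projB (u * b * g) = 1 := by
    change (A.mat _).toBlocks₂₂ = 1
    rw [hmat, ← Matrix.fromBlocks_one, Matrix.toBlocks_fromBlocks₂₂]
  rw [map_mul, map_mul, h1, A.projA_rightSet hb, one_mul, one_mul, ← left_π] at hA
  obtain rfl := A.left.eq_one_of_π_eq_one hg hA A.a₀
  rw [mul_one, map_mul, h2, one_mul, ← right_π] at hB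
  obtain rfl := A.right.eq_one_of_π_eq_one (A.closure_rightSet_le hb) hB A.b₀
  rw [mul_one, mul_one] at hγ ⊢
  exact h3 hγ

end ParSys
end

section
open LaurentPolynomial
open scoped Matrix MatrixGroups

theorem IsFinitelyPresented.of_mulEquiv {G H : Type*} [Group G] [Group H]
    (h : IsFinitelyPresented G) (e : G ≃* H) : IsFinitelyPresented H := by
  obtain ⟨m, S, ⟨f⟩⟩ := h
  exact ⟨m, S, ⟨f.trans e⟩⟩

theorem isFinitelyPresented_closure {G : Type*} [Group G] (X : Set G) (hX : X.Finite) (K : ℕ)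
    (H : ∀ (Γ : Type) [Group Γ] (lam : G → Γ) (π : Γ →* G), (∀ x ∈ X, π (lam x) = x) →
      Subgroup.closure (lam '' X) = ⊤ →
      (∀ l l' : List G, (∀ x ∈ l, x ∈ X) → (∀ x ∈ l', x ∈ X) → l.length ≤ K → l'.length ≤ K →
        l.prod = l'.prod → (l.map lam).prod = (l'.map lam).prod) → Function.Injective π) :
    IsFinitelyPresented (Subgroup.closure X) := by
  classical
  refine isFinitelyPresented_of_forall_injective
    (((↑) : Subgroup.closure X → G) ⁻¹' X) (hX.preimage Subtype.val_injective.injOn)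
    (Subgroup.closure_closure_coe_preimage) K ?_
  intro Γ _ lam π hπ hcl hw
  let lam' : G → Γ := fun g => if h : g ∈ Subgroup.closure X then lam ⟨g, h⟩ else 1
  have hlam : ∀ g (h : g ∈ Subgroup.closure X), lam' g = lam ⟨g, h⟩ := fun g h => dif_pos h
  have hinj := H Γ lam' ((Subgroup.closure X).subtype.comp π) ?_ ?_ ?_
  · exact fun x y hxy => hinj (congrArg Subtype.val hxy)
  · intro x hx
    rw [hlam x (Subgroup.subset_closure hx), MonoidHom.comp_apply, hπ _ hx]
    rfl
  · rw [← hcl]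
    congr 1
    ext γ
    constructor
    · rintro ⟨x, hx, rfl⟩
      exact ⟨⟨x, Subgroup.subset_closure hx⟩, hx, (hlam _ _).symm⟩
    · rintro ⟨⟨x, hx'⟩, hx, rfl⟩
      exact ⟨x, hx, hlam _ _⟩
  · intro l l' hl hl' hlK hlK' hprod
    lift l to List (Subgroup.closure X) using fun x hx => Subgroup.subset_closure (hl x hx)
    lift l' to List (Subgroup.closure X) using fun x hx => Subgroup.subset_closure (hl' x hx)
    have hmap : ∀ l : List (Subgroup.closure X),
        (l.map ((↑) : Subgroup.closure X → G)).map lam' = l.map lam := by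
      intro l
      rw [List.map_map]
      exact List.map_congr_left fun x _ => hlam _ x.2
    rw [hmap, hmap]
    refine hw l l' (fun x hx => hl _ (List.mem_map_of_mem hx))
      (fun x hx => hl' _ (List.mem_map_of_mem hx)) (by simpa using hlK) (by simpa using hlK') ?_
    exact Subtype.val_injective (by simpa using hprod)

theorem LaurentPolynomial.exists_eq_C_mul_T {F : Type*} [Field F] {u v : F[T;T⁻¹]}
    (h : u * v = 1) : ∃ (c : Fˣ) (d : ℤ), u = C (c : F) * T d := by
  obtain ⟨n, f, hf⟩ := u.exists_T_pow
  obtain ⟨m, g, hg⟩ := v.exists_T_pow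
  have h1 : f * g = Polynomial.X ^ (n + m) := by
    apply Polynomial.toLaurent_injective
    rw [map_mul, hf, hg, mul_mul_mul_comm, h, one_mul, ← T_add, Polynomial.toLaurent_X_pow,
      Nat.cast_add]
  obtain ⟨i, -, w, hw⟩ := (dvd_prime_pow Polynomial.prime_X _).1 (Dvd.intro g h1)
  obtain ⟨c, hc, hcw⟩ := Polynomial.isUnit_iff.1 (w⁻¹).isUnit
  obtain ⟨c, rfl⟩ := hc
  refine ⟨c, i - n, ?_⟩
  have h2 : f = Polynomial.C (c : F) * Polynomial.X ^ i := by
    rw [hcw, mul_comm, ← hw, Units.mul_inv_cancel_right]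
  rw [h2, Polynomial.toLaurent_C_mul_X_pow] at hf
  rw [sub_eq_add_neg, T_add, ← mul_assoc, hf, mul_assoc, ← T_add, add_neg_cancel, T_zero, mul_one]

section
variable {F κ ν : Type*} [Field F] [Fintype κ] [DecidableEq κ] [Fintype ν] [DecidableEq ν]

theorem prod_C_mul_T {ι : Type*} [Fintype ι] (c : ι → F) (d : ι → ℤ) :
    ∏ i, (C (c i) * T (d i) : F[T;T⁻¹]) = C (∏ i, c i) * T (∑ i, d i) := by
  classical
  have h : ∀ t : Finset ι,
      ∏ i ∈ t, (C (c i) * T (d i) : F[T;T⁻¹]) = C (∏ i ∈ t, c i) * T (∑ i ∈ t, d i) := by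
    intro t
    induction t using Finset.induction_on with
    | empty => simp
    | insert k t hk ih =>
      rw [Finset.prod_insert hk, Finset.sum_insert hk, Finset.prod_insert hk, ih, T_add, map_mul,
        mul_mul_mul_comm]
  exact h _

/-- The units of the Laurent polynomials which appear in a diagonal matrix. -/
theorem exists_diagonal_eq {ι : Type*} [Fintype ι] [DecidableEq ι] {u : ι → F[T;T⁻¹]}
    (h : ∏ i, u i = 1) : ∃ (c : ι → Fˣ) (d : ι → ℤ), (∏ i, c i = 1) ∧ (∑ i, d i = 0) ∧
      ∀ i, u i = C (c i : F) * T (d i) := by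
  have h1 : ∀ i, ∃ (c : Fˣ) (d : ℤ), u i = C (c : F) * T d := fun i =>
    exists_eq_C_mul_T (v := ∏ j ∈ Finset.univ.erase i, u j)
      (by rw [Finset.mul_prod_erase _ _ (Finset.mem_univ i), h])
  choose c d hu using h1
  have h2 : (C (∏ i, (c i : F)) * T (∑ i, d i) : F[T;T⁻¹]) = C 1 * T 0 := by
    rw [← prod_C_mul_T, map_one, T_zero, mul_one, ← h]
    exact Finset.prod_congr rfl fun i _ => (hu i).symm
  have h3 : ∑ i, d i = 0 := by
    have h4 := congrArg degree h2
    rw [degree_C_mul_T _ _ (Finset.prod_ne_zero_iff.2 fun i _ => (c i).ne_zero),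
      degree_C_mul_T _ _ one_ne_zero] at h4
    exact_mod_cast h4
  refine ⟨c, d, Units.ext ?_, h3, hu⟩
  rw [h3, T_zero, mul_one, mul_one] at h2
  rw [Units.coe_prod, Units.val_one]
  by_contra hne
  have h4 := congrArg degree (sub_eq_zero.2 h2)
  rw [← map_sub, degree_C (sub_ne_zero.2 hne), degree_zero] at h4
  exact WithBot.coe_ne_bot h4

theorem exists_mem_closure_letters_diagonal_T (o : κ ⊕ ν) {d : κ ⊕ ν → ℤ} (hd : ∑ i, d i = 0) :
    ∃ g ∈ Subgroup.closure (letters F κ ν),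
      (g : Matrix (κ ⊕ ν) (κ ⊕ ν) F[T;T⁻¹]) = Matrix.diagonal fun i => T (d i) := by
  let f : (κ ⊕ ν → ℤ) →+ (κ ⊕ ν → ℤ) :=
    { toFun := fun d => d - Pi.single o (∑ i, d i)
      map_zero' := by simp
      map_add' := fun d e => by
        simp only [Pi.add_apply, Finset.sum_add_distrib, Pi.single_add]
        abel }
  let H : AddSubgroup (κ ⊕ ν → ℤ) :=
    { carrier := {d | ∃ g ∈ Subgroup.closure (letters F κ ν),
        (g : Matrix (κ ⊕ ν) (κ ⊕ ν) F[T;T⁻¹]) = Matrix.diagonal fun i => T (f d i)}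
      zero_mem' := ⟨1, one_mem _, by
        rw [map_zero, diagonal_T_zero, Matrix.SpecialLinearGroup.coe_one]⟩
      add_mem' := by
        rintro d e ⟨g, hg, hgd⟩ ⟨h, hh, hhe⟩
        refine ⟨g * h, mul_mem hg hh, ?_⟩
        rw [Matrix.SpecialLinearGroup.coe_mul, hgd, hhe, map_add, diagonal_T_add]
      neg_mem' := by
        rintro d ⟨g, hg, hgd⟩
        refine ⟨g⁻¹, inv_mem hg, ?_⟩
        have h1 : (g⁻¹).1 * g.1 = 1 := by
          rw [← Matrix.SpecialLinearGroup.coe_mul, inv_mul_cancel,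
            Matrix.SpecialLinearGroup.coe_one]
        refine (left_inv_eq_right_inv h1 ?_)
        change g.1 = _ at hgd
        rw [hgd, ← diagonal_T_add, ← map_add, add_neg_cancel, map_zero, diagonal_T_zero] }
  have hmem : d ∈ H := by
    refine mem_of_single_mem (fun k => ?_) d
    refine ⟨torSL F k o, Subgroup.subset_closure (torSL_mem _ _), ?_⟩
    have h1 : f (Pi.single k 1) = (Pi.single k 1 - Pi.single o 1 : κ ⊕ ν → ℤ) := by
      have h2 : ∑ i, (Pi.single k 1 : κ ⊕ ν → ℤ) i = 1 := by
        rw [Finset.sum_pi_single', if_pos (Finset.mem_univ k)]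
      change (Pi.single k 1 : κ ⊕ ν → ℤ) - Pi.single o (∑ i, _) = _
      rw [h2]
    rw [torSL_val, h1]
  obtain ⟨g, hg, hgd⟩ := hmem
  have h1 : f d = d := by
    change d - Pi.single o (∑ i, d i) = d
    rw [hd, Pi.single_zero, sub_zero]
  rw [h1] at hgd
  exact ⟨g, hg, hgd⟩

variable (F κ ν) in
/-- The diagonal matrices and the elementary matrices of the parabolic subgroup. -/
def parGens : Set (Matrix.SpecialLinearGroup (κ ⊕ ν) F[T;T⁻¹]) :=
  {g | (g : Matrix (κ ⊕ ν) (κ ⊕ ν) F[T;T⁻¹]).IsDiag} ∪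
    {g | ∃ (i j : κ ⊕ ν) (r : F[T;T⁻¹]), ParRoot i j ∧ g = elSL i j r}

theorem isDiag_mem_closure_letters (o : κ ⊕ ν) {g : Matrix.SpecialLinearGroup (κ ⊕ ν) F[T;T⁻¹]}
    (hg : (g : Matrix (κ ⊕ ν) (κ ⊕ ν) F[T;T⁻¹]).IsDiag) :
    g ∈ Subgroup.closure (letters F κ ν) := by
  obtain ⟨u, hu⟩ : ∃ u : κ ⊕ ν → F[T;T⁻¹], g.1 = Matrix.diagonal u :=
    ⟨_, hg.diagonal_diag.symm⟩
  have hdet := g.2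
  rw [hu, Matrix.det_diagonal] at hdet
  obtain ⟨c, d, hc, hd, hcd⟩ := exists_diagonal_eq hdet
  obtain ⟨t, ht, htd⟩ := exists_mem_closure_letters_diagonal_T (F := F) o hd
  have hp : (diagUnit fun i => c (Sum.inl i), diagUnit fun i => c (Sum.inr i)) ∈
      (leviDet F κ ν).ker := by
    rw [MonoidHom.mem_ker]
    apply Units.ext
    change (Matrix.diagonal _).det * (Matrix.diagonal _).det = 1
    rw [Matrix.det_diagonal, Matrix.det_diagonal, ← Units.coe_prod, ← Units.coe_prod,
      ← Units.val_mul, ← Fintype.prod_sum_type, hc, Units.val_one]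
  have h1 : g = leviSL ⟨_, hp⟩ * t := by
    apply Subtype.ext
    rw [Matrix.SpecialLinearGroup.coe_mul, ParSys.leviSL_diag rfl, htd,
      Matrix.diagonal_mul_diagonal, hu]
    congr 1
    ext1 i
    rw [hcd]
    rcases i with i | i <;> rfl
  rw [h1]
  exact mul_mem (Subgroup.subset_closure (leviSL_mem _)) ht

theorem elSL_mem_closure_letters (o : κ) (o' : ν) (hκ : ∀ i j : κ ⊕ ν, ∃ k, k ≠ i ∧ k ≠ j)
    {i j : κ ⊕ ν} (hij : ParRoot i j) (r : F[T;T⁻¹]) :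
    elSL i j r ∈ Subgroup.closure (letters F κ ν) := by
  induction r using laurent_add_induction with
  | h0 =>
    rw [← map_zero C]
    exact Subgroup.subset_closure (elSL_mem_letters o o' hij 0)
  | hadd f g hf hg =>
    rw [elSL_add]
    exact mul_mem hf hg
  | hmon c p =>
    obtain ⟨k, hki, hkj⟩ := hκ i j
    have hsum : ∑ l, (Pi.single i p - Pi.single k p : κ ⊕ ν → ℤ) l = 0 := by simp
    obtain ⟨t, ht, htd⟩ := exists_mem_closure_letters_diagonal_T (F := F) k hsum
    have h1 : t * elSL i j (C c) = elSL i j (C c * T p) * t := by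
      refine elSL_conj_diagonal htd ?_
      rw [Pi.sub_apply, Pi.sub_apply, Pi.single_eq_same, Pi.single_eq_of_ne hki.symm,
        Pi.single_eq_of_ne hij.ne.symm, Pi.single_eq_of_ne hkj.symm, sub_zero, sub_zero, T_zero,
        mul_one, mul_comm]
    rw [← mul_inv_eq_iff_eq_mul] at h1
    rw [← h1]
    exact mul_mem (mul_mem ht (Subgroup.subset_closure (elSL_mem_letters o o' hij c))) (inv_mem ht)

theorem leviSL_mem_closure_parGens (o : κ) (o' : ν) (p : LeviGroup F κ ν) :
    leviSL p ∈ Subgroup.closure (parGens F κ ν) := by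
  have hdiag : ∀ (p : LeviGroup F κ ν) d d', p.1 = (diagUnit d, diagUnit d') →
      leviSL p ∈ Subgroup.closure (parGens F κ ν) := fun p d d' h =>
    Subgroup.subset_closure (Or.inl (by
      rw [Set.mem_ofPred_eq, ParSys.leviSL_diag h]
      exact Matrix.isDiag_diagonal _))
  have hel : ∀ i j (_ : ParRoot i j) (c : F),
      elSL i j (C c) ∈ Subgroup.closure (parGens F κ ν) := fun i j h c =>
    Subgroup.subset_closure (Or.inr ⟨i, j, C c, h, rfl⟩)
  have hA : ∀ g : GL κ F, leviSL (embA o' g) ∈ Subgroup.closure (parGens F κ ν) := by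
    intro g
    induction g using GL_induction with
    | hmul g h hg hh => rw [map_mul, leviSL_mul]; exact mul_mem hg hh
    | hdiag d => exact hdiag _ d _ rfl
    | helem i j hij c => rw [leviSL_embA_rowUnit _ hij]; exact hel (Sum.inl i) (Sum.inl j) hij c
  have hB : ∀ g : GL ν F, leviSL (embB o g) ∈ Subgroup.closure (parGens F κ ν) := by
    intro g
    induction g using GL_induction with
    | hmul g h hg hh => rw [map_mul, leviSL_mul]; exact mul_mem hg hh
    | hdiag d => exact hdiag _ _ d rfl
    | helem i j hij c => rw [leviSL_embB_rowUnit _ hij]; exact hel (Sum.inr i) (Sum.inr j) hij c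
  have h1 : (p * (embA o' p.1.1)⁻¹).1.1 = 1 := by
    rw [Subgroup.coe_mul, Subgroup.coe_inv, Prod.fst_mul, Prod.fst_inv, embA_fst, mul_inv_cancel]
  rw [← inv_mul_cancel_right p (embA o' p.1.1), leviSL_mul, ParSys.eq_embB h1 o]
  exact mul_mem (hB _) (hA _)

theorem closure_letters_eq (o : κ) (o' : ν) (hκ : ∀ i j : κ ⊕ ν, ∃ k, k ≠ i ∧ k ≠ j) :
    Subgroup.closure (letters F κ ν) = Subgroup.closure (parGens F κ ν) := by
  apply le_antisymm <;> rw [Subgroup.closure_le]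
  · rintro _ ((⟨p, rfl⟩ | ⟨i, j, c, rfl⟩) | ⟨i, j, rfl⟩)
    · exact leviSL_mem_closure_parGens o o' p
    · exact Subgroup.subset_closure (Or.inr ⟨Sum.inl i, Sum.inr j, C c, trivial, rfl⟩)
    · refine Subgroup.subset_closure (Or.inl ?_)
      rw [Set.mem_ofPred_eq, torSL_val]
      exact Matrix.isDiag_diagonal _
  · rintro _ (hg | ⟨i, j, r, hij, rfl⟩)
    · exact isDiag_mem_closure_letters (Sum.inl o) hg
    · exact elSL_mem_closure_letters o o' hκ hij r

theorem exists_ne_ne_of_three_le_card {α : Type*} [Fintype α] [DecidableEq α]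
    (h : 3 ≤ Fintype.card α) (i j : α) : ∃ k, k ≠ i ∧ k ≠ j := by
  have h1 : (({i, j} : Finset α)ᶜ).Nonempty := by
    rw [← Finset.card_pos, Finset.card_compl]
    have := Finset.card_le_two (a := i) (b := j)
    omega
  obtain ⟨k, hk⟩ := h1
  exact ⟨k, by simpa using hk⟩

theorem isFinitelyPresented_closure_parGens [Finite F] (hκ : 3 ≤ Fintype.card κ)
    (hν : 3 ≤ Fintype.card ν) : IsFinitelyPresented (Subgroup.closure (parGens F κ ν)) := by
  have ⟨o⟩ : Nonempty κ := Fintype.card_pos_iff.1 (by omega)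
  have ⟨o'⟩ : Nonempty ν := Fintype.card_pos_iff.1 (by omega)
  rw [← closure_letters_eq o o' (exists_ne_ne_of_three_le_card (by rw [Fintype.card_sum]; omega))]
  refine isFinitelyPresented_closure _ letters_finite 3 fun Γ _ lam π h1 h2 h3 => ?_
  exact ParSys.π_injective ⟨lam, π, h1, h2, h3, o, o', exists_ne_ne_of_three_le_card hκ,
    exists_ne_ne_of_three_le_card hν⟩

end

/-- Relabelling the indices of a special linear group. -/
def reindexSL {m n S : Type*} [CommRing S] [Fintype m] [DecidableEq m] [Fintype n] [DecidableEq n]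
    (e : m ≃ n) : Matrix.SpecialLinearGroup m S ≃* Matrix.SpecialLinearGroup n S where
  toFun g := ⟨Matrix.reindex e e g, by rw [Matrix.det_reindex_self, g.2]⟩
  invFun g := ⟨Matrix.reindex e.symm e.symm g, by rw [Matrix.det_reindex_self, g.2]⟩
  left_inv g := Subtype.ext (by ext; simp)
  right_inv g := Subtype.ext (by ext; simp)
  map_mul' g h := Subtype.ext (Matrix.submatrix_mul_equiv g.1 h.1 _ e.symm _).symm

section
variable {m n S : Type*} [CommRing S] [Fintype m] [DecidableEq m] [Fintype n] [DecidableEq n]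

theorem reindexSL_apply (e : m ≃ n) (g : Matrix.SpecialLinearGroup m S) (i j : n) :
    (reindexSL e g : Matrix n n S) i j = (g : Matrix m m S) (e.symm i) (e.symm j) := rfl

theorem reindexSL_isDiag (e : m ≃ n) {g : Matrix.SpecialLinearGroup m S}
    (hg : (g : Matrix m m S).IsDiag) : (reindexSL e g : Matrix n n S).IsDiag := fun _ _ hij =>
  hg (e.symm.injective.ne hij)

theorem reindexSL_elSL (e : m ≃ n) (i j : m) (hij : i ≠ j) (r : S) :
    (reindexSL e (elSL i j r) : Matrix n n S) = Matrix.transvection (e i) (e j) r := by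
  ext k l
  rw [reindexSL_apply]
  change rowMat i (Pi.single j r) _ _ = _
  rw [rowMat_single hij]
  simp [Matrix.transvection, Matrix.one_apply, Matrix.single_apply, Equiv.eq_symm_apply]

end

theorem iConn_iff {a b : ℕ} {i j : Fin (a + b)} (hij : i < j) :
    IConn (Set.Icc 1 (a + b - 1) \ {a}) i j ↔ j.val < a ∨ a ≤ i.val := by
  have hj := j.2
  have hij' : i.val < j.val := hij
  constructor
  · intro h
    by_contra! h'
    exact (h a (by omega) h'.1).2 rfl
  · intro h k hk1 hk2
    refine ⟨⟨by omega, by omega⟩, fun hk => ?_⟩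
    rw [Set.mem_singleton_iff] at hk
    omega

theorem map_closure_parGens (F : Type*) [Field F] (a b : ℕ) :
    (Subgroup.closure (parGens F (Fin a) (Fin b))).map
        (reindexSL finSumFinEquiv :
          _ ≃* Matrix.SpecialLinearGroup (Fin (a + b)) F[T;T⁻¹]).toMonoidHom =
      parabolic (a + b) F[T;T⁻¹] (Set.Icc 1 (a + b - 1) \ {a}) := by
  rw [MonoidHom.map_closure, parabolic]
  have key : ∀ (i j : Fin a ⊕ Fin b) (hij : ParRoot i j) (r : F[T;T⁻¹]),
      reindexSL finSumFinEquiv (elSL i j r) =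
        elemMat (finSumFinEquiv i) (finSumFinEquiv j) (finSumFinEquiv.injective.ne hij.ne) r :=
    fun i j hij r => Subtype.ext (reindexSL_elSL _ _ _ hij.ne _)
  have hroot : ∀ i j : Fin a ⊕ Fin b, i ≠ j → (ParRoot i j ↔
      finSumFinEquiv i < finSumFinEquiv j ∨ (finSumFinEquiv j < finSumFinEquiv i ∧
        IConn (Set.Icc 1 (a + b - 1) \ {a}) (finSumFinEquiv j) (finSumFinEquiv i))) := by
    intro i j hij
    rw [← and_congr_right fun h => (iConn_iff h).symm]
    rcases i with i | i <;> rcases j with j | j <;>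
      simp only [ParRoot, finSumFinEquiv_apply_left, finSumFinEquiv_apply_right, Fin.lt_def,
        Fin.val_castAdd, Fin.val_natAdd, true_iff, false_iff, ne_eq, Sum.inl.injEq,
        Sum.inr.injEq, Fin.ext_iff] at hij ⊢ <;>
      omega
  congr 1
  ext g
  constructor
  · rintro ⟨g, hg | ⟨i, j, r, hij, rfl⟩, rfl⟩
    · exact Or.inl (Or.inl (reindexSL_isDiag _ hg))
    · change reindexSL _ _ ∈ _
      rw [key i j hij]
      rcases (hroot i j hij.ne).1 hij with h | ⟨h, h'⟩
      · exact Or.inl (Or.inr ⟨_, _, h, r, rfl⟩)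
      · exact Or.inr ⟨_, _, h, r, h', rfl⟩
  · have hel : ∀ (i j : Fin (a + b)) (hij : i ≠ j) (r : F[T;T⁻¹]),
        ParRoot (finSumFinEquiv.symm i) (finSumFinEquiv.symm j) →
        elemMat i j hij r ∈
          (reindexSL finSumFinEquiv).toMonoidHom '' parGens F (Fin a) (Fin b) := by
      intro i j hij r h
      refine ⟨_, Or.inr ⟨_, _, r, h, rfl⟩, ?_⟩
      refine (key _ _ h r).trans ?_
      simp only [Equiv.apply_symm_apply]
    have hne : ∀ {i j : Fin (a + b)}, i ≠ j →
        (finSumFinEquiv.symm i : Fin a ⊕ Fin b) ≠ finSumFinEquiv.symm j := fun h =>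
      finSumFinEquiv.symm.injective.ne h
    rintro ((hg | ⟨i, j, hij, r, rfl⟩) | ⟨i, j, hij, r, hI, rfl⟩)
    · exact ⟨(reindexSL finSumFinEquiv).symm g,
        Or.inl (reindexSL_isDiag finSumFinEquiv.symm hg),
        (reindexSL finSumFinEquiv).apply_symm_apply g⟩
    · refine hel _ _ _ _ ((hroot _ _ (hne hij.ne)).2 (Or.inl ?_))
      simpa using hij
    · refine hel _ _ _ _ ((hroot _ _ (hne hij.ne')).2 (Or.inr ⟨?_, ?_⟩))
      · simpa using hij
      · simpa using hI

end

/-- Over the Laurent polynomials F[t,t⁻¹] with F a finite field, the standard maximal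
parabolic of SL_{a+b} with Levi blocks of sizes a, b ≥ 3 is finitely presented. -/
theorem maximalParabolic_laurent_finitelyPresented
    (F : Type*) [Field F] [Finite F] (a b : ℕ) (ha : 3 ≤ a) (hb : 3 ≤ b) :
    IsFinitelyPresented
      ↥(parabolic (a + b) (LaurentPolynomial F) (Set.Icc 1 (a + b - 1) \ {a})) := by
  rw [← map_closure_parGens]
  exact (isFinitelyPresented_closure_parGens (by simpa using ha) (by simpa using hb)).of_mulEquiv
    ((reindexSL finSumFinEquiv).subgroupMap _)
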